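/- The automorphism group Aut(F₂) of the free group on 2 generators is finitely generated, and it has property RD with respect to the word length associated to any finite generating set. -/

import Mathlib

/-- Convolution of finitely supported complex functions on a group:
`(f * g)(x) = ∑_y f(y) g(y⁻¹x)`. -/
noncomputable def conv {Γ : Type*} [Group Γ] (f g : Γ →₀ ℂ) : Γ →₀ ℂ :=
  f.sum fun y cy => g.sum fun z cz => Finsupp.single (y * z) (cy * cz)

/-- The ℓ² norm of a finitely supported complex function. -/
noncomputable def l2norm {Γ : Type*} (f : Γ →₀ ℂ) : ℝ :=
  Real.sqrt (f.sum fun _ c => ‖c‖ ^ 2)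

/-- Property RD of a group with respect to a length function `ℓ`. -/
def HasPropertyRD (Γ : Type*) [Group Γ] (ℓ : Γ → ℝ) : Prop :=
  ∃ P : Polynomial ℝ, ∀ r : ℝ, 0 ≤ r → ∀ f g : Γ →₀ ℂ,
    (∀ x : Γ, f x ≠ 0 → ℓ x ≤ r) →
    l2norm (conv f g) ≤ P.eval r * l2norm f * l2norm g

/-- The word length with respect to a generating set `S` (using `S ∪ S⁻¹`). -/
noncomputable def wordLength {Γ : Type*} [Group Γ] (S : Set Γ) (x : Γ) : ℕ :=
  sInf {n : ℕ | ∃ w : List Γ, w.length = n ∧ (∀ s ∈ w, s ∈ S ∨ s⁻¹ ∈ S) ∧ w.prod = x}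

namespace AutF2

open scoped ENNReal

theorem encard_biUnion_le_mul {α β : Type*} {A : Set α} {s : α → Set β} {N M : ℕ}
    (hA : A.encard ≤ N) (hs : ∀ k ∈ A, (s k).encard ≤ M) : (⋃ k ∈ A, s k).encard ≤ (N * M : ℕ) := by
  have hfin : A.Finite := Set.finite_of_encard_le_coe hA
  lift A to Finset α using hfin
  simp only [Finset.mem_coe] at *
  refine (Finset.set_encard_biUnion_le _ _).trans ((Finset.sum_le_card_nsmul _ _ _ hs).trans ?_)
  rw [Set.encard_coe_eq_coe_finsetCard] at hA
  rw [nsmul_eq_mul]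
  push_cast
  gcongr

theorem sq_tsum_mul_le {ι : Type*} (f g : ι → ℝ≥0∞) :
    (∑' i, f i * g i) ^ 2 ≤ (∑' i, f i ^ 2) * ∑' i, g i ^ 2 := by
  set C := (∑' i, f i ^ 2) * ∑' i, g i ^ 2
  have key : ∑' i, f i * g i ≤ C ^ (1 / 2 : ℝ) := by
    rw [ENNReal.tsum_eq_iSup_sum]
    refine iSup_le fun s => ?_
    refine (ENNReal.inner_le_Lp_mul_Lq s f g (p := 2) (q := 2)
      (Real.HolderConjugate.two_two)).trans ?_
    rw [← ENNReal.mul_rpow_of_nonneg _ _ (by norm_num)]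
    refine ENNReal.rpow_le_rpow ?_ (by norm_num)
    simp only [ENNReal.rpow_ofNat]
    exact mul_le_mul' (ENNReal.sum_le_tsum s) (ENNReal.sum_le_tsum s)
  calc _ ≤ (C ^ (1 / 2 : ℝ)) ^ 2 := pow_le_pow_left' key 2
    _ = C := by rw [← ENNReal.rpow_natCast, ← ENNReal.rpow_mul]; norm_num

theorem tsum_comp_le_mul_tsum {α β : Type*} (A : Set α) (π : α → β) (N : ℕ)
    (hN : ∀ z, {p | p ∈ A ∧ π p = z}.encard ≤ N) (g : β → ℝ≥0∞) :
    ∑' p : A, g (π p) ≤ N * ∑' z, g z := by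
  rw [← ENNReal.tsum_fiberwise _ (fun p : A => π p), ← ENNReal.tsum_mul_left]
  refine ENNReal.tsum_le_tsum fun z => ?_
  have h1 : ∀ b : ((fun p : A => π p) ⁻¹' {z}), g (π b.1) = g z := fun b => by
    have := b.2
    simp only [Set.mem_preimage, Set.mem_singleton_iff] at this
    rw [this]
  rw [tsum_congr h1, ENNReal.tsum_set_const]
  refine mul_le_mul' ?_ le_rfl
  have h2 : (((fun p : A => π p) ⁻¹' {z}) : Set A).encard ≤ N := by
    refine le_trans ?_ (hN z)
    rw [← Subtype.val_injective.encard_image]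
    refine Set.encard_le_encard ?_
    rintro _ ⟨p, hp, rfl⟩
    exact ⟨p.2, hp⟩
  exact_mod_cast ENat.toENNReal_le.2 h2

theorem tsum_enorm_sq {Γ : Type*} (f : Γ →₀ ℂ) :
    ∑' y, ‖f y‖ₑ ^ 2 = ENNReal.ofReal (l2norm f ^ 2) := by
  have h0 : 0 ≤ f.sum fun _ c => ‖c‖ ^ 2 := Finsupp.sum_nonneg fun _ _ => sq_nonneg _
  rw [l2norm, Real.sq_sqrt h0, Finsupp.sum,
    ENNReal.ofReal_sum_of_nonneg fun _ _ => sq_nonneg _, tsum_eq_sum (s := f.support)]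
  · refine Finset.sum_congr rfl fun y _ => ?_
    rw [← ofReal_norm, ENNReal.ofReal_pow (norm_nonneg _)]
  · intro y hy
    simp [Finsupp.notMem_support_iff.1 hy]

section TriBound

variable {Γ : Type*} [Group Γ]

/-- The trilinear form `∑ f(y) g(z) h(yz)` over the pairs `(y, z)` in `T`, in squared form,
is bounded by `C` times the product of the squared norms. -/
def TriBound (T : Set (Γ × Γ)) (C : ℕ) : Prop :=
  ∀ f g h : Γ → ℝ≥0∞, (∑' p : T, f p.1.1 * g p.1.2 * h (p.1.1 * p.1.2)) ^ 2 ≤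
    C * ((∑' y, f y ^ 2) * (∑' z, g z ^ 2) * ∑' x, h x ^ 2)

theorem TriBound.mono {T T' : Set (Γ × Γ)} {C C' : ℕ} (h : TriBound T C) (hT : T' ⊆ T)
    (hC : C ≤ C') : TriBound T' C' := by
  intro f g k
  refine (pow_le_pow_left' (ENNReal.tsum_mono_subtype
    (fun p : Γ × Γ => f p.1 * g p.2 * k (p.1 * p.2)) hT) 2).trans
    ((h f g k).trans ?_)
  gcongr

theorem TriBound.union {T T' : Set (Γ × Γ)} {C C' : ℕ} (h : TriBound T C) (h' : TriBound T' C') :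
    TriBound (T ∪ T') (4 * (C + C')) := by
  intro f g k
  refine (pow_le_pow_left' (ENNReal.tsum_union_le (fun p : Γ × Γ => f p.1 * g p.2 * k (p.1 * p.2))
    T T') 2).trans
    (((fun a b => ?_ : ∀ a b : ℝ≥0∞, (a + b) ^ 2 ≤ 4 * (a ^ 2 + b ^ 2)) _ _).trans ?_)
  · rcases le_total a b with hab | hab
    · calc (a + b) ^ 2 ≤ (b + b) ^ 2 := by gcongr
        _ = 4 * b ^ 2 := by ring
        _ ≤ _ := by gcongr; exact le_add_self
    · calc (a + b) ^ 2 ≤ (a + a) ^ 2 := by gcongr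
        _ = 4 * a ^ 2 := by ring
        _ ≤ _ := by gcongr; exact le_self_add
  push_cast
  rw [mul_assoc, add_mul]
  gcongr
  · exact h f g k
  · exact h' f g k

theorem TriBound.transpose {T : Set (Γ × Γ)} {C : ℕ} (h : TriBound T C) :
    TriBound {p | (p.1⁻¹, p.1 * p.2) ∈ T} C := by
  intro f g k
  have e : ∑' p : {p : Γ × Γ | (p.1⁻¹, p.1 * p.2) ∈ T}, f p.1.1 * g p.1.2 * k (p.1.1 * p.1.2) ≤
      ∑' p : T, f p.1.1⁻¹ * k p.1.2 * g (p.1.1 * p.1.2) := by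
    refine le_of_eq_of_le ?_ (ENNReal.tsum_comp_le_tsum_of_injective
      (f := fun p : {p : Γ × Γ | (p.1⁻¹, p.1 * p.2) ∈ T} => (⟨(p.1.1⁻¹, p.1.1 * p.1.2), p.2⟩ : T))
      ?_ _)
    · refine tsum_congr fun p => ?_
      simp only [inv_inv, inv_mul_cancel_left]
      ring
    · rintro ⟨⟨a, b⟩, _⟩ ⟨⟨c, d⟩, _⟩ h
      simp only [Subtype.mk.injEq, Prod.mk.injEq, inv_inj] at h
      obtain ⟨rfl, h⟩ := h
      simpa using h
  refine (pow_le_pow_left' e 2).trans ((h (fun y => f y⁻¹) k g).trans (le_of_eq ?_))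
  rw [(Equiv.inv Γ).tsum_eq (fun y => f y ^ 2) |> fun h => (by simpa using h :
    ∑' y, f y⁻¹ ^ 2 = ∑' y, f y ^ 2)]
  ring

theorem triBound_of_centroid {I : Type*} (T : Set (Γ × Γ)) (κ : Γ × Γ → I × Γ) (N₁ N₂ N₃ : ℕ)
    (h₁ : ∀ y, {k | ∃ p ∈ T, κ p = k ∧ p.1 = y}.encard ≤ N₁)
    (h₂ : ∀ x, {k | ∃ p ∈ T, κ p = k ∧ p.1 * p.2 = x}.encard ≤ N₂)
    (h₃ : ∀ i z, {q | ∃ p ∈ T, (κ p).1 = i ∧ p.2 = z ∧ p.1⁻¹ * (κ p).2 = q}.encard ≤ N₃) :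
    TriBound T (N₂ * (N₁ * N₃)) := by
  classical
  intro f g h
  let K : T → (I × Γ) × Γ := fun p => (κ p, p.1.1 * p.1.2)
  let A : Set ((I × Γ) × Γ) := Set.range K
  have e1 : ∑' p : T, f p.1.1 * g p.1.2 * h (p.1.1 * p.1.2) =
      ∑' k : (I × Γ) × Γ, A.indicator (fun k => h k.2) k *
        ∑' p : (K ⁻¹' {k}), f p.1.1.1 * g p.1.1.2 := by
    rw [← ENNReal.tsum_fiberwise _ K]
    refine tsum_congr fun k => ?_
    rw [← ENNReal.tsum_mul_left]
    refine tsum_congr fun p => ?_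
    have hp : K p.1 = k := p.2
    rw [Set.indicator_of_mem (show k ∈ A from ⟨p.1, hp⟩),
      show k.2 = p.1.1.1 * p.1.1.2 from (congrArg Prod.snd hp).symm]
    ring
  rw [e1]
  refine (sq_tsum_mul_le _ _).trans ?_
  have e2 : ∑' k, A.indicator (fun k => h k.2) k ^ 2 ≤ N₂ * ∑' x, h x ^ 2 := by
    have : ∑' k, A.indicator (fun k => h k.2) k ^ 2 = ∑' k : A, h k.1.2 ^ 2 := by
      rw [tsum_subtype A (fun k => h k.2 ^ 2)]
      refine tsum_congr fun k => ?_
      by_cases hk : k ∈ A <;> simp [hk]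
    rw [this]
    refine tsum_comp_le_mul_tsum A Prod.snd N₂ (fun x => ?_) (fun x => h x ^ 2)
    refine le_trans ?_ (h₂ x)
    rw [← Set.InjOn.encard_image (f := Prod.fst)]
    · refine Set.encard_le_encard ?_
      rintro _ ⟨_, ⟨hp, hx⟩, rfl⟩
      obtain ⟨p, rfl⟩ := hp
      exact ⟨p, p.2, rfl, hx⟩
    · rintro ⟨a, b⟩ ⟨_, hb⟩ ⟨c, d⟩ ⟨_, hd⟩ hac
      simp_all
  let B : I × Γ → Γ → Prop := fun k y => ∃ p ∈ T, κ p = k ∧ p.1 = y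
  have e3 : ∀ k : (I × Γ) × Γ, (∑' p : (K ⁻¹' {k}), f p.1.1.1 * g p.1.1.2) ^ 2 ≤
      ∑' p : (K ⁻¹' {k}), (∑' y, if B k.1 y then f y ^ 2 else 0) * g p.1.1.2 ^ 2 := by
    intro k
    refine (sq_tsum_mul_le _ _).trans ?_
    rw [ENNReal.tsum_mul_left]
    gcongr
    have inj : Function.Injective (fun p : (K ⁻¹' {k}) => p.1.1.1) := by
      rintro ⟨⟨⟨a, b⟩, hp⟩, hpk⟩ ⟨⟨⟨c, d⟩, hq⟩, hqk⟩ hac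
      have h1 : (κ (a, b), a * b) = k := hpk
      have h2 : (κ (c, d), c * d) = k := hqk
      have h3 := h1.trans h2.symm
      simp only [Prod.mk.injEq] at h3 hac
      subst hac
      simpa using h3.2
    refine le_of_eq_of_le ?_ (ENNReal.tsum_comp_le_tsum_of_injective inj
      (fun y => if B k.1 y then f y ^ 2 else 0))
    refine tsum_congr fun p => ?_
    have hp : K p.1 = k := p.2
    rw [if_pos ⟨p.1.1, p.1.2, congrArg Prod.fst hp, rfl⟩]
  have e4 : ∑' k : (I × Γ) × Γ, (∑' p : (K ⁻¹' {k}), f p.1.1.1 * g p.1.1.2) ^ 2 ≤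
      (N₁ * N₃ : ℕ) * ((∑' y, f y ^ 2) * ∑' z, g z ^ 2) := by
    calc _ ≤ ∑' k : (I × Γ) × Γ,
          ∑' p : (K ⁻¹' {k}), (∑' y, if B k.1 y then f y ^ 2 else 0) * g p.1.1.2 ^ 2 :=
          ENNReal.tsum_le_tsum e3
      _ = ∑' p : T, (∑' y, if B (κ p) y then f y ^ 2 else 0) * g p.1.2 ^ 2 := by
          rw [← ENNReal.tsum_fiberwise _ K]
          refine tsum_congr fun k => tsum_congr fun p => ?_
          have hp : κ p.1 = k.1 := congrArg Prod.fst p.2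
          rw [hp]
      _ = ∑' y, f y ^ 2 * ∑' p : T, (if B (κ p) y then g p.1.2 ^ 2 else 0) := by
          simp_rw [← ENNReal.tsum_mul_left, ← ENNReal.tsum_mul_right]
          rw [ENNReal.tsum_comm]
          refine tsum_congr fun y => tsum_congr fun p => ?_
          split_ifs <;> simp
      _ ≤ ∑' y, f y ^ 2 * ((N₁ * N₃ : ℕ) * ∑' z, g z ^ 2) := by
          refine ENNReal.tsum_le_tsum fun y => mul_le_mul' le_rfl ?_
          have : ∑' p : T, (if B (κ p) y then g p.1.2 ^ 2 else 0) =
              ∑' p : {p | p ∈ T ∧ B (κ p) y}, g p.1.2 ^ 2 := by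
            rw [tsum_subtype T (fun p => if B (κ p) y then g p.2 ^ 2 else 0),
              tsum_subtype {p | p ∈ T ∧ B (κ p) y} (fun p => g p.2 ^ 2)]
            refine tsum_congr fun p => ?_
            by_cases h1 : p ∈ T <;> by_cases h2 : B (κ p) y <;> simp [h1, h2]
          rw [this]
          refine tsum_comp_le_mul_tsum _ Prod.snd _ (fun z => ?_) (fun z => g z ^ 2)
          have hsub : {p | p ∈ {p | p ∈ T ∧ B (κ p) y} ∧ p.2 = z} ⊆
              ⋃ k ∈ {k | B k y}, {p | p ∈ T ∧ κ p = k ∧ p.2 = z} := by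
            rintro p ⟨⟨hp, hB⟩, hz⟩
            simp only [Set.mem_iUnion]
            exact ⟨κ p, hB, hp, rfl, hz⟩
          refine (Set.encard_le_encard hsub).trans ?_
          have hk : ∀ k, {p | p ∈ T ∧ κ p = k ∧ p.2 = z}.encard ≤ N₃ := by
            intro k
            refine le_trans ?_ (h₃ k.1 z)
            rw [← Set.InjOn.encard_image (f := fun p : Γ × Γ => p.1⁻¹ * k.2)]
            · refine Set.encard_le_encard ?_
              rintro _ ⟨p, ⟨h1, rfl, h3⟩, rfl⟩
              exact ⟨p, h1, rfl, h3, rfl⟩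
            · rintro ⟨a, b⟩ ⟨_, _, hb⟩ ⟨c, d⟩ ⟨_, _, hd⟩ hac
              simp_all
          exact encard_biUnion_le_mul (h₁ y) fun k _ => hk k
      _ = _ := by
          rw [ENNReal.tsum_mul_right]
          ring
  calc _ ≤ (N₂ * ∑' x, h x ^ 2) * ((N₁ * N₃ : ℕ) * ((∑' y, f y ^ 2) * ∑' z, g z ^ 2)) :=
        mul_le_mul' e2 e4
    _ = _ := by push_cast; ring

theorem triBound_of_extension {N Q : Type*} [Group N] [Group Q] (j : N →* Γ) (π : Γ →* Q)
    (hj : Function.Injective j) (hπ : Function.Surjective π)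
    (hker : ∀ g, π g = 1 → ∃ n, j n = g) (hjπ : ∀ n, π (j n) = 1)
    (B : Set Γ) (C₁ C₂ : ℕ)
    (h₁ : TriBound {p : N × N | ∃ b ∈ B, ∃ b' ∈ B, j p.1 = b⁻¹ * b'} C₁)
    (h₂ : TriBound {p : Q × Q | p.1 ∈ π '' B} C₂) :
    TriBound {p : Γ × Γ | p.1 ∈ B} (C₁ * C₂) := by
  classical
  intro f g h
  have ht : ∀ q, ∃ t, π t = q ∧ (q ∈ π '' B → t ∈ B) := by
    intro q
    by_cases hq : q ∈ π '' B
    · obtain ⟨b, hb, rfl⟩ := hq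
      exact ⟨b, rfl, fun _ => hb⟩
    · obtain ⟨t, rfl⟩ := hπ q
      exact ⟨t, rfl, fun h => absurd h hq⟩
  choose t ht htB using ht
  have hν : ∀ g, ∃ n, π g = 1 → j n = g := by
    intro g
    by_cases hg : π g = 1
    · obtain ⟨n, hn⟩ := hker g hg
      exact ⟨n, fun _ => hn⟩
    · exact ⟨1, fun h => absurd h hg⟩
  choose ν hν using hν
  set T : Set (Γ × Γ) := {p | p.1 ∈ B}
  set TQ : Set (Q × Q) := {p | p.1 ∈ π '' B}
  let sq : (Γ → ℝ≥0∞) → Q → ℝ≥0∞ := fun f q => ∑' x : π ⁻¹' {q}, f x ^ 2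
  have sq_tsum : ∀ f, ∑' q, (sq f q ^ (1 / 2 : ℝ)) ^ 2 = ∑' x, f x ^ 2 := by
    intro f
    rw [← ENNReal.tsum_fiberwise (fun x => f x ^ 2) π]
    refine tsum_congr fun q => ?_
    rw [← ENNReal.rpow_natCast, ← ENNReal.rpow_mul]
    norm_num [sq]
  have sq_le : ∀ (f : Γ → ℝ≥0∞) (a b : Γ) (q : Q), π a * π b = q →
      ∑' n, f (a * j n * b) ^ 2 ≤ sq f q := by
    intro f a b q hq
    refine le_of_eq_of_le ?_ (ENNReal.tsum_comp_le_tsum_of_injective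
      (f := fun n : N => (⟨a * j n * b, by simp [hjπ, hq]⟩ : π ⁻¹' {q})) ?_ _)
    · rfl
    · intro n m hnm
      simpa [hj.eq_iff] using hnm
  let K : T → Q × Q := fun p => (π p.1.1, π p.1.2)
  have fib : ∀ k : Q × Q, k ∈ TQ →
      (∑' p : K ⁻¹' {k}, f p.1.1.1 * g p.1.1.2 * h (p.1.1.1 * p.1.1.2)) ^ 2 ≤
        C₁ * (sq f k.1 * sq g k.2 * sq h (k.1 * k.2)) := by
    rintro ⟨q, q'⟩ hk
    have hp1 : ∀ p : K ⁻¹' {(q, q')}, t q * j (ν ((t q)⁻¹ * p.1.1.1)) = p.1.1.1 := by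
      intro p
      have : π p.1.1.1 = q := congrArg Prod.fst p.2
      rw [hν _ (by simp [ht, this])]
      simp
    have hp2 : ∀ p : K ⁻¹' {(q, q')}, j (ν (p.1.1.2 * (t q')⁻¹)) * t q' = p.1.1.2 := by
      intro p
      have : π p.1.1.2 = q' := congrArg Prod.snd p.2
      rw [hν _ (by simp [ht, this])]
      simp
    let TN : Set (N × N) := {p : N × N | ∃ b ∈ B, ∃ b' ∈ B, j p.1 = b⁻¹ * b'}
    let φ : K ⁻¹' {(q, q')} → TN := fun p =>
      ⟨(ν ((t q)⁻¹ * p.1.1.1), ν (p.1.1.2 * (t q')⁻¹)), t q, htB q hk, p.1.1.1, p.1.2, by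
        rw [eq_inv_mul_iff_mul_eq]
        exact hp1 p⟩
    have hφ : Function.Injective φ := by
      intro p p' hpp
      have e1 : ν ((t q)⁻¹ * p.1.1.1) = ν ((t q)⁻¹ * p'.1.1.1) :=
        congrArg (fun x : TN => x.1.1) hpp
      have e2 : ν (p.1.1.2 * (t q')⁻¹) = ν (p'.1.1.2 * (t q')⁻¹) :=
        congrArg (fun x : TN => x.1.2) hpp
      refine Subtype.ext (Subtype.ext (Prod.ext ?_ ?_))
      · rw [← hp1 p, ← hp1 p', e1]
      · rw [← hp2 p, ← hp2 p', e2]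
    have le1 : ∑' p : K ⁻¹' {(q, q')}, f p.1.1.1 * g p.1.1.2 * h (p.1.1.1 * p.1.1.2) ≤
        ∑' p : TN, f (t q * j p.1.1 * 1) * g (1 * j p.1.2 * t q') *
          h (t q * j (p.1.1 * p.1.2) * t q') := by
      refine le_of_eq_of_le ?_ (ENNReal.tsum_comp_le_tsum_of_injective hφ _)
      refine tsum_congr fun p => ?_
      have e3 : t q * j (ν ((t q)⁻¹ * p.1.1.1) * ν (p.1.1.2 * (t q')⁻¹)) * t q' =
          p.1.1.1 * p.1.1.2 := by
        rw [map_mul, ← mul_assoc, hp1, mul_assoc, hp2]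
      simp only [φ, e3, mul_one, one_mul, hp1, hp2]
    refine (pow_le_pow_left' le1 2).trans ((h₁ (fun n => f (t q * j n * 1))
      (fun n => g (1 * j n * t q')) (fun n => h (t q * j n * t q'))).trans ?_)
    gcongr
    · exact sq_le f _ _ _ (by simp [ht])
    · exact sq_le g _ _ _ (by simp [ht])
    · exact sq_le h _ _ _ (by simp [ht])
  let r : ℝ≥0∞ → ℝ≥0∞ := fun x => x ^ (1 / 2 : ℝ)
  have r_mul : ∀ x y, r (x * y) = r x * r y := fun x y =>
    ENNReal.mul_rpow_of_nonneg _ _ (by norm_num)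
  have r_sq : ∀ x, r x ^ 2 = x := fun x => by
    simp only [r]
    rw [← ENNReal.rpow_natCast, ← ENNReal.rpow_mul]
    norm_num
  have r_le : ∀ x y, x ^ 2 ≤ y → x ≤ r y := fun x y hxy => by
    have := ENNReal.rpow_le_rpow hxy (by norm_num : (0 : ℝ) ≤ 1 / 2)
    rwa [← ENNReal.rpow_natCast, ← ENNReal.rpow_mul, Nat.cast_ofNat,
      mul_one_div_cancel (by norm_num), ENNReal.rpow_one] at this
  have main : ∑' p : T, f p.1.1 * g p.1.2 * h (p.1.1 * p.1.2) ≤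
      r C₁ * ∑' k : TQ, r (sq f k.1.1) * r (sq g k.1.2) * r (sq h (k.1.1 * k.1.2)) := by
    rw [← ENNReal.tsum_fiberwise _ K, ← ENNReal.tsum_mul_left,
      tsum_subtype TQ (fun k => r C₁ * (r (sq f k.1) * r (sq g k.2) * r (sq h (k.1 * k.2))))]
    refine ENNReal.tsum_le_tsum fun k => ?_
    by_cases hk : k ∈ TQ
    · rw [Set.indicator_of_mem hk, ← r_mul, ← r_mul, ← r_mul]
      exact r_le _ _ (fib k hk)
    · have : IsEmpty (K ⁻¹' {k}) := ⟨fun p => hk ⟨p.1.1.1, p.1.2, congrArg Prod.fst p.2⟩⟩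
      simp
  calc _ ≤ (r C₁ * ∑' k : TQ, r (sq f k.1.1) * r (sq g k.1.2) * r (sq h (k.1.1 * k.1.2))) ^ 2 :=
        pow_le_pow_left' main 2
    _ ≤ C₁ * (C₂ * ((∑' y, r (sq f y) ^ 2) * (∑' z, r (sq g z) ^ 2) * ∑' x, r (sq h x) ^ 2)) := by
        rw [mul_pow, r_sq]
        exact mul_le_mul' le_rfl (h₂ (fun q => r (sq f q)) _ _)
    _ = _ := by
        simp only [r, sq_tsum]
        push_cast
        ring

theorem l2norm_conv_le (T : Set Γ) (C : ℕ) (hT : TriBound {p : Γ × Γ | p.1 ∈ T} C) (f g : Γ →₀ ℂ)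
    (hf : ∀ x, f x ≠ 0 → x ∈ T) : l2norm (conv f g) ≤ C * l2norm f * l2norm g := by
  classical
  set h := conv f g with hh
  set S := ∑' x, ‖h x‖ₑ ^ 2 with hS
  have hx : ∀ x, ‖h x‖ₑ ≤ ∑ y ∈ f.support, ∑ z ∈ g.support,
      if y * z = x then ‖f y‖ₑ * ‖g z‖ₑ else 0 := by
    intro x
    simp only [hh, conv, Finsupp.sum, Finsupp.finsetSum_apply, Finsupp.single_apply]
    refine (enorm_sum_le _ _).trans (Finset.sum_le_sum fun y _ => ?_)
    refine (enorm_sum_le _ _).trans (Finset.sum_le_sum fun z _ => ?_)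
    split_ifs <;> simp
  have le1 : S ≤ ∑' p : {p : Γ × Γ | p.1 ∈ T}, ‖f p.1.1‖ₑ * ‖g p.1.2‖ₑ * ‖h (p.1.1 * p.1.2)‖ₑ := by
    calc S = ∑' x, ‖h x‖ₑ * ‖h x‖ₑ := by simp only [hS, sq]
      _ ≤ ∑' x, (∑ y ∈ f.support, ∑ z ∈ g.support,
          if y * z = x then ‖f y‖ₑ * ‖g z‖ₑ else 0) * ‖h x‖ₑ :=
          ENNReal.tsum_le_tsum fun x => mul_le_mul' (hx x) le_rfl
      _ = ∑ y ∈ f.support, ∑ z ∈ g.support, ‖f y‖ₑ * ‖g z‖ₑ * ‖h (y * z)‖ₑ := by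
          simp_rw [Finset.sum_mul]
          rw [Summable.tsum_finsetSum fun _ _ => ENNReal.summable]
          refine Finset.sum_congr rfl fun y _ => ?_
          rw [Summable.tsum_finsetSum fun _ _ => ENNReal.summable]
          refine Finset.sum_congr rfl fun z _ => ?_
          rw [tsum_eq_single (y * z)]
          · simp
          · intro x hx
            simp [hx.symm]
      _ = ∑ p ∈ f.support ×ˢ g.support, {p : Γ × Γ | p.1 ∈ T}.indicator
            (fun p => ‖f p.1‖ₑ * ‖g p.2‖ₑ * ‖h (p.1 * p.2)‖ₑ) p := by
          rw [Finset.sum_product]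
          refine Finset.sum_congr rfl fun y hy => Finset.sum_congr rfl fun z _ => ?_
          rw [Set.indicator_of_mem]
          exact hf y (Finsupp.mem_support_iff.1 hy)
      _ ≤ _ := by
          rw [tsum_subtype {p : Γ × Γ | p.1 ∈ T}
            (fun p => ‖f p.1‖ₑ * ‖g p.2‖ₑ * ‖h (p.1 * p.2)‖ₑ)]
          exact ENNReal.sum_le_tsum _
  have le2 := (pow_le_pow_left' le1 2).trans
    (hT (fun y => ‖f y‖ₑ) (fun y => ‖g y‖ₑ) fun y => ‖h y‖ₑ)
  rw [← hS, tsum_enorm_sq, tsum_enorm_sq] at le2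
  rw [hS, tsum_enorm_sq, ← ENNReal.ofReal_natCast, ← ENNReal.ofReal_mul (by positivity),
    ← ENNReal.ofReal_mul (by positivity), ← ENNReal.ofReal_mul (by positivity),
    ← ENNReal.ofReal_pow (by positivity), ENNReal.ofReal_le_ofReal_iff (by positivity)] at le2
  have n0 : ∀ k : Γ →₀ ℂ, 0 ≤ l2norm k := fun k => Real.sqrt_nonneg _
  have hf0 := n0 f
  have hg0 := n0 g
  rcases (n0 h).eq_or_lt with h0 | h0
  · rw [← h0]
    positivity
  · refine le_of_sq_le_sq ?_ (by positivity)
    have le3 : l2norm h ^ 2 ≤ C * (l2norm f ^ 2 * l2norm g ^ 2) := by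
      have : 0 < l2norm h ^ 2 := by positivity
      nlinarith
    have hC : (C : ℝ) ≤ C ^ 2 := by
      exact_mod_cast Nat.le_self_pow two_ne_zero C
    calc _ ≤ _ := le3
      _ ≤ C ^ 2 * (l2norm f ^ 2 * l2norm g ^ 2) := by gcongr
      _ = _ := by ring

theorem hasPropertyRD_of_triBound (ℓ : Γ → ℕ) (A k : ℕ)
    (h : ∀ n, TriBound {p : Γ × Γ | ℓ p.1 ≤ n} (A * (n + 1) ^ k)) :
    HasPropertyRD Γ (fun x => (ℓ x : ℝ)) := by
  refine ⟨Polynomial.C (A : ℝ) * (Polynomial.X + 1) ^ k, fun r hr f g hf => ?_⟩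
  have := l2norm_conv_le {x | ℓ x ≤ ⌊r⌋₊} _ (h ⌊r⌋₊) f g fun x hx => Nat.le_floor (hf x hx)
  refine this.trans ?_
  have n0 : ∀ k : Γ →₀ ℂ, 0 ≤ l2norm k := fun k => Real.sqrt_nonneg _
  have hf0 := n0 f
  have hg0 := n0 g
  simp only [Polynomial.eval_mul, Polynomial.eval_C, Polynomial.eval_pow, Polynomial.eval_add,
    Polynomial.eval_X, Polynomial.eval_one]
  push_cast
  gcongr
  exact Nat.floor_le hr

end TriBound

/-- The free group on two generators. -/
abbrev F := FreeGroup (Fin 2)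

/-- A generator together with an exponent sign. -/
abbrev Letter := Fin 2 × Bool

/-- The inverse letter. -/
def linv (l : Letter) : Letter := (l.1, !l.2)

@[simp] theorem linv_linv (l : Letter) : linv (linv l) = l := by simp [linv]

theorem linv_ne (l : Letter) : linv l ≠ l := by
  revert l; unfold linv; decide

theorem eq_or_eq_linv {l m : Letter} (h : l.1 = m.1) : l = m ∨ l = linv m := by
  revert l m; unfold linv; decide

theorem eq_linv_or_of_ne {l m : Letter} (h : m ≠ l) : m = linv l ∨ l.1 ≠ m.1 := by
  revert l m; unfold linv; decide

theorem eq_or_of_ne_linv {l m : Letter} (h : m ≠ linv l) : m = l ∨ l.1 ≠ m.1 := by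
  revert l m; unfold linv; decide

theorem fst_eq_of_ne {l m n : Letter} (h : l.1 ≠ m.1) (h' : l.1 ≠ n.1) : n.1 = m.1 := by
  revert l m n; decide

/-- A letter as an element of the free group. -/
def lt (l : Letter) : F := FreeGroup.mk [l]

theorem lt_linv (l : Letter) : lt (linv l) = (lt l)⁻¹ := by
  simp [lt, linv, FreeGroup.inv_mk, FreeGroup.invRev]

/-- The first letter of the reduced word. -/
def hd (g : F) : Option Letter := g.toWord.head?

theorem hd_eq_none {g : F} : hd g = none ↔ g = 1 := by
  simp [hd, List.head?_eq_none_iff]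

@[simp] theorem hd_one : hd 1 = none := by simp [hd]

theorem toWord_lt (l : Letter) : (lt l).toWord = [l] := by
  simp [lt, FreeGroup.toWord_mk]

@[simp] theorem hd_lt (l : Letter) : hd (lt l) = some l := by simp [hd, toWord_lt]

/-- No cancellation in `g⁻¹ * h`. -/
def Sep (g h : F) : Prop := ∀ l, hd g = some l → hd h ≠ some l

theorem Sep.symm {g h : F} (H : Sep g h) : Sep h g := fun l h₁ h₂ => H l h₂ h₁

theorem hd_inv (g : F) : hd g⁻¹ = g.toWord.getLast?.map linv := by
  rw [hd, FreeGroup.toWord_inv, FreeGroup.invRev, List.head?_reverse, List.getLast?_map]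
  rfl

theorem toWord_mul_of_sep {u v : F} (h : Sep u⁻¹ v) :
    (u * v).toWord = u.toWord ++ v.toWord := by
  rw [FreeGroup.toWord_mul]
  apply FreeGroup.IsReduced.reduce_eq
  unfold FreeGroup.IsReduced
  rw [List.isChain_append]
  refine ⟨FreeGroup.isReduced_toWord, FreeGroup.isReduced_toWord, ?_⟩
  intro x hx y hy hxy
  by_contra hne
  refine h (linv x) ?_ ?_
  · rw [hd_inv, Option.mem_def.1 hx]; rfl
  · rw [hd, Option.mem_def.1 hy]
    congr 1
    rcases x with ⟨i, s⟩
    rcases y with ⟨j, t⟩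
    cases s <;> cases t <;> simp_all [linv]

theorem sep_of_toWord_mul {u v : F} (h : (u * v).toWord = u.toWord ++ v.toWord) : Sep u⁻¹ v := by
  intro l h₁ h₂
  have hr : FreeGroup.IsReduced (u.toWord ++ v.toWord) := h ▸ FreeGroup.isReduced_toWord
  unfold FreeGroup.IsReduced at hr
  rw [List.isChain_append] at hr
  rw [hd_inv, Option.map_eq_some_iff] at h₁
  obtain ⟨x, hx, rfl⟩ := h₁
  have := hr.2.2 x hx (linv x) h₂ rfl
  simp [linv] at this

theorem toWord_inv_mul_of_sep {g h : F} (H : Sep g h) :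
    (g⁻¹ * h).toWord = FreeGroup.invRev g.toWord ++ h.toWord := by
  rw [toWord_mul_of_sep (by simpa using H), FreeGroup.toWord_inv]

theorem toWord_lt_mul {l : Letter} {g : F} (h : hd g ≠ some (linv l)) :
    (lt l * g).toWord = l :: g.toWord := by
  rw [toWord_mul_of_sep, toWord_lt]; · rfl
  intro m hm
  rw [← lt_linv, hd_lt] at hm
  rwa [← hm]

theorem hd_lt_mul {l : Letter} {g : F} (h : hd g ≠ some (linv l)) : hd (lt l * g) = some l := by
  rw [hd, toWord_lt_mul h]; rfl

theorem exists_of_toWord_eq {l : Letter} {g : F} {w : List Letter} (h : g.toWord = l :: w) :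
    g = lt l * FreeGroup.mk w ∧ (FreeGroup.mk w).toWord = w ∧
      hd (FreeGroup.mk w) ≠ some (linv l) := by
  have hr : FreeGroup.IsReduced (l :: w) := h ▸ FreeGroup.isReduced_toWord
  have hw : (FreeGroup.mk w).toWord = w := by
    rw [FreeGroup.toWord_mk]
    exact FreeGroup.IsReduced.reduce_eq (List.IsChain.tail hr)
  refine ⟨?_, hw, ?_⟩
  · rw [← FreeGroup.mk_toWord (x := g), h, lt, FreeGroup.mul_mk]; rfl
  · rw [hd, hw]
    intro h'
    cases w with
    | nil => simp at h'
    | cons m w =>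
      simp only [List.head?_cons, Option.some.injEq] at h'
      subst h'
      unfold FreeGroup.IsReduced at hr
      rw [List.isChain_cons_cons] at hr
      simp [linv] at hr

theorem exists_of_hd_eq {l : Letter} {g : F} (h : hd g = some l) :
    ∃ k, g = lt l * k ∧ hd k ≠ some (linv l) ∧ g.toWord = l :: k.toWord := by
  obtain ⟨w, hw⟩ : ∃ w, g.toWord = l :: w := List.head?_eq_some_iff.1 h
  obtain ⟨h₁, h₂, h₃⟩ := exists_of_toWord_eq hw
  exact ⟨_, h₁, h₃, by rw [hw, h₂]⟩

theorem hd_cases (g : F) : g = 1 ∨ ∃ l k, g = lt l * k ∧ hd k ≠ some (linv l) ∧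
    g.toWord = l :: k.toWord := by
  cases h : hd g with
  | none => exact Or.inl (hd_eq_none.1 h)
  | some l =>
    obtain ⟨k, hk⟩ := exists_of_hd_eq h
    exact Or.inr ⟨l, k, hk⟩

@[elab_as_elim]
theorem word_induction {P : F → Prop} (h1 : P 1)
    (hl : ∀ l g, hd g ≠ some (linv l) → P g → P (lt l * g)) (g : F) : P g := by
  induction hn : g.toWord.length generalizing g with
  | zero =>
    rw [List.length_eq_zero_iff, FreeGroup.toWord_eq_nil_iff] at hn
    exact hn ▸ h1
  | succ n ih =>
    rcases hd_cases g with rfl | ⟨l, k, rfl, hk, hw⟩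
    · exact h1
    · exact hl l k hk (ih k (by simpa [hw] using hn))

theorem isPrefix_iff_sep {p g : F} : p.toWord <+: g.toWord ↔ Sep p⁻¹ (p⁻¹ * g) := by
  constructor
  · rintro ⟨w, hw⟩
    have hr : FreeGroup.IsReduced (p.toWord ++ w) := hw ▸ FreeGroup.isReduced_toWord
    have hw' : (FreeGroup.mk w).toWord = w := by
      rw [FreeGroup.toWord_mk]
      refine FreeGroup.IsReduced.reduce_eq ?_
      exact (List.isChain_append.1 hr).2.1
    have hg : g = p * FreeGroup.mk w := by
      rw [← FreeGroup.mk_toWord (x := g), ← hw, ← FreeGroup.mul_mk, FreeGroup.mk_toWord]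
    apply sep_of_toWord_mul
    rw [mul_inv_cancel_left, ← hw, hg, inv_mul_cancel_left, hw']
  · intro h
    have := toWord_mul_of_sep h
    rw [mul_inv_cancel_left] at this
    rw [this]
    exact List.prefix_append _ _

theorem toWord_of_isPrefix {p g : F} (h : p.toWord <+: g.toWord) :
    g.toWord = p.toWord ++ (p⁻¹ * g).toWord := by
  rw [← toWord_mul_of_sep (isPrefix_iff_sep.1 h), mul_inv_cancel_left]

/-- Elements of the free group given by prefixes of a reduced word. -/
theorem exists_toWord_eq_of_isPrefix {w : List Letter} {g : F} (h : w <+: g.toWord) :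
    ∃ p : F, p.toWord = w := by
  refine ⟨FreeGroup.mk w, ?_⟩
  rw [FreeGroup.toWord_mk]
  obtain ⟨t, ht⟩ := h
  have hr : FreeGroup.IsReduced (w ++ t) := ht ▸ FreeGroup.isReduced_toWord
  exact FreeGroup.IsReduced.reduce_eq (List.isChain_append.1 hr).1

/-- A signed relabelling of the generators acts letterwise on reduced words. -/
theorem toWord_relabel {θ : F →* F} {e : Letter → Letter} (he : Function.Injective e)
    (hi : ∀ l, e (linv l) = linv (e l)) (hθ : ∀ l, θ (lt l) = lt (e l)) (g : F) :
    (θ g).toWord = g.toWord.map e := by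
  induction g using word_induction with
  | h1 => simp
  | hl l g hg ih =>
    rw [map_mul, hθ, toWord_lt_mul, toWord_lt_mul hg, ih, List.map_cons]
    rw [hd, ih, List.head?_map, ← hi]
    intro h
    rw [Option.map_eq_some_iff] at h
    obtain ⟨x, hx, hx'⟩ := h
    exact hg (hx.trans (congrArg some (he hx')))

/-- The automorphism group of the free group on two generators. -/
abbrev G := MulAut F

/-- The first generator. -/
def a : F := FreeGroup.of 0

/-- The second generator. -/
def b : F := FreeGroup.of 1

/-- The endomorphism with given values on the generators. -/
def endo (x y : F) : F →* F := FreeGroup.lift ![x, y]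

@[simp] theorem endo_a (x y : F) : endo x y a = x := by simp [endo, a]

@[simp] theorem endo_b (x y : F) : endo x y b = y := by simp [endo, b]

theorem hom_ext {H : Type*} [Group H] {f g : F →* H} (ha : f a = g a) (hb : f b = g b) :
    f = g := by
  apply FreeGroup.ext_hom
  intro i
  fin_cases i
  · exact ha
  · exact hb

theorem aut_ext {f g : G} (ha : f a = g a) (hb : f b = g b) : f = g := by
  have : f.toMonoidHom = g.toMonoidHom := hom_ext ha hb
  ext x
  exact DFunLike.congr_fun this x

/-- The automorphism with given values on the generators and given inverse. -/
def mkAut (x y x' y' : F) (h : endo x' y' x = a ∧ endo x' y' y = b ∧ endo x y x' = a ∧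
    endo x y y' = b) : G :=
  MonoidHom.toMulEquiv (endo x y) (endo x' y')
    (hom_ext (by simpa using h.1) (by simpa using h.2.1))
    (hom_ext (by simpa using h.2.2.1) (by simpa using h.2.2.2))

@[simp] theorem mkAut_a (x y x' y' : F) (h) : mkAut x y x' y' h a = x := by
  simp [mkAut]

@[simp] theorem mkAut_b (x y x' y' : F) (h) : mkAut x y x' y' h b = y := by
  simp [mkAut]

@[simp] theorem mkAut_inv_a (x y x' y' : F) (h) : (mkAut x y x' y' h)⁻¹ a = x' := by
  simp [mkAut, MulAut.inv_def]

@[simp] theorem mkAut_inv_b (x y x' y' : F) (h) : (mkAut x y x' y' h)⁻¹ b = y' := by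
  simp [mkAut, MulAut.inv_def]

/-- The elementary automorphism `a ↦ a, b ↦ ab`. -/
def autL : G := mkAut a (a * b) a (a⁻¹ * b) (by simp)

/-- The elementary automorphism `a ↦ ab, b ↦ b`. -/
def autR : G := mkAut (a * b) b (a * b⁻¹) b (by simp)

/-- The automorphism `b ↦ b⁻¹`. -/
def flipB : G := mkAut a b⁻¹ a b⁻¹ (by simp)

/-- The automorphism `a ↦ a⁻¹`. -/
def flipA : G := mkAut a⁻¹ b a⁻¹ b (by simp)

/-- The automorphism `a ↦ b⁻¹, b ↦ a⁻¹`. -/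
def swapInv : G := mkAut b⁻¹ a⁻¹ b⁻¹ a⁻¹ (by simp)

@[simp] theorem autL_a : autL a = a := mkAut_a ..
@[simp] theorem autL_b : autL b = a * b := mkAut_b ..
@[simp] theorem autL_symm_a : MulEquiv.symm autL a = a := mkAut_inv_a ..
@[simp] theorem autL_symm_b : MulEquiv.symm autL b = a⁻¹ * b := mkAut_inv_b ..
@[simp] theorem autR_a : autR a = a * b := mkAut_a ..
@[simp] theorem autR_b : autR b = b := mkAut_b ..
@[simp] theorem autR_symm_a : MulEquiv.symm autR a = a * b⁻¹ := mkAut_inv_a ..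
@[simp] theorem autR_symm_b : MulEquiv.symm autR b = b := mkAut_inv_b ..
@[simp] theorem flipB_a : flipB a = a := mkAut_a ..
@[simp] theorem flipB_b : flipB b = b⁻¹ := mkAut_b ..
@[simp] theorem flipA_a : flipA a = a⁻¹ := mkAut_a ..
@[simp] theorem flipA_b : flipA b = b := mkAut_b ..
@[simp] theorem swapInv_a : swapInv a = b⁻¹ := mkAut_a ..
@[simp] theorem swapInv_b : swapInv b = a⁻¹ := mkAut_b ..

theorem flipB_mul_self : flipB * flipB = 1 := aut_ext (by simp) (by simp)
theorem flipA_mul_self : flipA * flipA = 1 := aut_ext (by simp) (by simp)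
theorem swapInv_mul_self : swapInv * swapInv = 1 := aut_ext (by simp) (by simp)
theorem flipB_inv : flipB⁻¹ = flipB := inv_eq_of_mul_eq_one_left flipB_mul_self
theorem swapInv_inv : swapInv⁻¹ = swapInv := inv_eq_of_mul_eq_one_left swapInv_mul_self

theorem autR_eq : autR = swapInv * autL * swapInv := aut_ext (by simp) (by simp)
theorem autL_inv_eq : autL⁻¹ = flipA * autL * flipA := aut_ext (by simp) (by simp)

theorem a_eq : a = lt (0, true) := rfl
theorem b_eq : b = lt (1, true) := rfl
theorem a_inv_eq : a⁻¹ = lt (0, false) := (lt_linv (0, true)).symm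
theorem b_inv_eq : b⁻¹ = lt (1, false) := (lt_linv (1, true)).symm
@[simp] theorem lt_a : lt (0, true) = a := rfl
@[simp] theorem lt_b : lt (1, true) = b := rfl
@[simp] theorem lt_a_inv : lt (0, false) = a⁻¹ := a_inv_eq.symm
@[simp] theorem lt_b_inv : lt (1, false) = b⁻¹ := b_inv_eq.symm

theorem letter_cases (l : Letter) : l = (0, true) ∨ l = (0, false) ∨ l = (1, true) ∨
    l = (1, false) := by
  revert l; decide

/-- Automorphisms preserving the word length, that is, signed permutations of the generators. -/
def signed : Subgroup G where
  carrier := {θ | ∀ g, (θ g).norm = g.norm}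
  mul_mem' {x y} hx hy g := by rw [MulAut.mul_apply, hx, hy]
  one_mem' _ := rfl
  inv_mem' {x} hx g := by rw [← hx, MulAut.apply_inv_self]

theorem norm_lt (l : Letter) : (lt l).norm = 1 := by simp [FreeGroup.norm, toWord_lt]

theorem exists_lt_of_norm_eq_one {g : F} (h : g.norm = 1) : ∃ l, g = lt l := by
  obtain ⟨l, hl⟩ := List.length_eq_one_iff.1 h
  exact ⟨l, FreeGroup.toWord_injective (by rw [hl, toWord_lt])⟩

theorem norm_lt_mul_lt (l m : Letter) : (lt l * lt m).norm = if m = linv l then 0 else 2 := by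
  split_ifs with h
  · rw [h, lt_linv]; simp
  · rw [FreeGroup.norm, toWord_lt_mul (by simpa using h), toWord_lt]; rfl

/-- A signed automorphism is determined by the images of the two generators, which are letters
of distinct generators. -/
theorem exists_of_mem_signed {σ : G} (h : σ ∈ signed) :
    ∃ l m : Letter, σ a = lt l ∧ σ b = lt m ∧ l.1 ≠ m.1 := by
  obtain ⟨l, hl⟩ := exists_lt_of_norm_eq_one (g := σ a) (by rw [h]; exact norm_lt (0, true))
  obtain ⟨m, hm⟩ := exists_lt_of_norm_eq_one (g := σ b) (by rw [h]; exact norm_lt (1, true))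
  refine ⟨l, m, hl, hm, fun hlm => ?_⟩
  have h₁ : (lt l * lt m).norm = 2 := by
    rw [← hl, ← hm, ← map_mul, h, a_eq, b_eq, norm_lt_mul_lt]; rfl
  have h₂ : (lt l * lt (linv m)).norm = 2 := by
    rw [lt_linv, ← hl, ← hm, ← map_inv, ← map_mul, h, a_eq, b_inv_eq, norm_lt_mul_lt]; rfl
  rw [norm_lt_mul_lt] at h₁ h₂
  obtain ⟨i, s⟩ := l
  obtain ⟨j, t⟩ := m
  simp only at hlm
  subst hlm
  revert h₁ h₂
  cases s <;> cases t <;> simp [linv]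

/-- The action on letters of the signed automorphism with given images of the generators. -/
def relabel (l m : Letter) (x : Letter) : Letter :=
  let y := if x.1 = 0 then l else m
  (y.1, y.2 == x.2)

theorem relabel_injective {l m : Letter} (h : l.1 ≠ m.1) : Function.Injective (relabel l m) := by
  revert l m; unfold Function.Injective relabel; decide

theorem relabel_linv (l m x : Letter) : relabel l m (linv x) = linv (relabel l m x) := by
  revert l m x; unfold linv relabel; decide

theorem apply_lt_of_relabel {f : F →* F} {l m : Letter} (ha : f a = lt l) (hb : f b = lt m)
    (x : Letter) : f (lt x) = lt (relabel l m x) := by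
  have key : ∀ l : Letter, lt (l.1, !l.2) = (lt l)⁻¹ := lt_linv
  rcases letter_cases x with rfl | rfl | rfl | rfl <;>
    simp [relabel, ha, hb, ← key]

theorem toWord_signed {f : F →* F} {l m : Letter} (ha : f a = lt l) (hb : f b = lt m)
    (hlm : l.1 ≠ m.1) (g : F) : (f g).toWord = g.toWord.map (relabel l m) :=
  toWord_relabel (relabel_injective hlm) (relabel_linv l m) (apply_lt_of_relabel ha hb) g

theorem mem_signed {σ : G} {l m : Letter} (ha : σ a = lt l) (hb : σ b = lt m)
    (hlm : l.1 ≠ m.1) : σ ∈ signed := fun g => by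
  rw [FreeGroup.norm, FreeGroup.norm]
  exact (congrArg List.length (toWord_signed (f := σ.toMonoidHom) ha hb hlm g)).trans
    (List.length_map _)

theorem flipA_mem : flipA ∈ signed := mem_signed (l := (0, false)) (m := (1, true))
  (by simp) (by simp) (by decide)

theorem flipB_mem : flipB ∈ signed := mem_signed (l := (0, true)) (m := (1, false))
  (by simp) (by simp) (by decide)

theorem swapInv_mem : swapInv ∈ signed := mem_signed (l := (1, false)) (m := (0, false))
  (by simp) (by simp) (by decide)

theorem signed_finite : (signed : Set G).Finite := by
  refine Set.Finite.of_injOn (t := Set.univ) (β := Option Letter × Option Letter)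
    (f := fun σ => (hd (σ a), hd (σ b))) (fun _ _ => trivial) ?_ Set.finite_univ
  intro σ hσ τ hτ h
  obtain ⟨l, m, h₁, h₂, -⟩ := exists_of_mem_signed hσ
  obtain ⟨l', m', h₁', h₂', -⟩ := exists_of_mem_signed hτ
  simp only [h₁, h₂, h₁', h₂', hd_lt, Prod.mk.injEq, Option.some.injEq] at h
  exact aut_ext (by rw [h₁, h₁', h.1]) (by rw [h₂, h₂', h.2])

/-- The inner automorphism `x ↦ g x g⁻¹`. -/
abbrev ad : F →* G := MulAut.conj

theorem mul_ad (θ : G) (g : F) : θ * ad g = ad (θ g) * θ := by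
  ext x; simp [ad, MulAut.conj_apply]

/-- Conjugating `autL` or its inverse by a signed automorphism. -/
theorem exists_conj_autL {σ : G} (hσ : σ ∈ signed) :
    ∃ t : F, (t = 1 ∨ ∃ l, t = lt l) ∧
      ∃ X ∈ ({autL, autL⁻¹, autR, autR⁻¹} : Set G), σ * autL = ad t * X * σ := by
  obtain ⟨l, m, ha, hb, hlm⟩ := exists_of_mem_signed hσ
  rcases letter_cases l with rfl | rfl | rfl | rfl <;>
    rcases letter_cases m with rfl | rfl | rfl | rfl <;> first | exact absurd rfl hlm | skip
  · exact ⟨1, .inl rfl, autL, by simp, aut_ext (by simp_all) (by simp_all)⟩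
  · exact ⟨a, .inr ⟨(0, true), rfl⟩, autL⁻¹, by simp,
      aut_ext (by simp_all [mul_assoc]) (by simp_all [mul_assoc])⟩
  · exact ⟨1, .inl rfl, autL⁻¹, by simp, aut_ext (by simp_all) (by simp_all)⟩
  · exact ⟨a⁻¹, .inr ⟨(0, false), by simp⟩, autL, by simp,
      aut_ext (by simp_all [mul_assoc]) (by simp_all [mul_assoc])⟩
  · exact ⟨b, .inr ⟨(1, true), rfl⟩, autR, by simp,
      aut_ext (by simp_all [mul_assoc]) (by simp_all [mul_assoc])⟩
  · exact ⟨1, .inl rfl, autR⁻¹, by simp, aut_ext (by simp_all) (by simp_all)⟩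
  · exact ⟨b⁻¹, .inr ⟨(1, false), by simp⟩, autR⁻¹, by simp,
      aut_ext (by simp_all [mul_assoc]) (by simp_all [mul_assoc])⟩
  · exact ⟨1, .inl rfl, autR, by simp, aut_ext (by simp_all) (by simp_all)⟩

/-- A chamber: an orientation bit and a positive word in the elementary automorphisms. -/
abbrev Chamber := Bool × List Bool

/-- The elementary automorphism with a given label. -/
def elem (x : Bool) : G := if x then autR else autL

/-- The orientation automorphism with a given bit. -/
def orient (x : Bool) : G := if x then flipB else 1

/-- The automorphism attached to a chamber. -/
def phi (ω : Chamber) : G := orient ω.1 * (ω.2.map elem).prod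

@[simp] theorem elem_true : elem true = autR := rfl
@[simp] theorem elem_false : elem false = autL := rfl

theorem phi_append (i : Bool) (u v : List Bool) :
    phi (i, u ++ v) = phi (i, u) * (v.map elem).prod := by
  simp [phi, mul_assoc]

theorem phi_concat (i : Bool) (u : List Bool) (x : Bool) :
    phi (i, u ++ [x]) = phi (i, u) * elem x := by
  simp [phi_append]

@[simp] theorem phi_false_nil : phi (false, []) = 1 := by simp [phi, orient]

theorem orient_mem (i : Bool) : orient i ∈ signed := by
  cases i
  · exact one_mem _
  · exact flipB_mem

/-- Products of at most `N` images of letters under chambers of depth at most `D`. -/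
def chamberProducts (N D : ℕ) : Set F :=
  {g | ∃ L : List (Chamber × Letter), L.length ≤ N ∧ (∀ q ∈ L, q.1.2.length ≤ D) ∧
    g = (L.map fun q => phi q.1 (lt q.2)).prod}

theorem one_mem_chamberProducts (N D : ℕ) : 1 ∈ chamberProducts N D := ⟨[], by simp, by simp, rfl⟩

theorem chamberProducts_mono {N N' D D' : ℕ} (hN : N ≤ N') (hD : D ≤ D') :
    chamberProducts N D ⊆ chamberProducts N' D' := by
  rintro g ⟨L, h₁, h₂, rfl⟩
  exact ⟨L, h₁.trans hN, fun q hq => (h₂ q hq).trans hD, rfl⟩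

theorem mul_mem_chamberProducts {N N' D : ℕ} {g h : F} (hg : g ∈ chamberProducts N D)
    (hh : h ∈ chamberProducts N' D) : g * h ∈ chamberProducts (N + N') D := by
  obtain ⟨L, h₁, h₂, rfl⟩ := hg
  obtain ⟨M, h₃, h₄, rfl⟩ := hh
  refine ⟨L ++ M, by simpa using Nat.add_le_add h₁ h₃, fun q hq => ?_, by simp⟩
  exact (List.mem_append.1 hq).elim (h₂ q) (h₄ q)

theorem phi_lt_mem {ω : Chamber} {D : ℕ} (h : ω.2.length ≤ D) (l : Letter) :
    phi ω (lt l) ∈ chamberProducts 1 D :=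
  ⟨[(ω, l)], by simp, by simpa using h, by simp⟩

theorem inv_mem_chamberProducts {N D : ℕ} {g : F} (hg : g ∈ chamberProducts N D) :
    g⁻¹ ∈ chamberProducts N D := by
  obtain ⟨L, h₁, h₂, rfl⟩ := hg
  refine ⟨(L.map fun q => (q.1, linv q.2)).reverse, by simpa using h₁, ?_, ?_⟩
  · intro q hq
    obtain ⟨q', hq', rfl⟩ := List.mem_map.1 (List.mem_reverse.1 hq)
    exact h₂ q' hq'
  · rw [List.prod_inv_reverse, List.map_reverse, List.map_map, List.map_map]
    congr 2
    apply List.map_congr_left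
    intro q _
    simp [lt_linv]

/-- A normal form of an automorphism, with an inner part, a chamber and a signed permutation. -/
def HasNormalForm (h : G) (n : ℕ) : Prop :=
  ∃ p ∈ chamberProducts (3 * n) n, ∃ ω : Chamber, ω.2.length ≤ n ∧ ∃ σ ∈ signed,
    h = ad p * phi ω * σ

theorem autR_mul_autL_inv :
    ∃ τ ∈ signed, autR * autL⁻¹ = ad (b⁻¹ * a⁻¹) * autL * τ := by
  refine ⟨flipB * swapInv, mul_mem flipB_mem swapInv_mem, aut_ext ?_ ?_⟩ <;>
    simp [mul_assoc]

theorem autL_mul_autR_inv :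
    ∃ τ ∈ signed, autL * autR⁻¹ = ad (a * b) * autR * τ := by
  refine ⟨flipA * swapInv, mul_mem flipA_mem swapInv_mem, aut_ext ?_ ?_⟩ <;>
    simp [mul_assoc]

theorem autL_inv_eq_flipB : autL⁻¹ = ad a⁻¹ * flipB * autL * flipB := by
  apply aut_ext <;> simp [mul_assoc]

theorem autR_inv_eq_flipB : autR⁻¹ = flipB * autR * flipB := by
  apply aut_ext <;> simp [mul_assoc]

theorem orient_mul_flipB (i : Bool) : orient i * flipB = orient !i := by
  cases i <;> simp [orient, flipB_mul_self]

theorem phi_mul_inv_elem (ω : Chamber) (x : Bool) :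
    ∃ p ∈ chamberProducts 2 (ω.2.length + 1), ∃ ω' : Chamber, ω'.2.length ≤ ω.2.length + 1 ∧
      ∃ τ ∈ signed, phi ω * (elem x)⁻¹ = ad p * phi ω' * τ := by
  obtain ⟨i, w⟩ := ω
  rcases List.eq_nil_or_concat' w with rfl | ⟨w, y, rfl⟩
  · cases x
    · refine ⟨phi (i, []) (lt (0, false)), chamberProducts_mono (by simp) (by simp)
        (phi_lt_mem le_rfl _), (!i, [false]), by simp, flipB, flipB_mem, ?_⟩
      rw [elem_false, autL_inv_eq_flipB, ← mul_assoc, ← mul_assoc, ← mul_assoc, lt_a_inv, mul_ad]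
      simp [phi, ← orient_mul_flipB, mul_assoc]
    · refine ⟨1, one_mem_chamberProducts _ _, (!i, [true]), by simp, flipB, flipB_mem, ?_⟩
      simp [phi, ← orient_mul_flipB, autR_inv_eq_flipB, mul_assoc]
  · by_cases hxy : x = y
    · subst hxy
      exact ⟨1, one_mem_chamberProducts _ _, (i, w), by simp; omega, 1, one_mem _, by
        simp [phi_concat]⟩
    · obtain ⟨l, m, τ, hτ, h⟩ : ∃ l m, ∃ τ ∈ signed,
          elem y * (elem x)⁻¹ = ad (lt l * lt m) * elem x * τ := by
        cases x <;> cases y <;> first | exact absurd rfl hxy | skip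
        · obtain ⟨τ, hτ, h⟩ := autR_mul_autL_inv
          exact ⟨(1, false), (0, false), τ, hτ, by simpa using h⟩
        · obtain ⟨τ, hτ, h⟩ := autL_mul_autR_inv
          exact ⟨(0, true), (1, true), τ, hτ, by simpa using h⟩
      refine ⟨phi (i, w) (lt l) * phi (i, w) (lt m), ?_, (i, w ++ [x]), by simp, τ, hτ, ?_⟩
      · refine mul_mem_chamberProducts (N := 1) (N' := 1) ?_ ?_ <;>
          exact phi_lt_mem (by simp; omega) _
      · rw [phi_concat, mul_assoc, h, phi_concat, ← map_mul, ← mul_assoc, ← mul_assoc, mul_ad,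
          mul_assoc, mul_assoc, mul_assoc, mul_assoc]

/-- Generators of the automorphism group. -/
def IsGen (s : G) : Prop := s ∈ signed ∨ s = autL ∨ s = autL⁻¹

theorem HasNormalForm.mul_gen {h : G} {n : ℕ} (H : HasNormalForm h n) {s : G} (hs : IsGen s) :
    HasNormalForm (h * s) (n + 1) := by
  obtain ⟨p, hp, ω, hω, σ, hσ, rfl⟩ := H
  have hp' := chamberProducts_mono le_rfl n.le_succ hp
  by_cases hs' : s ∈ signed
  · exact ⟨p, chamberProducts_mono (by omega) le_rfl hp', ω, by omega, σ * s, mul_mem hσ hs',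
      by simp only [mul_assoc]⟩
  obtain ⟨t, ht, X, hX, hσs⟩ : ∃ t : F, (t = 1 ∨ ∃ l, t = lt l) ∧
      ∃ X ∈ ({autL, autL⁻¹, autR, autR⁻¹} : Set G), σ * s = ad t * X * σ := by
    rcases hs with hs | rfl | rfl
    · exact absurd hs hs'
    · exact exists_conj_autL hσ
    · obtain ⟨t, ht, X, hX, h⟩ := exists_conj_autL (mul_mem hσ flipA_mem)
      refine ⟨t, ht, X, hX, ?_⟩
      rw [autL_inv_eq, ← mul_assoc, ← mul_assoc, h]
      simp only [mul_assoc, flipA_mul_self, mul_one]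
  have ht' : phi ω t ∈ chamberProducts 1 (n + 1) := by
    rcases ht with rfl | ⟨l, rfl⟩
    · rw [map_one]; exact one_mem_chamberProducts _ _
    · exact phi_lt_mem (by omega) l
  obtain ⟨q, hq, ω', hω', τ, hτ, hX'⟩ : ∃ q ∈ chamberProducts 2 (n + 1), ∃ ω' : Chamber,
      ω'.2.length ≤ n + 1 ∧ ∃ τ ∈ signed, phi ω * X = ad q * phi ω' * τ := by
    have pos (x : Bool) : ∃ q ∈ chamberProducts 2 (n + 1), ∃ ω' : Chamber,
        ω'.2.length ≤ n + 1 ∧ ∃ τ ∈ signed, phi ω * elem x = ad q * phi ω' * τ :=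
      ⟨1, one_mem_chamberProducts _ _, (ω.1, ω.2 ++ [x]), by simpa using hω, 1, one_mem _, by
        simp [phi_concat]⟩
    have neg (x : Bool) : ∃ q ∈ chamberProducts 2 (n + 1), ∃ ω' : Chamber,
        ω'.2.length ≤ n + 1 ∧ ∃ τ ∈ signed, phi ω * (elem x)⁻¹ = ad q * phi ω' * τ := by
      obtain ⟨q, hq, ω', hω', τ, hτ, h⟩ := phi_mul_inv_elem ω x
      exact ⟨q, chamberProducts_mono le_rfl (by omega) hq, ω', by omega, τ, hτ, h⟩
    rcases hX with rfl | rfl | rfl | rfl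
    · exact pos false
    · exact neg false
    · exact pos true
    · exact neg true
  refine ⟨p * phi ω t * q, ?_, ω', hω', τ * σ, mul_mem hτ hσ, ?_⟩
  · exact chamberProducts_mono (by omega) le_rfl
      (mul_mem_chamberProducts (mul_mem_chamberProducts hp' ht') hq)
  · rw [mul_assoc, hσs, map_mul, map_mul]
    calc ad p * phi ω * (ad t * X * σ) = ad p * (phi ω * ad t) * X * σ := by
          simp only [mul_assoc]
      _ = ad p * ad (phi ω t) * (phi ω * X) * σ := by rw [mul_ad]; simp only [mul_assoc]
      _ = _ := by rw [hX']; simp only [mul_assoc]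

theorem hasNormalForm_prod (w : List G) (hw : ∀ s ∈ w, IsGen s) :
    HasNormalForm w.prod w.length := by
  induction w using List.reverseRecOn with
  | nil => exact ⟨1, one_mem_chamberProducts _ _, (false, []), le_rfl, 1, one_mem _, by simp⟩
  | append_singleton w s ih =>
    rw [List.prod_append, List.prod_singleton, List.length_append, List.length_singleton]
    exact (ih fun t ht => hw t (by simp [ht])).mul_gen (hw s (by simp))

theorem HasNormalForm.mono {h : G} {n m : ℕ} (H : HasNormalForm h n) (hnm : n ≤ m) :
    HasNormalForm h m := by
  obtain ⟨p, hp, ω, hω, σ, hσ, rfl⟩ := H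
  exact ⟨p, chamberProducts_mono (by omega) hnm hp, ω, by omega, σ, hσ, rfl⟩

/-- Length of the longest common prefix of two lists. -/
def lcp {α : Type*} [DecidableEq α] : List α → List α → ℕ
  | x :: u, y :: v => if x = y then lcp u v + 1 else 0
  | _, _ => 0

section lcp
variable {α : Type*} [DecidableEq α]

theorem le_lcp_iff {u v : List α} {k : ℕ} :
    k ≤ lcp u v ↔ k ≤ u.length ∧ k ≤ v.length ∧ u.take k = v.take k := by
  induction u generalizing v k with
  | nil => simp [lcp]; rintro rfl; simp
  | cons x u ih =>
    cases v with
    | nil => simp [lcp]; rintro rfl; simp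
    | cons y v =>
      cases k with
      | zero => simp
      | succ k =>
        by_cases hxy : x = y
        · simp [lcp, hxy, ih]
        · simp [lcp, hxy]

theorem lcp_comm (u v : List α) : lcp u v = lcp v u :=
  eq_of_forall_le_iff fun k => by rw [le_lcp_iff, le_lcp_iff]; tauto

theorem min_lcp_le (u v w : List α) : min (lcp u v) (lcp v w) ≤ lcp u w := by
  obtain ⟨h₁, -, h₂⟩ := le_lcp_iff.1 (min_le_left (lcp u v) (lcp v w))
  obtain ⟨-, h₃, h₄⟩ := le_lcp_iff.1 (min_le_right (lcp u v) (lcp v w))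
  exact le_lcp_iff.2 ⟨h₁, h₃, h₂.trans h₄⟩

end lcp

/-- Length of the longest common prefix of two group elements. -/
def gp (u v : F) : ℕ := lcp u.toWord v.toWord

theorem gp_comm (u v : F) : gp u v = gp v u := lcp_comm _ _

theorem min_gp_le (u v w : F) : min (gp u v) (gp v w) ≤ gp u w := min_lcp_le _ _ _

theorem gp_le_left (u v : F) : gp u v ≤ u.norm := (le_lcp_iff.1 (le_refl (gp u v))).1

theorem norm_inv_mul (u v : F) : (u⁻¹ * v).norm + 2 * gp u v = u.norm + v.norm := by
  induction u using word_induction generalizing v with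
  | h1 => simp [gp, lcp]
  | hl l u hu ih =>
    rcases hd_cases v with rfl | ⟨m, v, rfl, hv, -⟩
    · rw [mul_one, FreeGroup.norm_inv_eq]
      simp [gp, lcp]
    · by_cases hlm : l = m
      · subst hlm
        have := ih v
        simp only [gp, FreeGroup.norm, toWord_lt_mul hu, toWord_lt_mul hv, lcp, if_true,
          List.length_cons, mul_inv_rev, mul_assoc, inv_mul_cancel_left] at this ⊢
        omega
      · have hs : Sep (lt l * u) (lt m * v) := by
          intro k h₁ h₂
          rw [hd_lt_mul hu] at h₁
          rw [hd_lt_mul hv] at h₂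
          exact hlm (Option.some.inj (h₁.trans h₂.symm))
        have h0 : gp (lt l * u) (lt m * v) = 0 := by
          simp [gp, toWord_lt_mul hu, toWord_lt_mul hv, lcp, hlm]
        rw [h0, FreeGroup.norm, toWord_inv_mul_of_sep hs]
        simp [FreeGroup.norm]

theorem gp_mul_left (u v : F) : gp (u * v) u + gp u⁻¹ v = u.norm := by
  have h₁ := norm_inv_mul u (u * v)
  have h₂ := norm_inv_mul u⁻¹ v
  rw [inv_mul_cancel_left, gp_comm] at h₁
  rw [inv_inv, FreeGroup.norm_inv_eq] at h₂
  omega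

/-- Splitting a reduced word at a given position. -/
theorem exists_split (g : F) (k : ℕ) (hk : k ≤ g.norm) :
    ∃ x y : F, g = x * y ∧ x.toWord = g.toWord.take k ∧ y.toWord = g.toWord.drop k := by
  obtain ⟨x, hx⟩ := exists_toWord_eq_of_isPrefix (List.take_prefix k g.toWord)
  have h : x.toWord <+: g.toWord := hx ▸ List.take_prefix k _
  refine ⟨x, x⁻¹ * g, by simp, hx, ?_⟩
  have h₁ := toWord_of_isPrefix h
  have h₂ : x.toWord.length = k := by rw [hx, List.length_take]; exact min_eq_left hk
  conv_rhs => rw [h₁]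
  rw [← h₂, List.drop_left]

theorem two_mul_gp_inv_lt {s : F} (hs : s ≠ 1) : 2 * gp s s⁻¹ < s.norm := by
  by_contra! h
  have hn : 0 < s.norm := Nat.pos_of_ne_zero (by simpa using hs)
  obtain ⟨k, hk⟩ := Nat.even_or_odd' s.norm
  obtain ⟨j, hj, hj1, hj2⟩ : ∃ j, s.norm - j ≤ j ∧ j ≤ s.norm ∧ j ≤ gp s s⁻¹ :=
    ⟨gp s s⁻¹, by omega, gp_le_left _ _, le_rfl⟩
  obtain ⟨-, -, h₁⟩ := le_lcp_iff.1 hj2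
  rw [FreeGroup.toWord_inv, FreeGroup.invRev] at h₁
  have hlen : s.toWord.length = s.norm := rfl
  set i := s.norm - 1 - s.norm / 2 with hi
  have e₁ := congrArg (fun w => w[i]?) h₁
  simp only [List.getElem?_take] at e₁
  rw [if_pos (by omega), if_pos (by omega), List.getElem?_reverse (by simp; omega),
    List.getElem?_map,
    List.length_map, hlen] at e₁
  rcases hk with hk | hk
  · have hi1 : i + 1 = k := by omega
    have hi2 : s.norm - 1 - i = k := by omega
    have hr : FreeGroup.IsReduced s.toWord := FreeGroup.isReduced_toWord
    unfold FreeGroup.IsReduced at hr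
    rw [List.isChain_iff_getElem] at hr
    have := hr i (by omega)
    rw [hi2, ← hi1, List.getElem?_eq_getElem (by omega), List.getElem?_eq_getElem (by omega)] at e₁
    simp only [Option.map_some, Option.some.injEq] at e₁
    rw [e₁] at this
    simp at this
  · have hi2 : s.norm - 1 - i = i := by omega
    rw [hi2, List.getElem?_eq_getElem (by omega)] at e₁
    simp only [Option.map_some, Option.some.injEq] at e₁
    have := congrArg Prod.snd e₁
    simp at this

theorem exists_list_of_mem_closure {Γ : Type*} [Group Γ] {S : Set Γ} {x : Γ}
    (hx : x ∈ Subgroup.closure S) :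
    ∃ w : List Γ, (∀ s ∈ w, s ∈ S ∨ s⁻¹ ∈ S) ∧ w.prod = x := by
  rw [← Subgroup.mem_toSubmonoid, Subgroup.closure_toSubmonoid] at hx
  exact Submonoid.exists_list_of_mem_closure hx

theorem exists_mem_signed {l m : Letter} (h : l.1 ≠ m.1) :
    ∃ σ ∈ signed, σ a = lt l ∧ σ b = lt m := by
  have hA := flipA_mem
  have hB := flipB_mem
  have hS := swapInv_mem
  rcases letter_cases l with rfl | rfl | rfl | rfl <;>
    rcases letter_cases m with rfl | rfl | rfl | rfl <;> first | exact absurd rfl h | skip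
  · exact ⟨1, one_mem _, by simp⟩
  · exact ⟨flipB, hB, by simp⟩
  · exact ⟨flipA, hA, by simp⟩
  · exact ⟨flipA * flipB, mul_mem hA hB, by simp⟩
  · exact ⟨flipA * flipB * swapInv, mul_mem (mul_mem hA hB) hS, by simp⟩
  · exact ⟨flipB * swapInv, mul_mem hB hS, by simp⟩
  · exact ⟨flipA * swapInv, mul_mem hA hS, by simp⟩
  · exact ⟨swapInv, hS, by simp⟩

/-- The subgroup generated by the elementary and the signed automorphisms. -/
def genGroup : Subgroup G := Subgroup.closure {s | IsGen s}

theorem signed_le_genGroup : signed ≤ genGroup := fun _ h => Subgroup.subset_closure (Or.inl h)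

theorem autL_mem_genGroup : autL ∈ genGroup := Subgroup.subset_closure (Or.inr (Or.inl rfl))

theorem flipB_autL_flipB_mem_genGroup : flipB * autL * flipB ∈ genGroup :=
  mul_mem (mul_mem (signed_le_genGroup flipB_mem) autL_mem_genGroup) (signed_le_genGroup flipB_mem)

theorem ad_mem_genGroup (g : F) : ad g ∈ genGroup := by
  have ha : ad a ∈ genGroup := by
    have : ad a = flipB * autL * flipB * autL := by
      apply aut_ext <;> simp [mul_assoc]
    rw [this]
    exact mul_mem flipB_autL_flipB_mem_genGroup autL_mem_genGroup
  have hS := signed_le_genGroup swapInv_mem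
  have hb : ad b ∈ genGroup := by
    have h : ad b⁻¹ = swapInv * ad a * swapInv⁻¹ := by
      rw [mul_ad, swapInv_a, mul_inv_cancel_right]
    rw [← inv_mem_iff, ← map_inv, h]
    exact mul_mem (mul_mem hS ha) (inv_mem hS)
  induction g using word_induction with
  | h1 => simp
  | hl l g _ ih =>
    rw [map_mul]
    refine mul_mem ?_ ih
    rcases letter_cases l with rfl | rfl | rfl | rfl
    · simpa using ha
    · simpa using ha
    · simpa using hb
    · simpa using hb

/-- Total length of the images of the generators. -/
def size (θ : G) : ℕ := (θ a).norm + (θ b).norm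

theorem size_eq (θ : G) {l m : Letter} (h : l.1 ≠ m.1) :
    size θ = (θ (lt l)).norm + (θ (lt m)).norm := by
  rcases letter_cases l with rfl | rfl | rfl | rfl <;>
    rcases letter_cases m with rfl | rfl | rfl | rfl <;> first | exact absurd rfl h | skip
  all_goals simp [size, add_comm]

/-- Automorphisms of minimal size in their coset. -/
def IsMinimal (θ : G) : Prop := ∀ s ∈ genGroup, size θ ≤ size (θ * s)

theorem norm_le_norm_mul {θ : G} (hθ : IsMinimal θ) {l m : Letter} (h : l.1 ≠ m.1) :
    (θ (lt m)).norm ≤ (θ (lt l) * θ (lt m)).norm := by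
  obtain ⟨σ, hσ, ha, hb⟩ := exists_mem_signed h
  have := hθ (σ * autL) (mul_mem (signed_le_genGroup hσ) autL_mem_genGroup)
  rw [size_eq θ h, size] at this
  simpa [ha, hb] using this

theorem two_mul_gp_le {θ : G} (hθ : IsMinimal θ) {x y : Letter} (h : x.1 ≠ y.1) :
    2 * gp (θ (lt x)) (θ (lt y)) ≤ (θ (lt x)).norm := by
  have h₁ := norm_le_norm_mul hθ (l := linv x) (m := y) h
  have h₂ := norm_inv_mul (θ (lt x)) (θ (lt y))
  rw [lt_linv, map_inv] at h₁
  omega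

theorem apply_lt_ne_one (θ : G) (x : Letter) : θ (lt x) ≠ 1 := by
  rw [Ne, EmbeddingLike.map_eq_one_iff, ← hd_eq_none, hd_lt]
  simp

theorem gp_add_gp_ne {θ : G} (hθ : IsMinimal θ) {x y z : Letter} (hy : x.1 ≠ y.1) (hz : x.1 ≠ z.1) :
    gp (θ (lt x)) (θ (lt y)) + gp (θ (lt x))⁻¹ (θ (lt z)) ≠ (θ (lt x)).norm := by
  intro heq
  have h₁ := two_mul_gp_le hθ hy
  have h₂ := two_mul_gp_le hθ (x := linv x) (y := z) hz
  have h₃ := two_mul_gp_le hθ (x := y) (y := x) hy.symm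
  rw [lt_linv, map_inv, FreeGroup.norm_inv_eq] at h₂
  rw [gp_comm] at h₃
  have hs1 := apply_lt_ne_one θ x
  obtain ⟨σ, hσ, ha, hb⟩ := exists_mem_signed hy
  have hsize := size_eq θ hy
  obtain ⟨k, hk⟩ : ∃ k, k = gp (θ (lt x)) (θ (lt y)) := ⟨_, rfl⟩
  have hk' : k = gp (θ (lt x))⁻¹ (θ (lt z)) := by omega
  have hyz : z = y ∨ z = linv y := eq_or_eq_linv (fst_eq_of_ne hy hz)
  set s := θ (lt x) with hs
  set t := θ (lt y) with ht
  obtain ⟨X, Y, hXY, hX, hY⟩ := exists_split s k (by omega)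
  obtain ⟨-, -, e₁⟩ := le_lcp_iff.1 hk.le
  obtain ⟨-, -, e₂⟩ := le_lcp_iff.1 hk'.le
  have hsn : s.toWord.length = s.norm := rfl
  have htn : t.toWord.length = t.norm := rfl
  have hXk : X.toWord.length = k := by rw [hX, List.length_take]; omega
  have hYk : Y.toWord.length = k := by rw [hY, List.length_drop]; omega
  have hsinv : (s⁻¹).toWord.take k = (Y⁻¹).toWord := by
    rw [FreeGroup.toWord_inv, FreeGroup.toWord_inv, ← List.take_append_drop k s.toWord, ← hX, ← hY,
      FreeGroup.invRev_append, List.take_left' (by simp [hYk])]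
  rcases hyz with rfl | rfl
  · have : X = Y⁻¹ := FreeGroup.toWord_injective (by rw [hX, e₁, ← hsinv, e₂])
    exact hs1 (by rw [hXY, this, inv_mul_cancel])
  · rw [lt_linv, map_inv, ← ht, hsinv] at e₂
    obtain ⟨X', u, hu, hX', hu'⟩ := exists_split t k (by omega)
    have : X' = X := FreeGroup.toWord_injective (by rw [hX, hX', e₁])
    subst this
    have hun : u.toWord.length = t.norm - k := by rw [hu', List.length_drop]; rfl
    have htu : (t⁻¹).toWord.take k = (u⁻¹).toWord.take k := by
      rw [FreeGroup.toWord_inv, FreeGroup.toWord_inv, ← List.take_append_drop k t.toWord, ← hX',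
        ← hu', FreeGroup.invRev_append, List.take_append_of_le_length]
      rw [FreeGroup.invRev_length, hun]; omega
    have hg : k ≤ gp u⁻¹ Y⁻¹ := by
      refine le_lcp_iff.2 ⟨?_, ?_, ?_⟩
      · rw [FreeGroup.toWord_inv, FreeGroup.invRev_length, hun]; omega
      · rw [FreeGroup.toWord_inv, FreeGroup.invRev_length, hYk]
      · rw [← htu, ← e₂, List.take_of_length_le]
        rw [FreeGroup.toWord_inv, FreeGroup.invRev_length, hYk]
    have hn := norm_inv_mul u⁻¹ Y⁻¹
    rw [inv_inv, FreeGroup.norm_inv_eq, FreeGroup.norm_inv_eq] at hn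
    have hmin := hθ (ad (θ⁻¹ X'⁻¹) * (σ * (flipB * autL * flipB)))
      (mul_mem (ad_mem_genGroup _) (mul_mem (signed_le_genGroup hσ) flipB_autL_flipB_mem_genGroup))
    rw [← mul_assoc, mul_ad, MulAut.apply_inv_self, hsize, size] at hmin
    have e₃ : (ad X'⁻¹ * θ * (σ * (flipB * autL * flipB))) a = Y * X' := by
      simp [ha, ← hs, hXY]
    have e₄ : (ad X'⁻¹ * θ * (σ * (flipB * autL * flipB))) b = u * Y⁻¹ := by
      simp [ha, hb, ← hs, ← ht, hXY, hu, mul_assoc]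
    rw [e₃, e₄] at hmin
    have h4 := FreeGroup.norm_mul_le Y X'
    have hs0 : s.norm ≠ 0 := by simpa using hs1
    simp only [FreeGroup.norm] at *
    omega

theorem gp_add_gp_lt {θ : G} (hθ : IsMinimal θ) {x y z : Letter} (hy : y ≠ x) (hz : z ≠ linv x) :
    gp (θ (lt x)) (θ (lt y)) + gp (θ (lt x))⁻¹ (θ (lt z)) < (θ (lt x)).norm := by
  have hs := two_mul_gp_inv_lt (apply_lt_ne_one θ x)
  have hs' := gp_comm (θ (lt x)) (θ (lt x))⁻¹
  have hy' : y = linv x ∨ x.1 ≠ y.1 := eq_linv_or_of_ne hy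
  have hz' : z = x ∨ x.1 ≠ z.1 := eq_or_of_ne_linv hz
  have hZ : x.1 ≠ z.1 → 2 * gp (θ (lt x))⁻¹ (θ (lt z)) ≤ (θ (lt x)).norm := fun h => by
    have := two_mul_gp_le hθ (x := linv x) (y := z) h
    rwa [lt_linv, map_inv, FreeGroup.norm_inv_eq] at this
  rcases hy' with rfl | hy'
  · rw [lt_linv, map_inv]
    rcases hz' with rfl | hz'
    · omega
    · have := hZ hz'; omega
  · have h₁ := two_mul_gp_le hθ hy'
    rcases hz' with rfl | hz'
    · omega
    · have h₂ := hZ hz'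
      have := gp_add_gp_ne hθ hy' hz'
      omega

theorem exists_le_norm_apply {θ : G} (hθ : IsMinimal θ) (g : F) :
    ∀ x k, g = lt x * k → hd k ≠ some (linv x) →
    ∃ z, z ≠ linv x ∧
      (θ (lt x)).norm ≤ gp (θ g) (θ (lt x)) + gp (θ (lt x))⁻¹ (θ (lt z)) ∧
      (θ (lt x)).norm + g.norm ≤ (θ g).norm + gp (θ (lt x))⁻¹ (θ (lt z)) + 1 := by
  induction g using word_induction with
  | h1 =>
    intro x k hk h
    have := hd_lt_mul h
    rw [← hk] at this
    simp at this
  | hl y g hg ih =>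
    intro x k hk h
    have hxy : x = y := by
      have := hd_lt_mul h
      rw [← hk, hd_lt_mul hg] at this
      exact (Option.some.inj this).symm
    subst hxy
    rcases hd_cases g with rfl | ⟨w, k', hg', hk', -⟩
    · refine ⟨x, ?_, ?_, ?_⟩
      · exact (linv_ne x).symm
      · rw [mul_one]
        have := gp_mul_left (θ (lt x)) 1
        simp only [mul_one] at this
        have h0 : gp (θ (lt x))⁻¹ 1 = 0 := by rw [gp_comm]; simp [gp, lcp]
        omega
      · rw [mul_one, norm_lt]; omega
    · obtain ⟨z, hz, h₁, h₂⟩ := ih w k' hg' hk'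
      have hw : hd g = some w := by rw [hg']; exact hd_lt_mul hk'
      have hwx : linv x ≠ w := fun h => hg (by rw [hw, h])
      refine ⟨w, hwx.symm, ?_⟩
      have h₃ := gp_add_gp_lt hθ hwx hz
      have h₄ := min_gp_le (θ (lt x))⁻¹ (θ g) (θ (lt w))
      rw [lt_linv, map_inv, gp_comm] at h₃
      have h₅ := gp_mul_left (θ (lt x)) (θ g)
      have h₆ := norm_inv_mul (θ (lt x))⁻¹ (θ g)
      rw [inv_inv, FreeGroup.norm_inv_eq] at h₆
      have h₇ : (lt x * g).norm = g.norm + 1 := by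
        rw [FreeGroup.norm, toWord_lt_mul hg]; rfl
      rw [map_mul, h₇]
      omega

theorem norm_le_norm_apply {θ : G} (hθ : IsMinimal θ) (g : F) : g.norm ≤ (θ g).norm := by
  rcases hd_cases g with rfl | ⟨x, k, hg, hk, -⟩
  · simp
  · obtain ⟨z, hz, -, h₂⟩ := exists_le_norm_apply hθ g x k hg hk
    have := gp_add_gp_lt hθ (x := x) (y := linv x) (z := z) (linv_ne x) hz
    omega

theorem mem_signed_of_minimal {θ : G} (hθ : IsMinimal θ) : θ ∈ signed := by
  have key (l : Letter) : ∃ l', θ⁻¹ (lt l) = lt l' := by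
    apply exists_lt_of_norm_eq_one
    have h₁ := norm_le_norm_apply hθ (θ⁻¹ (lt l))
    rw [MulAut.apply_inv_self, norm_lt] at h₁
    have h₂ : (θ⁻¹ (lt l)).norm ≠ 0 := by
      rw [Ne, FreeGroup.norm_eq_zero]; exact apply_lt_ne_one _ _
    omega
  obtain ⟨l, hl⟩ := key (0, true)
  obtain ⟨m, hm⟩ := key (1, true)
  have hlm : l.1 ≠ m.1 := by
    intro h
    rcases eq_or_eq_linv h with rfl | rfl
    · have := congrArg hd (θ⁻¹.injective (hl.trans hm.symm))
      simp only [hd_lt, Option.some.injEq] at this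
      exact absurd this (by decide)
    · rw [lt_linv, ← hm, ← map_inv, ← lt_linv] at hl
      have := congrArg hd (θ⁻¹.injective hl)
      simp only [hd_lt, Option.some.injEq] at this
      exact absurd this (by decide)
  exact inv_inv θ ▸ inv_mem (mem_signed hl hm hlm)

theorem genGroup_eq_top : genGroup = ⊤ := by
  rw [Subgroup.eq_top_iff']
  intro θ₀
  let T : Set ℕ := {n | ∃ s ∈ genGroup, size (θ₀ * s) = n}
  obtain ⟨s, hs, hn⟩ : sInf T ∈ T := Nat.sInf_mem ⟨_, 1, one_mem _, rfl⟩
  have : θ₀ * s ∈ signed := mem_signed_of_minimal fun t ht => by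
    rw [hn]
    exact Nat.sInf_le ⟨s * t, mul_mem hs ht, by rw [mul_assoc]⟩
  exact (Subgroup.mul_mem_cancel_right _ hs).1 (signed_le_genGroup this)

theorem IsGen.inv {s : G} (h : IsGen s) : IsGen s⁻¹ := by
  rcases h with h | rfl | rfl
  · exact Or.inl (inv_mem h)
  · exact Or.inr (Or.inr rfl)
  · exact Or.inr (Or.inl (inv_inv _))

/-- Every automorphism is a product of elementary and signed automorphisms. -/
theorem exists_word (θ : G) : ∃ w : List G, (∀ s ∈ w, IsGen s) ∧ w.prod = θ := by
  obtain ⟨w, hw, h⟩ := exists_list_of_mem_closure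
    (show θ ∈ genGroup by rw [genGroup_eq_top]; exact Subgroup.mem_top θ)
  refine ⟨w, fun s hs => (hw s hs).elim id fun h => ?_, h⟩
  exact inv_inv s ▸ IsGen.inv h

theorem fg_aut : Group.FG G := by
  refine ⟨Subgroup.fg_iff _ |>.2 ⟨{s | IsGen s}, genGroup_eq_top, ?_⟩⟩
  have : {s : G | IsGen s} = (signed : Set G) ∪ {autL, autL⁻¹} := by
    ext s; rfl
  rw [this]
  exact signed_finite.union (Set.toFinite _)

theorem exists_hasNormalForm (θ : G) : ∃ n, HasNormalForm θ n := by
  obtain ⟨w, hw, rfl⟩ := exists_word θ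
  exact ⟨_, hasNormalForm_prod w hw⟩

/-- The exponent sums of the two generators. -/
def expSum : F →* Multiplicative (Fin 2 → ℤ) :=
  FreeGroup.lift fun i => Multiplicative.ofAdd (Pi.single i 1)

/-- The matrix of an automorphism on the abelianization. -/
def abMatrix (θ : G) : Matrix (Fin 2) (Fin 2) ℤ :=
  Matrix.of fun i j => (expSum (θ (FreeGroup.of j))).toAdd i

theorem toAdd_expSum_apply (θ : G) (g : F) :
    (expSum (θ g)).toAdd = (abMatrix θ).mulVec (expSum g).toAdd := by
  have : expSum.comp θ.toMonoidHom =
      (AddMonoidHom.toMultiplicative (abMatrix θ).mulVecLin.toAddMonoidHom).comp expSum := by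
    apply FreeGroup.ext_hom
    intro j
    apply Multiplicative.toAdd.injective
    ext i
    simp [expSum, abMatrix]
  exact congrArg Multiplicative.toAdd (DFunLike.congr_fun this g)

theorem abMatrix_mul (θ ψ : G) : abMatrix (θ * ψ) = abMatrix θ * abMatrix ψ := by
  ext i j
  have := congrFun (toAdd_expSum_apply θ (ψ (FreeGroup.of j))) i
  exact this

theorem abMatrix_ad (g : F) : abMatrix (ad g) = 1 := by
  ext i j
  simp [abMatrix, ad, expSum, Matrix.one_apply, Pi.single_apply]

theorem abMatrix_ne_zero_det (θ : G) : (abMatrix θ).det ≠ 0 := by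
  intro h
  have h₁ := abMatrix_mul θ θ⁻¹
  have h₂ := congrArg Matrix.det h₁
  rw [mul_inv_cancel, ← map_one ad, abMatrix_ad, Matrix.det_mul, h] at h₂
  simp at h₂

/-- The automorphism given by a positive word. -/
def posWord (w : List Bool) : G := (w.map elem).prod

theorem abMatrix_elem_mul (x : Bool) (θ : G) : abMatrix (elem x * θ) =
    if x then !![abMatrix θ 0 0, abMatrix θ 0 1;
      abMatrix θ 0 0 + abMatrix θ 1 0, abMatrix θ 0 1 + abMatrix θ 1 1]
    else !![abMatrix θ 0 0 + abMatrix θ 1 0, abMatrix θ 0 1 + abMatrix θ 1 1;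
      abMatrix θ 1 0, abMatrix θ 1 1] := by
  have hL : abMatrix autL = !![1, 1; 0, 1] := by
    have h₁ := autL_a
    have h₂ := autL_b
    unfold a at h₁ h₂
    unfold b at h₂
    ext i j
    fin_cases i <;> fin_cases j <;> simp [abMatrix, h₁, h₂, expSum]
  have hR : abMatrix autR = !![1, 0; 1, 1] := by
    have h₁ := autR_a
    have h₂ := autR_b
    unfold a b at h₁
    unfold b at h₂
    ext i j
    fin_cases i <;> fin_cases j <;> simp [abMatrix, h₁, h₂, expSum]
  rw [abMatrix_mul]
  cases x
  · ext i j
    fin_cases i <;> fin_cases j <;> simp [hL, Matrix.mul_apply]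
  · ext i j
    fin_cases i <;> fin_cases j <;> simp [hR, Matrix.mul_apply]

theorem abMatrix_signed {σ : G} (hσ : σ ∈ signed) :
    (∃ j, abMatrix σ 0 j = 0 ∧ abMatrix σ 1 j ^ 2 = 1) ∧
      (∃ j, abMatrix σ 1 j = 0 ∧ abMatrix σ 0 j ^ 2 = 1) ∧
      ∀ j, abMatrix σ 0 j * abMatrix σ 1 j = 0 := by
  obtain ⟨l, m, ha, hb, hlm⟩ := exists_of_mem_signed hσ
  have key (x : Letter) (i : Fin 2) :
      (expSum (lt x)).toAdd i = if x.1 = i then (if x.2 then 1 else -1) else 0 := by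
    rcases x with ⟨j, s⟩
    cases s
    · simp only [lt, expSum, FreeGroup.lift_mk]
      simp [Pi.single_apply, eq_comm, apply_ite Neg.neg]
    · simp [lt, expSum, Pi.single_apply, eq_comm]
  have e₀ (i : Fin 2) : abMatrix σ i 0 = if l.1 = i then (if l.2 then 1 else -1) else 0 := by
    rw [← key, ← ha]; rfl
  have e₁ (i : Fin 2) : abMatrix σ i 1 = if m.1 = i then (if m.2 then 1 else -1) else 0 := by
    rw [← key, ← hb]; rfl
  clear key ha hb
  simp only [Fin.exists_fin_two, Fin.forall_fin_two, e₀, e₁]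
  revert hlm
  clear e₀ e₁ hσ
  revert l m
  decide

theorem abMatrix_posWord_mul (w : List Bool) {σ : G} (hσ : σ ∈ signed) (j : Fin 2) :
    0 ≤ abMatrix (posWord w * σ) 0 j * abMatrix (posWord w * σ) 1 j := by
  induction w with
  | nil => simpa [posWord] using ((abMatrix_signed hσ).2.2 j).ge
  | cons x w ih =>
    have : posWord (x :: w) * σ = elem x * (posWord w * σ) := by simp [posWord, mul_assoc]
    rw [this, abMatrix_elem_mul]
    revert ih
    generalize abMatrix (posWord w * σ) = A
    intro ih
    cases x <;> fin_cases j <;> simp at ih ⊢ <;> nlinarith [mul_self_nonneg (A 0 0),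
      mul_self_nonneg (A 0 1), mul_self_nonneg (A 1 0), mul_self_nonneg (A 1 1)]

theorem abMatrix_cons (x : Bool) (w : List Bool) {σ : G} (hσ : σ ∈ signed) (j : Fin 2) :
    abMatrix (posWord (x :: w) * σ) (if x then 0 else 1) j ^ 2 ≤
      abMatrix (posWord (x :: w) * σ) (if x then 1 else 0) j ^ 2 := by
  have : posWord (x :: w) * σ = elem x * (posWord w * σ) := by simp [posWord, mul_assoc]
  have h := abMatrix_posWord_mul w hσ j
  rw [this, abMatrix_elem_mul]
  revert h
  generalize abMatrix (posWord w * σ) = A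
  intro h
  cases x <;> fin_cases j <;> simp at h ⊢ <;> nlinarith

theorem posWord_unique {w w' : List Bool} {σ σ' : G} (hσ : σ ∈ signed) (hσ' : σ' ∈ signed)
    (h : abMatrix (posWord w * σ) = abMatrix (posWord w' * σ')) :
    w = w' ∧ abMatrix σ = abMatrix σ' := by
  have nil_cons {x : Bool} {w : List Bool} {σ σ' : G} (hσ : σ ∈ signed) (hσ' : σ' ∈ signed)
      (h : abMatrix (posWord [] * σ) = abMatrix (posWord (x :: w) * σ')) : False := by
    have h₁ := abMatrix_cons x w hσ'
    rw [← h] at h₁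
    obtain ⟨⟨j, hj, hj'⟩, ⟨k, hk, hk'⟩, -⟩ := abMatrix_signed hσ
    have hj1 := h₁ j
    have hk1 := h₁ k
    simp only [posWord, List.map_nil, List.prod_nil, one_mul] at hj1 hk1
    cases x <;> simp_all
  induction w generalizing w' with
  | nil =>
    cases w' with
    | nil => simpa [posWord] using h
    | cons x w' => exact (nil_cons hσ hσ' h).elim
  | cons x w ih =>
    cases w' with
    | nil => exact (nil_cons hσ' hσ h.symm).elim
    | cons y w' =>
      by_cases hxy : x = y
      · subst hxy
        have e (v : List Bool) (τ : G) : posWord (x :: v) * τ = elem x * (posWord v * τ) := by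
          simp [posWord, mul_assoc]
        rw [e, e, abMatrix_mul, abMatrix_mul] at h
        have h' := congrArg (fun A => abMatrix (elem x)⁻¹ * A) h
        simp only [← mul_assoc, ← abMatrix_mul, inv_mul_cancel] at h'
        simp only [one_mul] at h'
        obtain ⟨rfl, h₂⟩ := ih h'
        exact ⟨rfl, h₂⟩
      · exfalso
        have h₁ := abMatrix_cons x w hσ
        have h₂ := abMatrix_cons y w' hσ'
        have h₃ := abMatrix_posWord_mul (x :: w) hσ
        rw [← h] at h₂
        have hdet := abMatrix_ne_zero_det (posWord (x :: w) * σ)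
        rw [Matrix.det_fin_two] at hdet
        revert h₁ h₂ h₃ hdet
        generalize abMatrix (posWord (x :: w) * σ) = A
        intro h₁ h₂ h₃ hdet
        have key (j : Fin 2) : A 0 j = A 1 j := by
          have a₁ := h₁ j
          have a₂ := h₂ j
          have a₃ := h₃ j
          have : A 0 j ^ 2 = A 1 j ^ 2 := by
            cases x <;> cases y <;> simp_all <;> omega
          rcases sq_eq_sq_iff_eq_or_eq_neg.1 this with h | h
          · exact h
          · rw [h] at a₃ ⊢
            have : A 1 j * A 1 j = 0 := by nlinarith [mul_self_nonneg (A 1 j)]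
            simp [mul_self_eq_zero.1 this]
        apply hdet
        rw [key 0, key 1]; ring

theorem eq_of_abMatrix_eq {σ τ : G} (hσ : σ ∈ signed) (hτ : τ ∈ signed)
    (h : abMatrix σ = abMatrix τ) : σ = τ := by
  obtain ⟨l, m, ha, hb, -⟩ := exists_of_mem_signed hσ
  obtain ⟨l', m', ha', hb', -⟩ := exists_of_mem_signed hτ
  have key {x y : Letter} (h : (expSum (lt x)).toAdd = (expSum (lt y)).toAdd) : x = y := by
    have e (x : Letter) : (expSum (lt x)).toAdd =
        Pi.single x.1 (if x.2 then 1 else -1) := by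
      rcases x with ⟨j, s⟩
      cases s <;> simp [lt, expSum, Pi.single_neg]
    rw [e, e] at h
    have h0 := congrFun h 0
    have h1 := congrFun h 1
    clear e h
    simp only [Pi.single_apply] at h0 h1
    revert x y
    decide
  refine aut_ext ?_ ?_
  · rw [ha, ha']
    refine congrArg lt (key ?_)
    rw [← ha, ← ha']
    ext i
    exact congrFun (congrFun h i) 0
  · rw [hb, hb']
    refine congrArg lt (key ?_)
    rw [← hb, ← hb']
    ext i
    exact congrFun (congrFun h i) 1

/-- Inner automorphisms have trivial chamber and trivial signed part. -/
theorem phi_mul_eq_one {ω : Chamber} {σ : G} (hσ : σ ∈ signed) {g : F}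
    (h : phi ω * σ = ad g) : phi ω * σ = 1 := by
  obtain ⟨i, w⟩ := ω
  have hi : orient i * orient i = 1 := by cases i <;> simp [orient, flipB_mul_self]
  have h₁ : abMatrix (posWord w * σ) = abMatrix (posWord [] * orient i) := by
    have : posWord w * σ = orient i * ad g := by
      rw [← h, phi, ← mul_assoc, ← mul_assoc, hi, one_mul, posWord]
    rw [this, abMatrix_mul, abMatrix_ad, mul_one]
    simp [posWord]
  obtain ⟨rfl, h₂⟩ := posWord_unique hσ (orient_mem i) h₁
  rw [eq_of_abMatrix_eq hσ (orient_mem i) h₂]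
  simpa [phi] using hi

theorem ad_injective : Function.Injective ad := by
  rw [injective_iff_map_eq_one]
  intro g hg
  have key (l : Letter) : g * lt l = lt l * g := by
    have := DFunLike.congr_fun hg (lt l)
    simpa [ad, mul_inv_eq_iff_eq_mul] using this
  by_contra hne
  rcases hd_cases g with rfl | ⟨l, k, rfl, hk, hw⟩
  · exact hne rfl
  · obtain ⟨m, hm⟩ : ∃ m : Letter, m.1 ≠ l.1 := ⟨(l.1 + 1, true), by
      simp⟩
    have h₁ (s : Letter) (hs : s.1 = m.1) : hd (lt s * (lt l * k)) = some s := by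
      apply hd_lt_mul
      rw [hd_lt_mul hk]
      intro h
      exact hm (by rw [← hs, Option.some.inj h]; rfl)
    have h₂ : lt l * k * lt m = lt m * (lt l * k) := key m
    have h₃ : (lt l * k * lt m).norm = (lt l * k).norm + 1 := by
      rw [h₂, FreeGroup.norm, toWord_lt_mul]
      · rfl
      · rw [hd_lt_mul hk]
        intro h
        exact hm (congrArg Prod.fst (Option.some.inj h)).symm
    have h₄ := toWord_mul_of_sep (u := lt l * k) (v := lt m) (by
      have := norm_inv_mul (lt l * k)⁻¹ (lt m)
      rw [inv_inv, FreeGroup.norm_inv_eq, norm_lt] at this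
      intro x hx hx'
      have h0 : gp (lt l * k)⁻¹ (lt m) = 0 := by omega
      have : 1 ≤ gp (lt l * k)⁻¹ (lt m) := by
        obtain ⟨k₁, h₅, -, h₇⟩ := exists_of_hd_eq hx
        obtain ⟨k₂, h₈, -, h₁₀⟩ := exists_of_hd_eq hx'
        exact le_lcp_iff.2 ⟨by rw [h₇]; simp, by rw [h₁₀]; simp, by rw [h₇, h₁₀]; simp⟩
      omega)
    have h₅ : hd (lt l * k * lt m) = some l := by
      rw [hd, h₄, hw]; rfl
    rw [h₂, h₁ m rfl] at h₅
    exact hm (congrArg Prod.fst (Option.some.inj h₅))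

theorem mem_chamberProducts_of_hasNormalForm {g : F} {n : ℕ} (h : HasNormalForm (ad g) n) :
    g ∈ chamberProducts (3 * n) n := by
  obtain ⟨p, hp, ω, -, σ, hσ, h⟩ := h
  have h₁ : phi ω * σ = ad (p⁻¹ * g) := by
    rw [map_mul, h, map_inv]; group
  have h₂ := phi_mul_eq_one hσ h₁
  rw [mul_assoc, h₂, mul_one] at h
  rwa [ad_injective h]

/-- A version of `triBound_of_centroid` in which the centroids are only assumed to exist. -/
theorem triBound_of_exists_centroid {Γ I : Type*} [Group Γ] (T : Set (Γ × Γ))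
    (S₁ S₂ : Γ → Set (I × Γ)) (S₃ : I → Γ → Set Γ) (N₁ N₂ N₃ : ℕ)
    (h : ∀ p ∈ T, ∃ k : I × Γ, k ∈ S₁ p.1 ∧ k ∈ S₂ (p.1 * p.2) ∧ p.1⁻¹ * k.2 ∈ S₃ k.1 p.2)
    (h₁ : ∀ y, (S₁ y).encard ≤ N₁) (h₂ : ∀ x, (S₂ x).encard ≤ N₂)
    (h₃ : ∀ i z, (S₃ i z).encard ≤ N₃) : TriBound T (N₂ * (N₁ * N₃)) := by
  classical
  rcases T.eq_empty_or_nonempty with rfl | ⟨p₀, hp₀⟩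
  · obtain hI | ⟨⟨i⟩⟩ := isEmpty_or_nonempty I
    · exact triBound_of_centroid (I := Unit) _ (fun p => ((), p.1)) _ _ _
        (by simp) (by simp) (by simp)
    · exact triBound_of_centroid _ (fun p => (i, p.1)) _ _ _ (by simp) (by simp) (by simp)
  have : Nonempty (I × Γ) := ⟨(h p₀ hp₀).choose⟩
  choose! κ hκ using h
  refine triBound_of_centroid T κ N₁ N₂ N₃
    (fun y => le_trans (Set.encard_le_encard ?_) (h₁ y))
    (fun x => le_trans (Set.encard_le_encard ?_) (h₂ x))
    (fun i z => le_trans (Set.encard_le_encard ?_) (h₃ i z))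
  · rintro _ ⟨p, hp, rfl, rfl⟩
    exact (hκ p hp).1
  · rintro _ ⟨p, hp, rfl, rfl⟩
    exact (hκ p hp).2.1
  · rintro _ ⟨p, hp, rfl, rfl, rfl⟩
    exact (hκ p hp).2.2

instance ad_range_normal : ad.range.Normal := by
  constructor
  rintro _ ⟨g, rfl⟩ θ
  exact ⟨θ g, by rw [mul_ad, mul_assoc, mul_inv_cancel, mul_one]⟩

/-- The outer automorphism group. -/
abbrev Out := G ⧸ ad.range

/-- The quotient map to the outer automorphism group. -/
abbrev qm : G →* Out := QuotientGroup.mk' ad.range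

theorem qm_ad (g : F) : qm (ad g) = 1 := by
  rw [QuotientGroup.mk'_apply, QuotientGroup.eq_one_iff]
  exact ⟨g, rfl⟩

theorem exists_ad_of_qm_eq {θ ψ : G} (h : qm θ = qm ψ) : ∃ g, θ = ad g * ψ := by
  have : θ * ψ⁻¹ ∈ ad.range := by
    rw [← QuotientGroup.eq_one_iff]
    have : qm (θ * ψ⁻¹) = 1 := by rw [map_mul, map_inv, h, mul_inv_cancel]
    exact this
  obtain ⟨g, hg⟩ := this
  exact ⟨g, by rw [hg]; group⟩

theorem posWord_append (u v : List Bool) : posWord (u ++ v) = posWord u * posWord v := by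
  simp [posWord]

theorem posWord_singleton (x : Bool) : posWord [x] = elem x := by simp [posWord]

theorem qm_posWord_unique {w w' : List Bool} {σ σ' : G} (hσ : σ ∈ signed) (hσ' : σ' ∈ signed)
    (h : qm (posWord w * σ) = qm (posWord w' * σ')) : w = w' := by
  obtain ⟨g, hg⟩ := exists_ad_of_qm_eq h
  refine (posWord_unique hσ hσ' ?_).1
  rw [hg, abMatrix_mul, abMatrix_ad, one_mul]

theorem qm_flipB_mul_self : qm flipB * qm flipB = 1 := by
  rw [← map_mul, flipB_mul_self, map_one]

theorem qm_posWord_inv (w : List Bool) :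
    (qm (posWord w))⁻¹ = qm flipB * qm (posWord w.reverse) * qm flipB := by
  induction w with
  | nil =>
    rw [List.reverse_nil]
    simp only [posWord, List.map_nil, List.prod_nil, map_one, inv_one, mul_one]
    exact qm_flipB_mul_self.symm
  | cons x w ih =>
    have h₁ : (qm (elem x))⁻¹ = qm flipB * qm (elem x) * qm flipB := by
      rw [← map_inv]
      cases x
      · rw [elem_false, autL_inv_eq_flipB]
        simp only [map_mul, qm_ad, one_mul]
      · rw [elem_true, autR_inv_eq_flipB]
        simp only [map_mul]
    have h₂ : posWord (x :: w) = elem x * posWord w := by simp [posWord]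
    rw [h₂, map_mul, mul_inv_rev, ih, h₁, List.reverse_cons, posWord_append, posWord_singleton,
      map_mul]
    calc _ = qm flipB * qm (posWord w.reverse) * (qm flipB * qm flipB) * qm (elem x) *
        qm flipB := by group
      _ = _ := by rw [qm_flipB_mul_self]; group

/-- Moving a flip across an elementary automorphism of the other type. -/
theorem exists_turn (x : Bool) : ∃ τ ∈ signed,
    (∀ v, qm τ * qm (posWord v) = qm (posWord (v.map not)) * qm τ) ∧
    qm (elem x * flipB * elem (!x)) = qm (elem (!x) * τ) := by
  have comm {τ : G} (h₁ : qm (τ * autL) = qm (autR * τ)) (h₂ : qm (τ * autR) = qm (autL * τ))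
      (v : List Bool) : qm τ * qm (posWord v) = qm (posWord (v.map not)) * qm τ := by
    induction v with
    | nil => simp [posWord]
    | cons x v ih =>
      have e (x : Bool) (v : List Bool) : qm (posWord (x :: v)) = qm (elem x) * qm (posWord v) := by
        rw [← map_mul]; simp [posWord]
      have hx : qm τ * qm (elem x) = qm (elem (!x)) * qm τ := by
        rw [← map_mul, ← map_mul]
        cases x
        · exact h₁
        · exact h₂
      rw [List.map_cons, e, e, ← mul_assoc, hx, mul_assoc, ih, mul_assoc]
  have inner {θ ψ : G} (g : F) (h : θ = ad g * ψ) : qm θ = qm ψ := by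
    rw [h, map_mul, qm_ad, one_mul]
  cases x
  · exact ⟨swapInv, swapInv_mem,
      comm (inner 1 (aut_ext (by simp) (by simp))) (inner 1 (aut_ext (by simp) (by simp))),
      inner (a * b) (aut_ext (by simp [ad, mul_assoc]) (by simp [ad]))⟩
  · exact ⟨flipA * flipB * swapInv, mul_mem (mul_mem flipA_mem flipB_mem) swapInv_mem,
      comm (inner b (aut_ext (by simp [ad]) (by simp [ad, mul_assoc])))
        (inner a⁻¹ (aut_ext (by simp [ad]) (by simp [ad, mul_assoc]))),
      inner 1 (aut_ext (by simp) (by simp))⟩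

theorem exists_common_isPrefix (u v : List Bool) : ∃ p u' v', u = p ++ u' ∧ v = p ++ v' ∧
    (u' = [] ∨ v' = [] ∨ ∃ x u'' v'', u' = x :: u'' ∧ v' = (!x) :: v'') := by
  induction u generalizing v with
  | nil => exact ⟨[], [], v, rfl, rfl, .inl rfl⟩
  | cons x u ih =>
    rcases v with _ | ⟨y, v⟩
    · exact ⟨[], x :: u, [], rfl, rfl, .inr (.inl rfl)⟩
    · by_cases h : x = y
      · obtain ⟨p, u', v', rfl, rfl, h'⟩ := ih v
        exact ⟨x :: p, u', v', rfl, by simp [h], h'⟩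
      · refine ⟨[], x :: u, y :: v, rfl, rfl, .inr (.inr ⟨x, u, v, rfl, ?_⟩)⟩
        revert h; cases x <;> cases y <;> simp

/-- The classes of automorphisms with a normal form of bounded size. -/
def outBall (r : ℕ) : Set Out := {q | ∃ h, HasNormalForm h r ∧ qm h = q}

theorem exists_rep (r : ℕ) (q : Out) : ∃ (i : Bool) (w : List Bool) (σ : G), σ ∈ signed ∧
    q = qm (orient i) * qm (posWord w) * qm σ ∧ (q ∈ outBall r → w.length ≤ r) := by
  have aux {h : G} {n : ℕ} (hh : HasNormalForm h n) : ∃ (i : Bool) (w : List Bool) (σ : G),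
      σ ∈ signed ∧ qm h = qm (orient i) * qm (posWord w) * qm σ ∧ w.length ≤ n := by
    obtain ⟨p, -, ω, hω, σ, hσ, rfl⟩ := hh
    refine ⟨ω.1, ω.2, σ, hσ, ?_, hω⟩
    rw [map_mul, map_mul, qm_ad, one_mul, phi, map_mul, posWord]
  by_cases hq : q ∈ outBall r
  · obtain ⟨h, hh, rfl⟩ := hq
    obtain ⟨i, w, σ, h₁, h₂, h₃⟩ := aux hh
    exact ⟨i, w, σ, h₁, h₂, fun _ => h₃⟩
  · obtain ⟨h, rfl⟩ := QuotientGroup.mk'_surjective _ q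
    obtain ⟨n, hn⟩ := exists_hasNormalForm h
    obtain ⟨i, w, σ, h₁, h₂, -⟩ := aux hn
    exact ⟨i, w, σ, h₁, h₂, fun h => absurd h hq⟩

open Classical in
/-- The positive word read off from an outer automorphism of positive type. -/
noncomputable def readWord (q : Out) : List Bool :=
  if h : ∃ w : List Bool, ∃ σ ∈ signed, q = qm (posWord w * σ) then h.choose else []

theorem readWord_eq {q : Out} {w : List Bool} {σ : G} (hσ : σ ∈ signed)
    (h : q = qm (posWord w * σ)) : readWord q = w := by
  have h' : ∃ w : List Bool, ∃ σ ∈ signed, q = qm (posWord w * σ) := ⟨w, σ, hσ, h⟩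
  rw [readWord, dif_pos h']
  obtain ⟨τ, hτ, e⟩ := h'.choose_spec
  exact qm_posWord_unique hτ hσ (e ▸ h)

theorem qm_orient_mul_self (i : Bool) : qm (orient i) * qm (orient i) = 1 := by
  cases i
  · simp [orient]
  · exact qm_flipB_mul_self

/-- The possible values of the third difference of a centroid. -/
noncomputable def thirdLeg (z : Out) (t : G × ℕ × Option Bool × Bool) : Out :=
  (qm t.1)⁻¹ * (qm (posWord (t.2.2.1.toList ++
    ((readWord (qm flipB * qm t.1 * z)).take t.2.1).reverse)))⁻¹ * qm (orient t.2.2.2)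

theorem exists_out_centroid {i i' : Bool} {u v : List Bool} {s s' : G} (hs' : s' ∈ signed)
    {y z : Out} (hy : y = qm (orient i) * qm (posWord u) * qm s)
    (hx : y * z = qm (orient i') * qm (posWord v) * qm s') :
    ∃ c : Out, (c = 1 ∨ ∃ k ≤ u.length, c = qm (orient i) * qm (posWord (u.take k)) ∧
      c = qm (orient i') * qm (posWord (v.take k))) ∧
      ∃ k ≤ u.length, ∃ t j, y⁻¹ * c = thirdLeg z (s, k, t, j) := by
  have hz : z = (qm s)⁻¹ * (qm (posWord u))⁻¹ * (qm (orient i))⁻¹ *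
      (qm (orient i') * qm (posWord v) * qm s') := by
    rw [← hx, hy]; group
  have hfl : (qm flipB)⁻¹ = qm flipB := by rw [← map_inv, flipB_inv]
  by_cases hi : i = i'
  · subst hi
    obtain ⟨p, u', v', rfl, rfl, h⟩ := exists_common_isPrefix u v
    refine ⟨qm (orient i) * qm (posWord p), .inr ⟨p.length, by simp, by simp, by simp⟩, ?_⟩
    have hq : y⁻¹ * (qm (orient i) * qm (posWord p)) = (qm s)⁻¹ * (qm (posWord u'))⁻¹ := by
      rw [hy, posWord_append, map_mul]; group
    have hz' : qm flipB * qm s * z =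
        qm (posWord u'.reverse) * qm flipB * qm (posWord v') * qm s' := by
      rw [hz, posWord_append, posWord_append, map_mul, map_mul, mul_inv_rev,
        qm_posWord_inv u']
      calc _ = qm flipB * qm flipB * qm (posWord u'.reverse) * qm flipB * qm (posWord v') *
            qm s' := by group
        _ = _ := by rw [qm_flipB_mul_self, one_mul]
    rw [hq]
    rcases h with rfl | rfl | ⟨x, u'', v'', rfl, rfl⟩
    · exact ⟨0, by simp, none, false, by simp [thirdLeg, posWord, orient]⟩
    · have : readWord (qm flipB * qm s * z) = u'.reverse :=
        readWord_eq (mul_mem flipB_mem hs') (by rw [hz']; simp [posWord, mul_assoc])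
      exact ⟨u'.length, by simp, none, false, by
        rw [thirdLeg]; simp only [this]; simp [orient, List.take_of_length_le]⟩
    · obtain ⟨τ, hτ, h₁, h₂⟩ := exists_turn x
      have : readWord (qm flipB * qm s * z) = u''.reverse ++ [!x] ++ v''.map not := by
        refine readWord_eq (mul_mem hτ hs') ?_
        rw [hz', List.reverse_cons, posWord_append, posWord_singleton, posWord_append,
          posWord_append, posWord_singleton]
        have e : posWord ((!x) :: v'') = elem (!x) * posWord v'' := by simp [posWord]
        rw [e]
        calc _ = qm (posWord u''.reverse) * qm (elem x * flipB * elem (!x)) *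
              qm (posWord v'') * qm s' := by simp only [map_mul, mul_assoc]
          _ = qm (posWord u''.reverse) * qm (elem (!x)) * (qm τ * qm (posWord v'')) * qm s' := by
            rw [h₂]; simp only [map_mul, mul_assoc]
          _ = _ := by rw [h₁]; simp only [map_mul, mul_assoc]
      refine ⟨u''.length, by simp; omega, some x, false, ?_⟩
      rw [thirdLeg]
      simp only [this]
      simp [orient]
  · have hz' : qm flipB * qm s * z = qm (posWord (u.reverse ++ v) * s') := by
      have ho : (qm (orient i))⁻¹ * qm (orient i') = qm flipB := by
        cases i <;> cases i' <;> simp_all [orient]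
      calc _ = qm flipB * (qm (posWord u))⁻¹ * ((qm (orient i))⁻¹ * qm (orient i')) *
            qm (posWord v) * qm s' := by rw [hz]; group
        _ = (qm flipB * qm flipB) * qm (posWord u.reverse) * (qm flipB * qm flipB) *
            qm (posWord v) * qm s' := by rw [ho, qm_posWord_inv]; group
        _ = _ := by
            rw [qm_flipB_mul_self, posWord_append, map_mul, map_mul]; group
    have := readWord_eq hs' hz'
    refine ⟨1, .inl rfl, u.length, le_rfl, none, i, ?_⟩
    rw [thirdLeg, hy]
    simp only [this]
    have ho : (qm (orient i))⁻¹ = qm (orient i) := inv_eq_of_mul_eq_one_left (qm_orient_mul_self i)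
    rw [mul_one, mul_inv_rev, mul_inv_rev, ho]
    simp [mul_assoc]

theorem exists_triBound_out : ∃ A : ℕ, ∀ r,
    TriBound {p : Out × Out | p.1 ∈ outBall r} (A * (r + 1) ^ 3) := by
  classical
  refine ⟨24 * signed_finite.toFinset.card, fun r => ?_⟩
  choose i w σ hσ hrep hw using exists_rep r
  let S (x : Out) : Set (Unit × Out) := {((), 1)} ∪
    ((fun k => ((), qm (orient (i x)) * qm (posWord ((w x).take k)))) '' (Finset.range (r + 1)))
  have hS (x) : (S x).encard ≤ (r + 2 : ℕ) := by
    refine (Set.encard_union_le _ _).trans ?_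
    refine (add_le_add_right (Set.encard_image_le _ _) _).trans ?_
    rw [Set.encard_coe_eq_coe_finsetCard]
    simp only [Set.encard_singleton, Finset.card_range]
    norm_cast
    omega
  let J : Finset (G × ℕ × Option Bool × Bool) :=
    signed_finite.toFinset ×ˢ Finset.range (r + 1) ×ˢ Finset.univ
  have key := triBound_of_exists_centroid {p : Out × Out | p.1 ∈ outBall r} S S
    (fun _ z => thirdLeg z '' J) (r + 2) (r + 2) (J.card) ?_ hS hS ?_
  · refine key.mono subset_rfl ?_
    simp only [J, Finset.card_product, Finset.card_range, Finset.card_univ, Fintype.card_prod,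
      Fintype.card_option, Fintype.card_bool]
    have : (r + 2) * (r + 2) ≤ (2 * (r + 1)) * (2 * (r + 1)) := Nat.mul_le_mul (by omega) (by omega)
    calc _ = ((r + 2) * (r + 2)) * (signed_finite.toFinset.card * (r + 1) * 6) := by ring
      _ ≤ ((2 * (r + 1)) * (2 * (r + 1))) * (signed_finite.toFinset.card * (r + 1) * 6) :=
        Nat.mul_le_mul_right _ this
      _ = _ := by ring
  · rintro ⟨y, z⟩ hy
    obtain ⟨c, hc, k, hk, t, j, h⟩ := exists_out_centroid (hσ (y * z)) (hrep y) (hrep (y * z))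
    have hr := hw y hy
    refine ⟨((), c), ?_, ?_, ⟨(σ y, k, t, j), ?_, h.symm⟩⟩
    · rcases hc with rfl | ⟨k, hk, hc, -⟩
      · exact .inl rfl
      · exact .inr ⟨k, by simp; omega, by rw [hc]⟩
    · rcases hc with rfl | ⟨k, hk, -, hc⟩
      · exact .inl rfl
      · exact .inr ⟨k, by simp; omega, by rw [hc]⟩
    · simp only [J, Finset.coe_product, Set.mem_prod, Finset.mem_coe, Set.Finite.mem_toFinset,
        Finset.mem_range, Finset.coe_univ, Set.mem_univ, and_true]
      exact ⟨hσ y, by omega⟩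
  · intro _ z
    refine (Set.encard_image_le _ _).trans ?_
    rw [Set.encard_coe_eq_coe_finsetCard]

/-- The action of `flipA` on letters. -/
def flipAL (l : Letter) : Letter := if l.1 = 0 then linv l else l

/-- The action of `flipB` on letters. -/
def flipBL (l : Letter) : Letter := if l.1 = 1 then linv l else l

/-- The action of `swapInv` on letters. -/
def swapL (l : Letter) : Letter := (if l.1 = 0 then 1 else 0, !l.2)

theorem toWord_flipA (g : F) : (flipA g).toWord = g.toWord.map flipAL := by
  refine (toWord_signed (f := flipA.toMonoidHom) (l := (0, false)) (m := (1, true))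
    flipA_a flipA_b (by decide) g).trans ?_
  congr 1; funext l; revert l; unfold relabel flipAL linv; decide

theorem toWord_flipB (g : F) : (flipB g).toWord = g.toWord.map flipBL := by
  refine (toWord_signed (f := flipB.toMonoidHom) (l := (0, true)) (m := (1, false))
    flipB_a ?_ (by decide) g).trans ?_
  · exact flipB_b.trans b_inv_eq
  congr 1; funext l; revert l; unfold relabel flipBL linv; decide

theorem toWord_swapInv (g : F) : (swapInv g).toWord = g.toWord.map swapL := by
  refine (toWord_signed (f := swapInv.toMonoidHom) (l := (1, false)) (m := (0, false))
    (swapInv_a.trans b_inv_eq) (swapInv_b.trans a_inv_eq) (by decide) g).trans ?_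
  congr 1; funext l; revert l; unfold relabel swapL; decide

theorem flipAL_flipAL (l : Letter) : flipAL (flipAL l) = l := by
  revert l; unfold flipAL linv; decide
theorem flipBL_flipBL (l : Letter) : flipBL (flipBL l) = l := by
  revert l; unfold flipBL linv; decide
theorem swapL_swapL (l : Letter) : swapL (swapL l) = l := by
  revert l; unfold swapL; decide

theorem map_eq_some_of_invol {e : Letter → Letter} (he : ∀ l, e (e l) = l) {o : Option Letter}
    {l : Letter} : o.map e = some l ↔ o = some (e l) := by
  rw [Option.map_eq_some_iff]
  constructor
  · rintro ⟨x, rfl, rfl⟩; rw [he]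
  · rintro rfl; exact ⟨_, rfl, he l⟩

theorem hd_flipA (g : F) : hd (flipA g) = (hd g).map flipAL := by
  rw [hd, toWord_flipA, List.head?_map]; rfl

theorem hd_flipB (g : F) : hd (flipB g) = (hd g).map flipBL := by
  rw [hd, toWord_flipB, List.head?_map]; rfl

theorem hd_swapInv (g : F) : hd (swapInv g) = (hd g).map swapL := by
  rw [hd, toWord_swapInv, List.head?_map]; rfl

theorem hd_flipA_eq {g : F} {l : Letter} : hd (flipA g) = some l ↔ hd g = some (flipAL l) := by
  rw [hd_flipA, map_eq_some_of_invol flipAL_flipAL]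

theorem hd_flipB_eq {g : F} {l : Letter} : hd (flipB g) = some l ↔ hd g = some (flipBL l) := by
  rw [hd_flipB, map_eq_some_of_invol flipBL_flipBL]

theorem hd_swapInv_eq {g : F} {l : Letter} :
    hd (swapInv g) = some l ↔ hd g = some (swapL l) := by
  rw [hd_swapInv, map_eq_some_of_invol swapL_swapL]

/-- The first letter of the image of a word under `autL`. -/
theorem hd_autL (g : F) : hd (autL g) = if hd g = some (1, true) then some (0, true) else
    if hd (a * g) = some (1, true) then some (1, true) else hd g := by
  induction hn : g.toWord.length using Nat.strong_induction_on generalizing g with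
  | _ n ih =>
  rcases hd_cases g with rfl | ⟨l, k, hg, hk, hw⟩
  · simp [← lt_a]
  have ihk := ih _ (by rw [← hn, hw]; simp) k rfl
  have hgl : hd g = some l := by rw [hd, hw]; rfl
  rcases letter_cases l with rfl | rfl | rfl | rfl
  · have h₁ : hd (autL k) ≠ some (0, false) := by
      rw [ihk]; split_ifs
      · simp
      · simp
      · exact hk
    have h₂ : hd (a * g) = some (0, true) := hd_lt_mul (l := (0, true)) (by simp [hgl, linv])
    rw [h₂, hgl, hg]
    simpa using hd_lt_mul (l := (0, true)) h₁
  · have h₂ : a * g = k := by rw [hg]; simp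
    rw [h₂, hgl, hg, map_mul]
    simp only [lt_a_inv, map_inv, autL_a]
    by_cases hkb : hd k = some (1, true)
    · obtain ⟨k', hk', hk'', hw'⟩ := exists_of_hd_eq hkb
      have ihk' := ih _ (by rw [← hn, hw, hw']; simp) k' rfl
      have h₁ : hd (autL k') ≠ some (1, false) := by
        rw [ihk']; split_ifs
        · simp
        · simp
        · exact hk''
      have := hd_lt_mul (l := (1, true)) h₁
      have e : a⁻¹ * autL k = b * autL k' := by rw [hk']; simp [mul_assoc]
      rw [e]
      simpa [hkb] using this
    · have h₁ : hd (autL k) ≠ some (0, true) := by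
        rw [ihk]; split_ifs
        · simp
        · exact hk
      have := hd_lt_mul (l := (0, false)) h₁
      simpa [hkb] using this
  · have h₁ : hd (autL k) ≠ some (1, false) := by
      rw [ihk]; split_ifs
      · simp
      · simp
      · exact hk
    have h₂ := hd_lt_mul (l := (1, true)) h₁
    have h₃ := hd_lt_mul (l := (0, true)) (g := lt (1, true) * autL k) (by rw [h₂]; simp [linv])
    rw [hgl, hg]
    simpa [mul_assoc] using h₃
  · have h₂ : hd (a * g) = some (0, true) := hd_lt_mul (l := (0, true)) (by simp [hgl, linv])
    have h₁ : hd (a⁻¹ * autL k) ≠ some (1, true) := by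
      by_cases hka : hd k = some (0, true)
      · obtain ⟨k', hk', hk'', hw'⟩ := exists_of_hd_eq hka
        have ihk' := ih _ (by rw [← hn, hw, hw']; simp) k' rfl
        have e : a⁻¹ * autL k = autL k' := by rw [hk']; simp
        have h₃ : hd (a * k') ≠ some (1, true) := by
          rw [← lt_a, ← hk', hka]; simp
        rw [e, ihk']; split_ifs with h₄
        · simp
        · exact h₄
      · have h₁ : hd (autL k) ≠ some (0, true) := by
          rw [ihk]; split_ifs with h
          · exact absurd h hk
          · simp
          · exact hka
        have := hd_lt_mul (l := (0, false)) h₁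
        rw [lt_a_inv] at this
        rw [this]; simp
    have := hd_lt_mul (l := (1, false)) h₁
    rw [h₂, hgl, hg]
    simpa [mul_assoc] using this

theorem autL_symm_apply (g : F) : MulEquiv.symm autL g = flipA (autL (flipA g)) := by
  have := DFunLike.congr_fun autL_inv_eq g
  simpa using this

/-- The first letter of the image of a word under the inverse of `autL`. -/
theorem hd_autL_symm (g : F) : hd (MulEquiv.symm autL g) =
    if hd g = some (1, true) then some (0, false) else
    if hd (a⁻¹ * g) = some (1, true) then some (1, true) else hd g := by
  have h₁ : a * flipA g = flipA (a⁻¹ * g) := by simp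
  have h₂ : flipAL (1, true) = (1, true) := rfl
  rw [autL_symm_apply, hd_flipA, hd_autL, h₁]
  simp only [hd_flipA_eq, h₂]
  split_ifs
  · rfl
  · rfl
  · rw [hd_flipA, Option.map_map]
    convert Option.map_id'
    exact flipAL_flipAL _

/-- A set meets another set and its complement does as well. -/
def Split (K U : Set F) : Prop := (U ∩ K).Nonempty ∧ (U \ K).Nonempty

theorem Split.mono {K U V : Set F} (h : Split K U) (hUV : U ⊆ V) : Split K V :=
  ⟨h.1.mono (Set.inter_subset_inter_left _ hUV), h.2.mono (Set.sdiff_subset_sdiff_left hUV)⟩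

/-- The translate by `m` of the set of words starting with a given letter. -/
def cone (m : F) (l : Letter) : Set F := {g | hd (m⁻¹ * g) = some l}

/-- A set that does not split both halfspaces of a turn of a given kind. -/
def NoTurn (k : Bool) (K : Set F) : Prop :=
  ∀ m s, ¬ (Split K (cone m (0, s)) ∧ Split K (cone m (1, xor s k)))

theorem split_image {θ : G} {K U : Set F} : Split (θ '' K) U ↔ Split K (θ ⁻¹' U) := by
  rw [Split, Split]
  constructor
  · rintro ⟨⟨_, h, y, hy, rfl⟩, ⟨x, h₁, h₂⟩⟩
    refine ⟨⟨y, h, hy⟩, ⟨θ⁻¹ x, by simpa using h₁, fun h => h₂ ⟨_, h, by simp⟩⟩⟩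
  · rintro ⟨⟨y, h, hy⟩, ⟨x, h₁, h₂⟩⟩
    refine ⟨⟨θ y, h, y, hy, rfl⟩, ⟨θ x, h₁, ?_⟩⟩
    rintro ⟨x', hx', h'⟩
    exact h₂ (θ.injective h' ▸ hx')

theorem NoTurn.image {θ : G} {k k' : Bool} {K : Set F} (h : NoTurn k K)
    (hθ : ∀ s, ∃ m s', (∀ g, hd (θ g) = some (0, s) → hd (m⁻¹ * g) = some (0, s')) ∧
        (∀ g, hd (θ g) = some (1, xor s k') → hd (m⁻¹ * g) = some (1, xor s' k)) ∨
      (∀ g, hd (θ g) = some (1, xor s k') → hd (m⁻¹ * g) = some (0, s')) ∧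
        (∀ g, hd (θ g) = some (0, s) → hd (m⁻¹ * g) = some (1, xor s' k))) :
    NoTurn k' (θ '' K) := by
  rintro m s ⟨h₁, h₂⟩
  rw [split_image] at h₁ h₂
  obtain ⟨m', s', hs⟩ := hθ s
  have key {l l' : Letter} (hl : ∀ g, hd (θ g) = some l → hd (m'⁻¹ * g) = some l') :
      θ ⁻¹' cone m l ⊆ cone (θ⁻¹ m * m') l' := by
    intro g hg
    have := hl (θ⁻¹ m⁻¹ * g) (by simpa [cone] using hg)
    simpa [cone, mul_assoc] using this
  rcases hs with ⟨h₃, h₄⟩ | ⟨h₃, h₄⟩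
  · exact h _ s' ⟨h₁.mono (key h₃), h₂.mono (key h₄)⟩
  · exact h _ s' ⟨h₂.mono (key h₃), h₁.mono (key h₄)⟩

theorem noTurn_autL {K : Set F} (h : NoTurn false K) : NoTurn false (autL '' K) := by
  refine h.image fun s => ?_
  cases s
  · refine ⟨1, false, .inl ⟨fun g hg => ?_, fun g hg => ?_⟩⟩ <;>
    · rw [hd_autL] at hg
      split_ifs at hg <;> simp_all
  · refine ⟨a⁻¹, true, .inl ⟨fun g hg => ?_, fun g hg => ?_⟩⟩
    · rw [hd_autL] at hg
      rw [inv_inv]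
      have : hd g ≠ some (0, false) := by split_ifs at hg <;> simp_all
      exact hd_lt_mul (l := (0, true)) this
    · rw [hd_autL] at hg
      rw [inv_inv]
      split_ifs at hg <;> simp_all

theorem noTurn_flipA {k : Bool} {K : Set F} (h : NoTurn k K) : NoTurn (!k) (flipA '' K) := by
  refine h.image fun s => ⟨1, !s, .inl ⟨fun g hg => ?_, fun g hg => ?_⟩⟩ <;>
  · rw [hd_flipA_eq] at hg
    cases s <;> cases k <;> simpa [flipAL, linv] using hg

theorem noTurn_flipB {k : Bool} {K : Set F} (h : NoTurn k K) : NoTurn (!k) (flipB '' K) := by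
  refine h.image fun s => ⟨1, s, .inl ⟨fun g hg => ?_, fun g hg => ?_⟩⟩ <;>
  · rw [hd_flipB_eq] at hg
    cases s <;> cases k <;> simpa [flipBL, linv] using hg

theorem noTurn_swapInv {k : Bool} {K : Set F} (h : NoTurn k K) : NoTurn k (swapInv '' K) := by
  refine h.image fun s => ⟨1, !(xor s k), .inr ⟨fun g hg => ?_, fun g hg => ?_⟩⟩ <;>
  · rw [hd_swapInv_eq] at hg
    cases s <;> cases k <;> simpa [swapL] using hg

theorem hd_of_split_cone {m m' : F} {l x : Letter} (h : Split (cone m l) (cone m' x)) :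
    hd (m'⁻¹ * m) = some x := by
  by_contra hne
  have key {u : F} (hu : u ∈ cone m' x) :
      hd (m⁻¹ * u) = ((m⁻¹ * m').toWord ++ [x]).head? := by
    obtain ⟨k, -, -, hw⟩ := exists_of_hd_eq hu
    have : Sep (m⁻¹ * m')⁻¹ (m'⁻¹ * u) := by
      intro y hy hy'
      rw [mul_inv_rev, inv_inv] at hy
      rw [hu] at hy'
      exact hne (hy.trans hy'.symm)
    have := toWord_mul_of_sep this
    rw [mul_assoc, mul_inv_cancel_left] at this
    rw [hd, this, hw]
    cases (m⁻¹ * m').toWord <;> rfl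
  obtain ⟨⟨u, hu, hu'⟩, ⟨v, hv, hv'⟩⟩ := h
  exact hv' ((key hv).trans ((key hu).symm.trans hu'))

/-- Halfspaces split no two disjoint cones with a common base point. -/
theorem noTurn_cone (k : Bool) (m : F) (l : Letter) : NoTurn k (cone m l) := by
  rintro m' s ⟨h₁, h₂⟩
  have := (hd_of_split_cone h₁).symm.trans (hd_of_split_cone h₂)
  simp at this

/-- The sign of a letter with respect to a kind of monotone words. -/
def sg (k : Bool) (l : Letter) : Bool := xor l.2 (k && decide (l.1 = 1))

theorem sg_linv (k : Bool) (l : Letter) : sg k (linv l) = !sg k l := by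
  revert k l; unfold sg linv; decide

theorem sg_flipAL (k : Bool) (l : Letter) : sg (!k) (flipAL l) = !sg k l := by
  revert k l; unfold sg flipAL linv; decide

theorem sg_flipBL (k : Bool) (l : Letter) : sg (!k) (flipBL l) = sg k l := by
  revert k l; unfold sg flipBL linv; decide

theorem sg_swapL (k : Bool) (l : Letter) : sg k (swapL l) = xor (sg k l) (!k) := by
  revert k l; unfold sg swapL; decide

/-- Words all of whose letters have a given sign. -/
def Mono (k s : Bool) (w : List Letter) : Prop := ∀ l ∈ w, sg k l = s

/-- Words with bounded powers of letters. -/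
def RunLE (n : ℕ) (w : List Letter) : Prop := ∀ l m, List.replicate m l <:+: w → m ≤ n

theorem Mono.of_isInfix {k s : Bool} {w w' : List Letter} (h : Mono k s w) (hw : w' <:+: w) :
    Mono k s w' := fun l hl => h l (hw.subset hl)

theorem RunLE.of_isInfix {n : ℕ} {w w' : List Letter} (h : RunLE n w) (hw : w' <:+: w) :
    RunLE n w' := fun l m hm => h l m (hm.trans hw)

theorem RunLE.mono {n n' : ℕ} {w : List Letter} (h : RunLE n w) (hn : n ≤ n') : RunLE n' w :=
  fun l m hm => (h l m hm).trans hn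

theorem RunLE.map {n : ℕ} {w : List Letter} {e : Letter → Letter} (he : ∀ l, e (e l) = l)
    (h : RunLE n w) : RunLE n (w.map e) := by
  intro l m hm
  have := hm.map e
  rw [List.map_map, List.map_replicate, show e ∘ e = id from funext he, List.map_id] at this
  exact h _ m this

theorem RunLE.invRev {n : ℕ} {w : List Letter} (h : RunLE n w) :
    RunLE n (FreeGroup.invRev w) := by
  intro l m hm
  have := List.reverse_infix.2 hm
  rw [FreeGroup.invRev, List.reverse_reverse, List.reverse_replicate] at this
  exact h.map (e := linv) linv_linv l m this

theorem mem_invRev {w : List Letter} {l : Letter} :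
    l ∈ FreeGroup.invRev w ↔ linv l ∈ w := by
  rw [FreeGroup.invRev, List.mem_reverse, List.mem_map]
  constructor
  · rintro ⟨x, hx, rfl⟩
    simpa [linv] using hx
  · intro h
    exact ⟨_, h, by simp [linv]⟩

theorem Mono.invRev {k s : Bool} {w : List Letter} (h : Mono k s w) :
    Mono k (!s) (FreeGroup.invRev w) := fun l hl => by
  have := h _ (mem_invRev.1 hl)
  rw [sg_linv] at this
  simp [← this]

/-- Reading a word while counting the current power. -/
def runOK (n : ℕ) : Letter → ℕ → List Letter → Prop
  | _, k, [] => k ≤ n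
  | x, k, y :: w => if y = x then runOK n x (k + 1) w else k ≤ n ∧ runOK n y 1 w

theorem runOK_of_runLE {n : ℕ} {w : List Letter} {x : Letter} {k : ℕ}
    (h : RunLE n (List.replicate k x ++ w)) : runOK n x k w := by
  induction w generalizing x k with
  | nil => exact h x k (by simp)
  | cons y w ih =>
    rw [runOK]
    split_ifs with hy
    · subst hy
      apply ih
      rwa [List.replicate_succ', List.append_assoc]
    · refine ⟨h x k (List.prefix_append _ _).isInfix, ih (h.of_isInfix ?_)⟩
      exact (List.suffix_append _ _).isInfix

theorem runOK.le {n k : ℕ} {x : Letter} {w : List Letter} (h : runOK n x k w) : k ≤ n := by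
  induction w generalizing x k with
  | nil => exact h
  | cons y w ih =>
    rw [runOK] at h
    split_ifs at h
    · exact (Nat.le_succ k).trans (ih h)
    · exact h.1

theorem runOK.append {n k : ℕ} {x : Letter} {u w : List Letter} (h : runOK n x k (u ++ w)) :
    ∃ x' k', runOK n x' k' w := by
  induction u generalizing x k with
  | nil => exact ⟨x, k, h⟩
  | cons y u ih =>
    rw [List.cons_append, runOK] at h
    split_ifs at h
    · exact ih h
    · exact ih h.2

theorem runOK.replicate {n k m : ℕ} {x : Letter} {w : List Letter}
    (h : runOK n x k (List.replicate m x ++ w)) : k + m ≤ n := by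
  induction m generalizing k with
  | zero => exact h.le
  | succ m ih =>
    rw [List.replicate_succ, List.cons_append, runOK, if_pos rfl] at h
    have := ih h
    omega

theorem runOK.runLE {n k : ℕ} {x : Letter} {w : List Letter} (h : runOK n x k w) :
    RunLE n w := by
  rintro l m ⟨u, v, rfl⟩
  rw [List.append_assoc] at h
  obtain ⟨y, j, h⟩ := h.append
  cases m with
  | zero => simp
  | succ m =>
    by_cases hy : l = y
    · subst hy
      have := h.replicate
      omega
    · rw [List.replicate_succ, List.cons_append, runOK, if_neg hy] at h
      have := h.2.replicate
      omega

/-- The substitution by which `autL` acts on monotone words. -/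
def subL (l : Letter) : List Letter := if l.1 = 1 then [(0, l.2), l] else [l]

theorem sg_of_mem_subL {l x : Letter} (h : x ∈ subL l) : sg false x = sg false l := by
  revert h; revert l x; unfold sg subL; decide

theorem toWord_autL_of_mono {g : F} (h : Mono false true g.toWord) :
    (autL g).toWord = g.toWord.flatMap subL := by
  induction g using word_induction with
  | h1 => simp
  | hl l g hg ih =>
    rw [toWord_lt_mul hg] at h ⊢
    have ih := ih (h.of_isInfix (List.suffix_cons l _).isInfix)
    have hne {x : Letter} (hx : x.2 = false) : hd (autL g) ≠ some x := by
      rw [hd, ih]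
      intro h'
      obtain ⟨y, hy, hxy⟩ := List.mem_flatMap.1 (List.mem_of_head? h')
      have h₁ := h y (List.mem_cons_of_mem _ hy)
      rw [← sg_of_mem_subL hxy, sg, hx] at h₁
      simp at h₁
    have hl := h l List.mem_cons_self
    rcases letter_cases l with rfl | rfl | rfl | rfl
    · rw [List.flatMap_cons, ← ih, map_mul, lt_a, autL_a]
      exact toWord_lt_mul (hne rfl)
    · simp [sg] at hl
    · rw [List.flatMap_cons, ← ih, map_mul, lt_b, autL_b, mul_assoc]
      have h₁ := toWord_lt_mul (l := (1, true)) (hne rfl)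
      have h₂ := toWord_lt_mul (l := (0, true)) (g := lt (1, true) * autL g)
        (by rw [hd, h₁]; simp [linv])
      rw [h₁] at h₂
      exact h₂
    · simp [sg] at hl

theorem runOK_flatMap_subL {n : ℕ} {w : List Letter} (hw : Mono false true w) {x : Letter}
    {k k' : ℕ} (h : runOK n x k w)
    (hx : x = (0, true) ∧ k' ≤ k ∨ x = (1, true) ∧ k' ≤ 1) :
    runOK (n + 1) x k' (w.flatMap subL) := by
  induction w generalizing x k k' with
  | nil =>
    have := h.le
    change k' ≤ n + 1
    omega
  | cons y w ih =>
    have hw' : Mono false true w := hw.of_isInfix (List.suffix_cons _ _).isInfix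
    have hy := hw y List.mem_cons_self
    have hkn := h.le
    rw [runOK] at h
    rcases letter_cases y with rfl | rfl | rfl | rfl
    · change runOK (n + 1) x k' ((0, true) :: w.flatMap subL)
      rw [runOK]
      rcases hx with ⟨rfl, hx⟩ | ⟨rfl, hx⟩
      · rw [if_pos rfl] at h ⊢
        exact ih hw' h (.inl ⟨rfl, by omega⟩)
      · rw [if_neg (by decide)] at h ⊢
        exact ⟨by omega, ih hw' h.2 (.inl ⟨rfl, le_rfl⟩)⟩
    · simp [sg] at hy
    · change runOK (n + 1) x k' ((0, true) :: (1, true) :: w.flatMap subL)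
      rw [runOK]
      rcases hx with ⟨rfl, hx⟩ | ⟨rfl, hx⟩
      · rw [if_neg (by decide)] at h
        rw [if_pos rfl, runOK, if_neg (by decide)]
        exact ⟨by omega, ih hw' h.2 (.inr ⟨rfl, le_rfl⟩)⟩
      · rw [if_pos rfl] at h
        rw [if_neg (by decide), runOK, if_neg (by decide)]
        exact ⟨by omega, by omega, ih hw' h (.inr ⟨rfl, le_rfl⟩)⟩
    · simp [sg] at hy

/-- Elements whose reduced words are monotone with bounded powers of letters. -/
def Mon (k : Bool) (n : ℕ) (g : F) : Prop := (∃ s, Mono k s g.toWord) ∧ RunLE n g.toWord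

theorem Mon.inv {k : Bool} {n : ℕ} {g : F} (h : Mon k n g) : Mon k n g⁻¹ := by
  obtain ⟨⟨s, hs⟩, hr⟩ := h
  rw [Mon, FreeGroup.toWord_inv]
  exact ⟨⟨_, hs.invRev⟩, hr.invRev⟩

theorem mon_lt (k : Bool) (l : Letter) : Mon k 1 (lt l) := by
  refine ⟨⟨sg k l, ?_⟩, ?_⟩ <;> rw [toWord_lt]
  · simp [Mono]
  · intro x m h
    simpa using h.length_le

theorem Mon.autL {n : ℕ} {g : F} (h : Mon false n g) : Mon false (n + 1) (autL g) := by
  have key {g : F} (h : Mono false true g.toWord) (hr : RunLE n g.toWord) :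
      Mon false (n + 1) (AutF2.autL g) := by
    rw [Mon, toWord_autL_of_mono h]
    refine ⟨⟨true, fun l hl => ?_⟩, ?_⟩
    · obtain ⟨y, hy, hl⟩ := List.mem_flatMap.1 hl
      rw [sg_of_mem_subL hl, h y hy]
    · exact (runOK_flatMap_subL (k' := 0) h (runOK_of_runLE (x := (0, true)) (k := 0) (by simpa))
        (.inl ⟨rfl, le_rfl⟩)).runLE
  obtain ⟨⟨s, hs⟩, hr⟩ := h
  cases s
  · have := key (g := g⁻¹) (by rw [FreeGroup.toWord_inv]; exact hs.invRev)
      (by rw [FreeGroup.toWord_inv]; exact hr.invRev)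
    simpa using this.inv
  · exact key hs hr

theorem Mon.flipA {k : Bool} {n : ℕ} {g : F} (h : Mon k n g) : Mon (!k) n (flipA g) := by
  obtain ⟨⟨s, hs⟩, hr⟩ := h
  rw [Mon, toWord_flipA]
  refine ⟨⟨!s, fun l hl => ?_⟩, hr.map flipAL_flipAL⟩
  obtain ⟨x, hx, rfl⟩ := List.mem_map.1 hl
  rw [sg_flipAL, hs x hx]

theorem Mon.flipB {k : Bool} {n : ℕ} {g : F} (h : Mon k n g) : Mon (!k) n (flipB g) := by
  obtain ⟨⟨s, hs⟩, hr⟩ := h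
  rw [Mon, toWord_flipB]
  refine ⟨⟨s, fun l hl => ?_⟩, hr.map flipBL_flipBL⟩
  obtain ⟨x, hx, rfl⟩ := List.mem_map.1 hl
  rw [sg_flipBL, hs x hx]

theorem Mon.swapInv {k : Bool} {n : ℕ} {g : F} (h : Mon k n g) : Mon k n (swapInv g) := by
  obtain ⟨⟨s, hs⟩, hr⟩ := h
  rw [Mon, toWord_swapInv]
  refine ⟨⟨xor s (!k), fun l hl => ?_⟩, hr.map swapL_swapL⟩
  obtain ⟨x, hx, rfl⟩ := List.mem_map.1 hl
  rw [sg_swapL, hs x hx]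

/-- Products of elementary automorphisms which are compatible with the kinds of monotone words,
with a given number of occurrences of `autL`. -/
inductive Path : Bool → Bool → ℕ → G → Prop
  | one (k : Bool) : Path k k 0 1
  | flipA (k : Bool) : Path k (!k) 0 flipA
  | flipB (k : Bool) : Path k (!k) 0 flipB
  | swapInv (k : Bool) : Path k k 0 swapInv
  | autL : Path false false 1 autL
  | comp {k k' k'' : Bool} {n m : ℕ} {θ ψ : G} :
      Path k k' n θ → Path k' k'' m ψ → Path k k'' (m + n) (ψ * θ)

theorem Path.mon {k k' : Bool} {n r : ℕ} {θ : G} (h : Path k k' n θ) {g : F} (hg : Mon k r g) :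
    Mon k' (r + n) (θ g) := by
  induction h generalizing r g with
  | one k => exact hg
  | flipA k => exact hg.flipA
  | flipB k => exact hg.flipB
  | swapInv k => exact hg.swapInv
  | autL => exact hg.autL
  | @comp _ _ _ n m _ _ _ _ h₁ h₂ =>
    rw [Nat.add_comm m, ← Nat.add_assoc]
    exact h₂ (h₁ hg)

theorem Path.noTurn {k k' : Bool} {n : ℕ} {θ : G} (h : Path k k' n θ) {K : Set F}
    (hK : NoTurn k K) : NoTurn k' (θ '' K) := by
  induction h generalizing K with
  | one k => simpa using hK
  | flipA k => exact noTurn_flipA hK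
  | flipB k => exact noTurn_flipB hK
  | swapInv k => exact noTurn_swapInv hK
  | autL => exact noTurn_autL hK
  | comp _ _ h₁ h₂ =>
    have := h₂ (h₁ hK)
    rwa [Set.image_image] at this

theorem path_elem (x : Bool) : Path false false 1 (elem x) := by
  cases x
  · exact .autL
  · rw [elem_true, autR_eq]
    exact ((Path.swapInv false).comp .autL).comp (.swapInv false)

theorem path_elem_inv (x : Bool) : Path true true 1 (elem x)⁻¹ := by
  have h : Path true true 1 autL⁻¹ := by
    rw [autL_inv_eq]
    exact ((Path.flipA true).comp .autL).comp (.flipA false)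
  cases x
  · exact h
  · rw [elem_true, autR_eq, show (swapInv * autL * swapInv)⁻¹ =
      swapInv * autL⁻¹ * swapInv by simp [mul_assoc, swapInv_inv]]
    exact ((Path.swapInv true).comp h).comp (.swapInv true)

theorem path_posWord (u : List Bool) : Path false false u.length (posWord u) := by
  induction u with
  | nil => exact .one _
  | cons x u ih =>
    rw [posWord, List.map_cons, List.prod_cons, List.length_cons, Nat.add_comm]
    exact ih.comp (path_elem x)

theorem path_posWord_inv (u : List Bool) : Path true true u.length (posWord u)⁻¹ := by
  induction u with
  | nil => simpa [posWord] using Path.one true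
  | cons x u ih =>
    rw [posWord, List.map_cons, List.prod_cons, List.length_cons, mul_inv_rev]
    exact (path_elem_inv x).comp ih

theorem path_turn (x : Bool) : Path false true 1 ((elem x)⁻¹ * elem (!x)) := by
  cases x
  · have h : autL⁻¹ * autR =
        (flipA * swapInv) * autL * (flipA * flipB) := by
      apply aut_ext <;> simp
    rw [elem_false, Bool.not_false, elem_true, h]
    exact (((Path.flipB false).comp (.flipA true)).comp .autL).comp
      ((Path.swapInv false).comp (.flipA false))
  · have h : autR⁻¹ * autL =
        flipB * autL * (flipA * flipB * swapInv) := by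
      rw [inv_mul_eq_iff_eq_mul]
      apply aut_ext <;> simp [mul_assoc]
    rw [elem_true, Bool.not_true, elem_false, h]
    exact (((Path.swapInv false).comp ((Path.flipB false).comp (.flipA true))).comp .autL).comp
      (.flipB false)

theorem orient_inv_mul {i j : Bool} (h : i ≠ j) : (orient i)⁻¹ * orient j = flipB := by
  cases i <;> cases j <;> simp_all [orient, flipB_inv]

/-- Two chambers are related by a product of elementary automorphisms which ends with monotone
words of kind `true`, unless the first chamber is a prefix of the second one. -/
theorem exists_path (ω ω' : Chamber) :
    ∃ k k' n, n ≤ ω.2.length + ω'.2.length + 1 ∧ Path k k' n ((phi ω)⁻¹ * phi ω') ∧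
      ((ω.1 = ω'.1 ∧ ω.2 <+: ω'.2) ∨ k' = true) := by
  obtain ⟨i, u⟩ := ω
  obtain ⟨j, v⟩ := ω'
  have hphi (i u) : phi (i, u) = orient i * posWord u := rfl
  by_cases hij : i = j
  · subst hij
    have h : (phi (i, u))⁻¹ * phi (i, v) = (posWord u)⁻¹ * posWord v := by
      rw [hphi, hphi]; group
    rw [h]
    obtain ⟨p, u', v', rfl, rfl, hp⟩ := exists_common_isPrefix u v
    rw [show (posWord (p ++ u'))⁻¹ * posWord (p ++ v') = (posWord u')⁻¹ * posWord v' by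
      rw [posWord_append, posWord_append]; group]
    simp only [List.length_append]
    rcases hp with rfl | rfl | ⟨x, u'', v'', rfl, rfl⟩
    · refine ⟨false, false, v'.length, by omega, ?_, .inl (by simp)⟩
      simpa [posWord] using path_posWord v'
    · refine ⟨true, true, u'.length, by omega, ?_, .inr rfl⟩
      simpa [posWord] using path_posWord_inv u'
    · refine ⟨false, true, u''.length + (1 + v''.length), by simp; omega, ?_, .inr rfl⟩
      have : (posWord (x :: u''))⁻¹ * posWord ((!x) :: v'') =
          (posWord u'')⁻¹ * (((elem x)⁻¹ * elem (!x)) * posWord v'') := by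
        simp only [posWord, List.map_cons, List.prod_cons]; group
      rw [this]
      exact ((path_posWord v'').comp (path_turn x)).comp (path_posWord_inv u'')
  · have h : (phi (i, u))⁻¹ * phi (j, v) = (posWord u)⁻¹ * (flipB * posWord v) := by
      rw [← orient_inv_mul hij, hphi, hphi]; group
    rw [h]
    refine ⟨false, true, u.length + (0 + v.length), by simp, ?_, .inr rfl⟩
    exact ((path_posWord v).comp (.flipB false)).comp (path_posWord_inv u)

/-- Words which are concatenations of at most `n` words of a given class. -/
def Dec (𝒞 : List Letter → Prop) (n : ℕ) (w : List Letter) : Prop :=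
  ∃ Ls : List (List Letter), Ls.length ≤ n ∧ (∀ u ∈ Ls, 𝒞 u) ∧ Ls.flatten = w

theorem Dec.of_isInfix {𝒞 : List Letter → Prop} (h𝒞 : ∀ u v, u <:+: v → 𝒞 v → 𝒞 u) {n : ℕ}
    {w w' : List Letter} (h : Dec 𝒞 n w) (hw : w' <:+: w) : Dec 𝒞 n w' := by
  obtain ⟨Ls, hn, hu, rfl⟩ := h
  suffices ∃ Ls' : List (List Letter), Ls'.length ≤ Ls.length ∧ (∀ u ∈ Ls', 𝒞 u) ∧
      Ls'.flatten = w' by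
    obtain ⟨Ls', h₁, h₂⟩ := this
    exact ⟨Ls', h₁.trans hn, h₂⟩
  clear hn
  induction Ls generalizing w' with
  | nil => exact ⟨[], by simp_all⟩
  | cons u Ls ih =>
    have hu' : ∀ v ∈ Ls, 𝒞 v := fun v hv => hu v (List.mem_cons_of_mem _ hv)
    have hu := hu u List.mem_cons_self
    rw [List.flatten_cons, List.infix_append_iff] at hw
    rcases hw with hw | hw | ⟨l₁, l₂, rfl, h₁, h₂⟩
    · exact ⟨[w'], by simp, by simpa using h𝒞 _ _ hw hu, by simp⟩
    · obtain ⟨Ls', h₁, h₂⟩ := ih hu' hw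
      exact ⟨Ls', by simp; omega, h₂⟩
    · obtain ⟨Ls', h₃, h₄, rfl⟩ := ih hu' h₂.isInfix
      refine ⟨l₁ :: Ls', by simpa using h₃, ?_, by simp⟩
      simpa using ⟨h𝒞 _ _ h₁.isInfix hu, fun v hv => h₄ v hv⟩

theorem Dec.append {𝒞 : List Letter → Prop} {n m : ℕ} {w w' : List Letter} (h : Dec 𝒞 n w)
    (h' : Dec 𝒞 m w') : Dec 𝒞 (n + m) (w ++ w') := by
  obtain ⟨Ls, h₁, h₂, rfl⟩ := h
  obtain ⟨Ls', h₃, h₄, rfl⟩ := h'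
  refine ⟨Ls ++ Ls', by simp; omega, fun u hu => ?_, by simp⟩
  exact (List.mem_append.1 hu).elim (h₂ u) (h₄ u)

theorem exists_toWord_mul (g h : F) :
    ∃ p s, p <+: g.toWord ∧ s <:+ h.toWord ∧ (g * h).toWord = p ++ s := by
  induction g using word_induction with
  | h1 => exact ⟨[], h.toWord, by simp⟩
  | hl l g hg ih =>
    obtain ⟨p, s, hp, hs, hps⟩ := ih
    rw [toWord_lt_mul hg, mul_assoc]
    by_cases hl : hd (g * h) = some (linv l)
    · obtain ⟨k, hk, -, hw⟩ := exists_of_hd_eq hl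
      rw [hk, lt_linv, mul_inv_cancel_left]
      rw [hps] at hw
      rcases p with _ | ⟨c, p⟩
      · rw [List.nil_append] at hw
        exact ⟨[], k.toWord, by simp, (hw ▸ List.suffix_cons _ _ : k.toWord <:+ s).trans hs, rfl⟩
      · rw [List.cons_append, List.cons.injEq] at hw
        rw [hw.1] at hp
        refine absurd ?_ hg
        obtain ⟨t, ht⟩ := hp
        rw [hd, ← ht]
        rfl
    · refine ⟨l :: p, s, by simpa using hp, hs, ?_⟩
      rw [toWord_lt_mul hl, hps, List.cons_append]

theorem Dec.toWord_mul {𝒞 : List Letter → Prop} (h𝒞 : ∀ u v, u <:+: v → 𝒞 v → 𝒞 u) {n m : ℕ}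
    {g h : F} (hg : Dec 𝒞 n g.toWord) (hh : Dec 𝒞 m h.toWord) : Dec 𝒞 (n + m) (g * h).toWord := by
  obtain ⟨p, s, hp, hs, h⟩ := exists_toWord_mul g h
  rw [h]
  exact (hg.of_isInfix h𝒞 hp.isInfix).append (hh.of_isInfix h𝒞 hs.isInfix)

theorem Dec.toWord_prod {𝒞 : List Letter → Prop} (h𝒞 : ∀ u v, u <:+: v → 𝒞 v → 𝒞 u)
    {L : List F} (hL : ∀ g ∈ L, 𝒞 g.toWord) : Dec 𝒞 L.length L.prod.toWord := by
  induction L with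
  | nil => exact ⟨[], by simp⟩
  | cons g L ih =>
    rw [List.prod_cons, List.length_cons, Nat.add_comm]
    refine Dec.toWord_mul h𝒞 (n := 1) ⟨[g.toWord], ?_⟩
      (ih fun h hh => hL h (List.mem_cons_of_mem _ hh))
    simpa using hL g List.mem_cons_self

theorem Dec.length_le {𝒞 : List Letter → Prop} {n M : ℕ} {w : List Letter} (h : Dec 𝒞 n w)
    (hM : ∀ u, u <:+: w → 𝒞 u → u.length ≤ M) : w.length ≤ n * M := by
  obtain ⟨Ls, h₁, h₂, rfl⟩ := h
  rw [List.length_flatten]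
  have : (Ls.map List.length).sum ≤ (Ls.map List.length).length • M := by
    apply List.sum_le_card_nsmul
    intro x hx
    obtain ⟨u, hu, rfl⟩ := List.mem_map.1 hx
    exact hM u (List.infix_of_mem_flatten hu) (h₂ u hu)
  rw [List.length_map, smul_eq_mul] at this
  exact this.trans (Nat.mul_le_mul_right _ h₁)

/-- The coordinates of an element of the free group in the basis given by a chamber. -/
def co (ω : Chamber) (y : F) : F := (phi ω)⁻¹ y

theorem co_mul (ω : Chamber) (x y : F) : co ω (x * y) = co ω x * co ω y := map_mul _ _ _

theorem co_inv (ω : Chamber) (x : F) : co ω x⁻¹ = (co ω x)⁻¹ := map_inv _ _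

@[simp] theorem co_one (ω : Chamber) : co ω 1 = 1 := map_one _

@[simp] theorem phi_co (ω : Chamber) (x : F) : phi ω (co ω x) = x :=
  MulEquiv.apply_symm_apply _ _

@[simp] theorem co_phi (ω : Chamber) (x : F) : co ω (phi ω x) = x :=
  MulEquiv.symm_apply_apply _ _

theorem co_injective (ω : Chamber) : Function.Injective (co ω) := MulEquiv.injective _

theorem co_concat (i : Bool) (u : List Bool) (x : Bool) (y : F) :
    co (i, u ++ [x]) y = (elem x)⁻¹ (co (i, u) y) := by
  rw [co, phi_concat, mul_inv_rev]; rfl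

@[simp] theorem co_false_nil (y : F) : co (false, []) y = y := by rw [co, phi_false_nil]; rfl

theorem co_true_nil (y : F) : co (true, []) y = flipB y := by
  rw [co, phi]; simp [orient, flipB_inv]

theorem co_phi_eq (ω ω' : Chamber) (y : F) : co ω (phi ω' y) = ((phi ω)⁻¹ * phi ω') y := rfl

/-- The length of a power of a letter which is bounded in the coordinates of the products of `N`
elements of bases of depth at most `D`. -/
def powBound (N D : ℕ) : ℕ := N * (2 * D + 3)

/-- The pieces of the coordinates of products of elements of bases. -/
def Piece (M : ℕ) (w : List Letter) : Prop := (∃ k s, Mono k s w) ∧ RunLE M w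

theorem Piece.of_isInfix {M : ℕ} (u v : List Letter) (h : u <:+: v) (hv : Piece M v) :
    Piece M u := by
  obtain ⟨⟨k, s, hk⟩, hr⟩ := hv
  exact ⟨⟨k, s, hk.of_isInfix h⟩, hr.of_isInfix h⟩

theorem length_le_of_forall_eq {n : ℕ} {w : List Letter} (hw : RunLE n w) {l : Letter}
    (h : ∀ x ∈ w, x = l) : w.length ≤ n := by
  apply hw l
  rw [← List.eq_replicate_of_mem h]

theorem dec_co {L : List (Chamber × Letter)} {D : ℕ} (hL : ∀ q ∈ L, q.1.2.length ≤ D)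
    {ω : Chamber} (hω : ω.2.length ≤ D + 1) :
    Dec (fun w => ∃ q ∈ L, ∃ k, (∃ s, Mono k s w) ∧ RunLE (2 * D + 3) w ∧
      ((ω.1 = q.1.1 ∧ ω.2 <+: q.1.2) ∨ k = true)) L.length
      (co ω (L.map fun q => phi q.1 (lt q.2)).prod).toWord := by
  have := Dec.toWord_prod (𝒞 := fun w => ∃ q ∈ L, ∃ k, (∃ s, Mono k s w) ∧ RunLE (2 * D + 3) w ∧
      ((ω.1 = q.1.1 ∧ ω.2 <+: q.1.2) ∨ k = true)) ?_
      (L := L.map fun q => co ω (phi q.1 (lt q.2))) ?_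
  · rw [List.length_map] at this
    convert this using 2
    rw [co, map_list_prod, List.map_map]
    rfl
  · rintro u v h ⟨q, hq, k, ⟨s, hk⟩, hr, h'⟩
    exact ⟨q, hq, k, ⟨s, hk.of_isInfix h⟩, hr.of_isInfix h, h'⟩
  · intro g hg
    obtain ⟨q, hq, rfl⟩ := List.mem_map.1 hg
    obtain ⟨k, k', n, hn, hp, h'⟩ := exists_path ω q.1
    have := hp.mon (mon_lt k q.2)
    have h₁ := hL q hq
    exact ⟨q, hq, k', this.1, this.2.mono (by omega), h'⟩

theorem dec_piece_co {N D : ℕ} {y : F} (hy : y ∈ chamberProducts N D) {ω : Chamber}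
    (hω : ω.2.length ≤ D + 1) : Dec (Piece (2 * D + 3)) N (co ω y).toWord := by
  obtain ⟨L, h₁, h₂, rfl⟩ := hy
  obtain ⟨Ls, h₃, h₄, h₅⟩ := dec_co h₂ hω
  refine ⟨Ls, h₃.trans h₁, fun u hu => ?_, h₅⟩
  obtain ⟨q, -, k, ⟨s, hs⟩, hr, -⟩ := h₄ u hu
  exact ⟨⟨k, s, hs⟩, hr⟩

theorem runLE_co {N D : ℕ} {y : F} (hy : y ∈ chamberProducts N D) {ω : Chamber}
    (hω : ω.2.length ≤ D + 1) : RunLE (powBound N D) (co ω y).toWord := by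
  intro l m hm
  have := ((dec_piece_co hy hω).of_isInfix Piece.of_isInfix hm).length_le
    (M := 2 * D + 3) fun u hu h =>
    length_le_of_forall_eq h.2 (l := l) fun x hx => List.eq_of_mem_replicate (hu.subset hx)
  rwa [List.length_replicate] at this

/-- The chambers in whose coordinates an element has a long positive or negative subword. -/
def longChambers (N D : ℕ) (y : F) : Set Chamber :=
  {ω | ω.2.length ≤ D + 1 ∧ ∃ s w, w <:+: (co ω y).toWord ∧ Mono false s w ∧
    powBound N D + 1 ≤ w.length}

theorem eq_of_sg_eq {l m : Letter} (h₁ : sg false l = sg false m) (h₂ : sg true l = sg true m) :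
    l = m := by
  revert h₁ h₂; revert l m; unfold sg; decide

theorem exists_isPrefix_of_mem_longChambers {N D : ℕ} {L : List (Chamber × Letter)}
    (h₁ : L.length ≤ N) (h₂ : ∀ q ∈ L, q.1.2.length ≤ D) {ω : Chamber}
    (hω : ω ∈ longChambers N D (L.map fun q => phi q.1 (lt q.2)).prod) :
    ∃ q ∈ L, ω.1 = q.1.1 ∧ ω.2 <+: q.1.2 := by
  obtain ⟨hω, s, w, hw, hs, hlen⟩ := hω
  by_contra! hcon
  have := ((dec_co h₂ hω).of_isInfix ?_ hw).length_le (M := 2 * D + 3) ?_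
  · have := this.trans (Nat.mul_le_mul_right _ h₁)
    rw [powBound] at hlen
    omega
  · rintro u v h ⟨q, hq, k, ⟨s, hk⟩, hr, h'⟩
    exact ⟨q, hq, k, ⟨s, hk.of_isInfix h⟩, hr.of_isInfix h, h'⟩
  · rintro u hu ⟨q, hq, k, ⟨s', hk⟩, hr, h' | rfl⟩
    · exact absurd h'.2 (hcon q hq h'.1)
    · rcases u with _ | ⟨x, u⟩
      · simp
      · refine length_le_of_forall_eq hr (l := x) fun y hy => eq_of_sg_eq ?_ ?_
        · rw [hs.of_isInfix hu y hy, hs.of_isInfix hu x List.mem_cons_self]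
        · rw [hk y hy, hk x List.mem_cons_self]

theorem length_le_of_mem_longChambers {N D : ℕ} {y : F} (hy : y ∈ chamberProducts N D)
    {ω : Chamber} (hω : ω ∈ longChambers N D y) : ω.2.length ≤ D := by
  obtain ⟨L, h₁, h₂, rfl⟩ := hy
  obtain ⟨q, hq, -, h⟩ := exists_isPrefix_of_mem_longChambers h₁ h₂ hω
  exact h.length_le.trans (h₂ q hq)

theorem encard_longChambers_le {N D : ℕ} {y : F} (hy : y ∈ chamberProducts N D) :
    (longChambers N D y).encard ≤ (N * (D + 1) : ℕ) := by
  obtain ⟨L, h₁, h₂, rfl⟩ := hy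
  classical
  have hsub : longChambers N D (L.map fun q => phi q.1 (lt q.2)).prod ⊆
      ⋃ q ∈ {q | q ∈ L}, (fun n => ((q.1.1, q.1.2.take n) : Chamber)) '' Set.Iio (D + 1) := by
    intro ω hω
    obtain ⟨q, hq, h₃, h₄⟩ := exists_isPrefix_of_mem_longChambers h₁ h₂ hω
    refine Set.mem_biUnion hq ⟨ω.2.length, ?_, ?_⟩
    · have := h₄.length_le
      have := h₂ q hq
      rw [Set.mem_Iio]
      omega
    · exact Prod.ext h₃.symm (List.prefix_iff_eq_take.1 h₄).symm
  refine (Set.encard_le_encard hsub).trans (encard_biUnion_le_mul ?_ fun q _ => ?_)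
  · rw [show {q | q ∈ L} = (L.toFinset : Set (Chamber × Letter)) by ext; simp,
      Set.encard_coe_eq_coe_finsetCard]
    exact_mod_cast (List.toFinset_card_le _).trans h₁
  · refine (Set.encard_image_le _ _).trans ?_
    rw [← Finset.coe_Iio, Set.encard_coe_eq_coe_finsetCard, Nat.card_Iio]

/-- The first `R` letters of an element have constant sign and involve both generators. -/
def Lg (k s : Bool) (R : ℕ) (g : F) : Prop :=
  R ≤ g.toWord.length ∧ Mono k s (g.toWord.take R) ∧
    ∃ l ∈ g.toWord.take R, ∃ l' ∈ g.toWord.take R, l.1 ≠ l'.1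

theorem sg_ne {l l' : Letter} (h : l.1 ≠ l'.1) (h' : sg false l = sg false l') :
    sg true l ≠ sg true l' := by
  revert h h'; revert l l'; unfold sg; decide

theorem not_lg_true {s s' : Bool} {R : ℕ} {g : F} (h : Lg false s R g) : ¬Lg true s' R g := by
  rintro ⟨-, h', -⟩
  obtain ⟨-, h₁, l, hl, l', hl', hne⟩ := h
  exact sg_ne hne (by rw [h₁ l hl, h₁ l' hl']) (by rw [h' l hl, h' l' hl'])

theorem lg_flipB {k s : Bool} {R : ℕ} {g : F} (h : Lg k s R g) : Lg (!k) s R (flipB g) := by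
  obtain ⟨h₁, h₂, l, hl, l', hl', hne⟩ := h
  have hf (x : Letter) : (flipBL x).1 = x.1 := by revert x; unfold flipBL linv; decide
  rw [Lg, toWord_flipB, ← List.map_take]
  refine ⟨by simpa using h₁, fun x hx => ?_, _, List.mem_map_of_mem hl, _, List.mem_map_of_mem hl',
    by rwa [hf, hf]⟩
  obtain ⟨y, hy, rfl⟩ := List.mem_map.1 hx
  rw [sg_flipBL, h₂ y hy]

/-- The path between two elements with different first letters passes monotonically through
the origin. -/
def PairLong (k : Bool) (R : ℕ) (g h : F) : Prop := ∃ s, Lg k (!s) R g ∧ Lg k s R h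

theorem PairLong.symm {k : Bool} {R : ℕ} {g h : F} (H : PairLong k R g h) : PairLong k R h g := by
  obtain ⟨s, h₁, h₂⟩ := H
  exact ⟨!s, by simpa using h₂, h₁⟩

theorem PairLong.flipB {k : Bool} {R : ℕ} {g h : F} (H : PairLong k R g h) :
    PairLong (!k) R (flipB g) (flipB h) := by
  obtain ⟨s, h₁, h₂⟩ := H
  exact ⟨s, lg_flipB h₁, lg_flipB h₂⟩

/-- The translation used to pass to a child chamber. -/
def shift (x : Bool) : F := if x then b else a⁻¹

/-- The moves from a chamber to itself or to one of its children. -/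
def move : Option (Bool × Bool) → F → F
  | none, g => g
  | some (x, j), g => (elem x)⁻¹ ((if j then shift x else 1)⁻¹ * g)

theorem move_injective (μ : Option (Bool × Bool)) : Function.Injective (move μ) := by
  rcases μ with _ | ⟨x, j⟩
  · exact fun _ _ => id
  · intro g h hgh
    exact mul_left_cancel ((elem x)⁻¹.injective hgh)

/-- The chamber reached by a move. -/
def moveChamber : Option (Bool × Bool) → Chamber → Chamber
  | none, ω => ω
  | some (x, _), ω => (ω.1, ω.2 ++ [x])

theorem move_mul_co (μ : Option (Bool × Bool)) (ω : Chamber) (g y : F) :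
    move μ (g * co ω y) = move μ g * co (moveChamber μ ω) y := by
  rcases μ with _ | ⟨x, j⟩
  · rfl
  · rw [move, moveChamber, co_concat, move, ← mul_assoc, map_mul]

theorem length_moveChamber (μ : Option (Bool × Bool)) (ω : Chamber) :
    (moveChamber μ ω).2.length ≤ ω.2.length + 1 := by
  rcases μ with _ | ⟨x, j⟩ <;> simp [moveChamber]

theorem sep_swapInv {g h : F} (H : Sep g h) : Sep (swapInv g) (swapInv h) := by
  intro l h₁ h₂
  rw [hd_swapInv_eq] at h₁ h₂
  exact H _ h₁ h₂

theorem swapInv_swapInv (g : F) : swapInv (swapInv g) = g := by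
  rw [← MulAut.mul_apply, swapInv_mul_self, MulAut.one_apply]

theorem move_true (j : Bool) (g : F) :
    move (some (true, j)) g = swapInv (move (some (false, j)) (swapInv g)) := by
  have h : autR⁻¹ = swapInv * autL⁻¹ * swapInv := by
    rw [autR_eq, mul_inv_rev, mul_inv_rev, swapInv_inv, mul_assoc]
  have hb : swapInv b⁻¹ = a := by simp
  cases j
  · simp only [move, elem_true, elem_false, h, Bool.false_eq_true, if_false]
    simp [-MulAut.inv_apply]
  · simp only [move, elem_true, elem_false, h, shift, if_true, Bool.false_eq_true, if_false,
      inv_inv, MulAut.mul_apply]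
    rw [map_mul swapInv, hb]

theorem hd_a_mul (g : F) : hd (a * g) = some (0, true) ∨
    (hd g = some (0, false) ∧ hd (a * g) ≠ some (0, true)) := by
  by_cases h : hd g = some (0, false)
  · obtain ⟨k, rfl, hk, -⟩ := exists_of_hd_eq h
    refine .inr ⟨h, ?_⟩
    rw [← lt_a, show ((0, false) : Letter) = linv (0, true) from rfl, lt_linv, mul_inv_cancel_left]
    exact hk
  · left
    rw [← lt_a]
    exact hd_lt_mul (l := (0, true)) h

theorem move_false_false (g : F) : move (some (false, false)) g = MulEquiv.symm autL g := by
  simp [move]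

theorem move_false_true (g : F) :
    move (some (false, true)) g = MulEquiv.symm autL (a * g) := by
  simp [move, shift]

theorem hd_move_false_false (g : F) :
    (hd g = some (1, true) ∧ hd (move (some (false, false)) g) = some (0, false)) ∨
    (hd g = some (0, true) ∧ (hd (move (some (false, false)) g) = some (1, true) ∨
      hd (move (some (false, false)) g) = some (0, true))) ∨
    (hd g ≠ some (1, true) ∧ hd g ≠ some (0, true) ∧
      hd (move (some (false, false)) g) = hd g) := by
  rw [move_false_false, hd_autL_symm]
  by_cases h : hd g = some (1, true)
  · simp [h]
  · by_cases h' : hd g = some (0, true)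
    · right; left
      simp only [h', if_neg (show (some (0, true) : Option Letter) ≠ some (1, true) by decide),
        true_and]
      split_ifs <;> simp
    · have : hd (a⁻¹ * g) = some (0, false) := by
        rw [← lt_a_inv]
        exact hd_lt_mul (l := (0, false)) h'
      simp [h, h', this]

theorem hd_move_false_true (g : F) :
    (hd g = some (1, true) ∧ hd (move (some (false, true)) g) = some (1, true)) ∨
    (hd g = some (0, false) ∧ hd (move (some (false, true)) g) ≠ some (0, true) ∧
      hd (move (some (false, true)) g) ≠ some (1, true)) ∨
    (hd g ≠ some (1, true) ∧ hd g ≠ some (0, false) ∧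
      hd (move (some (false, true)) g) = some (0, true)) := by
  rw [move_false_true, hd_autL_symm, inv_mul_cancel_left]
  rcases hd_a_mul g with h | ⟨h, h'⟩
  · by_cases h₁ : hd g = some (1, true)
    · simp [h, h₁]
    · have h₂ : hd g ≠ some (0, false) := by
        intro h₂
        obtain ⟨k, rfl, hk, -⟩ := exists_of_hd_eq h₂
        rw [← lt_a, show ((0, false) : Letter) = linv (0, true) from rfl, lt_linv,
          mul_inv_cancel_left] at h
        exact hk h
      simp [h, h₁, h₂]
  · right; left
    refine ⟨h, ?_⟩
    by_cases h₁ : hd (a * g) = some (1, true)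
    · simp [h₁]
    · simp [h₁, h', h]

theorem sep_move_false_false {g h : F} (H : Sep g h)
    (h₁ : ¬(hd g = some (1, true) ∧ hd h = some (0, false)))
    (h₂ : ¬(hd h = some (1, true) ∧ hd g = some (0, false))) :
    Sep (move (some (false, false)) g) (move (some (false, false)) h) := by
  intro l hl hl'
  have H₁ := H (0, true)
  have H₂ := H (1, true)
  have H₃ := H l
  rcases hd_move_false_false g with ⟨h₃, h₄⟩ | ⟨h₃, h₄ | h₄⟩ | ⟨h₃, h₃', h₄⟩ <;>
  rcases hd_move_false_false h with ⟨h₅, h₆⟩ | ⟨h₅, h₆ | h₆⟩ | ⟨h₅, h₅', h₆⟩ <;>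
  rw [h₄] at hl <;> rw [h₆] at hl' <;> simp_all <;>
  exact absurd (hl.trans hl'.symm) (by decide)

theorem sep_move_false_true {g h : F} (H : Sep g h)
    (h₁ : (hd g = some (1, true) ∨ hd g = some (0, false)) ∨
      (hd h = some (1, true) ∨ hd h = some (0, false))) :
    Sep (move (some (false, true)) g) (move (some (false, true)) h) := by
  intro l hl hl'
  have H₁ := H (0, false)
  have H₂ := H (1, true)
  rcases hd_move_false_true g with ⟨h₃, h₄⟩ | ⟨h₃, h₄, h₄'⟩ | ⟨h₃, h₃', h₄⟩ <;>
  rcases hd_move_false_true h with ⟨h₅, h₆⟩ | ⟨h₅, h₆, h₆'⟩ | ⟨h₅, h₅', h₆⟩ <;> simp_all <;>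
  exact absurd (hl.trans hl'.symm) (by decide)

/-- Three directions. -/
def Sep₃ (g h k : F) : Prop := Sep g h ∧ Sep g k ∧ Sep h k

theorem exists_sep₃_move (x : Bool) {g h k : F} (H : Sep₃ g h k) : ∃ j,
    Sep₃ (move (some (x, j)) g) (move (some (x, j)) h) (move (some (x, j)) k) := by
  have key {g h k : F} (H : Sep₃ g h k) : ∃ j, Sep₃ (move (some (false, j)) g)
      (move (some (false, j)) h) (move (some (false, j)) k) := by
    obtain ⟨H₁, H₂, H₃⟩ := H
    by_cases h₁ : ∃ u ∈ [g, h, k], hd u = some (1, true)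
    · by_cases h₂ : ∃ u ∈ [g, h, k], hd u = some (0, false)
      · refine ⟨true, sep_move_false_true H₁ ?_, sep_move_false_true H₂ ?_,
          sep_move_false_true H₃ ?_⟩ <;>
        · by_contra! hcon
          have K₁ := H₁ (1, true)
          have K₂ := H₂ (1, true)
          have K₃ := H₃ (1, true)
          simp_all
      · refine ⟨false, sep_move_false_false H₁ ?_ ?_, sep_move_false_false H₂ ?_ ?_,
          sep_move_false_false H₃ ?_ ?_⟩ <;> simp_all
    · refine ⟨false, sep_move_false_false H₁ ?_ ?_, sep_move_false_false H₂ ?_ ?_,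
        sep_move_false_false H₃ ?_ ?_⟩ <;> simp_all
  cases x
  · exact key H
  · obtain ⟨j, h₁, h₂, h₃⟩ := key (g := swapInv g) (h := swapInv h) (k := swapInv k)
      ⟨sep_swapInv H.1, sep_swapInv H.2.1, sep_swapInv H.2.2⟩
    refine ⟨j, ?_⟩
    simp only [move_true]
    exact ⟨sep_swapInv h₁, sep_swapInv h₂, sep_swapInv h₃⟩

theorem length_autL_symm_le (g : F) :
    (MulEquiv.symm autL g).toWord.length ≤ 2 * g.toWord.length := by
  induction g using word_induction with
  | h1 => simp
  | hl l g hg ih =>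
    rw [toWord_lt_mul hg, List.length_cons, map_mul]
    have h₁ := FreeGroup.norm_mul_le (MulEquiv.symm autL (lt l)) (MulEquiv.symm autL g)
    have h₂ : (MulEquiv.symm autL (lt l)).norm ≤ 2 := by
      rw [autL_symm_apply]
      rcases letter_cases l with rfl | rfl | rfl | rfl
      · simp only [lt_a, flipA_a, map_inv, autL_a]
        rw [inv_inv, ← lt_a, FreeGroup.norm, toWord_lt]; simp
      · simp only [lt_a_inv, flipA_a, map_inv, autL_a]
        rw [inv_inv, ← lt_a_inv, FreeGroup.norm, toWord_lt]; simp
      · simp only [lt_b, flipA_b, autL_b, map_mul, flipA_a]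
        refine (FreeGroup.norm_mul_le _ _).trans ?_
        rw [← lt_a_inv, ← lt_b, FreeGroup.norm, FreeGroup.norm, toWord_lt, toWord_lt]; simp
      · simp only [lt_b_inv, flipA_b, autL_b, map_mul, flipA_a, map_inv]
        rw [FreeGroup.norm_inv_eq]
        refine (FreeGroup.norm_mul_le _ _).trans ?_
        rw [← lt_a_inv, ← lt_b, FreeGroup.norm, FreeGroup.norm, toWord_lt, toWord_lt]; simp
    simp only [FreeGroup.norm] at h₁ h₂
    omega

theorem hd_autL_symm_eq_b_inv {g : F} :
    hd (MulEquiv.symm autL g) = some (1, false) ↔ hd g = some (1, false) := by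
  rw [hd_autL_symm]
  by_cases h : hd g = some (1, true)
  · simp [h]
  · rw [if_neg h]
    by_cases h' : hd (a⁻¹ * g) = some (1, true)
    · rw [if_pos h']
      simp only [Option.some.injEq, Prod.mk.injEq, Bool.true_eq_false, and_false, false_iff]
      intro h₁
      rw [← lt_a_inv, hd_lt_mul (l := (0, false)) (by rw [h₁]; decide)] at h'
      simp at h'
    · rw [if_neg h']

theorem hd_autL_symm_of_a_inv {g : F} (h : hd g = some (0, false)) :
    hd (MulEquiv.symm autL g) = some (0, false) := by
  rw [hd_autL_symm, if_neg (by rw [h]; decide), if_neg, h]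
  rw [← lt_a_inv, hd_lt_mul (l := (0, false)) (by rw [h]; decide)]
  decide

theorem hd_autL_symm_of_a {g : F} (h : hd g = some (0, true)) :
    hd (MulEquiv.symm autL g) ≠ some (0, false) := by
  rw [hd_autL_symm, if_neg (by rw [h]; decide), h]
  split_ifs <;> decide

theorem exists_mul_of_toWord_eq {g : F} {U V : List Letter} (h : g.toWord = U ++ V) :
    ∃ x y, g = x * y ∧ x.toWord = U ∧ y.toWord = V ∧ Sep x⁻¹ y := by
  obtain ⟨x, y, hg, hx, hy⟩ := exists_split g U.length (by rw [FreeGroup.norm, h]; simp)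
  rw [h, List.take_left] at hx
  rw [h, List.drop_left] at hy
  exact ⟨x, y, hg, hx, hy, sep_of_toWord_mul (by rw [← hg, hx, hy, h])⟩

theorem exists_append_of_mem_take {n : ℕ} {w u : List Letter} (h : u <:+: w.take n) :
    ∃ U W, w = U ++ (u ++ W) ∧ U.length + u.length ≤ n := by
  obtain ⟨U, V, h⟩ := h
  refine ⟨U, V ++ w.drop n, ?_, ?_⟩
  · conv_lhs => rw [← List.take_append_drop n w, ← h]
    simp
  · have := congrArg List.length h
    simp only [List.length_append, List.length_take] at this
    omega

theorem mem_take_autL_symm {x y : F} {l : Letter}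
    (H : Sep (MulEquiv.symm autL x⁻¹) (MulEquiv.symm autL y))
    (h : hd (MulEquiv.symm autL x⁻¹) = some (linv l) ∨ hd (MulEquiv.symm autL y) = some l)
    {n : ℕ} (hn : 2 * x.toWord.length + 1 ≤ n) :
    l ∈ (MulEquiv.symm autL (x * y)).toWord.take n := by
  rw [map_inv] at H h
  rw [map_mul, toWord_mul_of_sep H]
  have h₁ := length_autL_symm_le x
  rcases h with h | h
  · rw [List.take_append]
    refine List.mem_append_left _ ?_
    rw [List.take_of_length_le (by omega)]
    rw [hd_inv, Option.map_eq_some_iff] at h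
    obtain ⟨c, hc, hcl⟩ := h
    rw [show l = c by rw [← linv_linv l, ← hcl, linv_linv]]
    exact List.mem_of_getLast? hc
  · rw [List.take_append]
    refine List.mem_append_right _ ?_
    obtain ⟨k, -, -, hk⟩ := exists_of_hd_eq h
    rw [hk, show n - (MulEquiv.symm autL x).toWord.length =
      n - (MulEquiv.symm autL x).toWord.length - 1 + 1 by omega, List.take_succ_cons]
    exact List.mem_cons_self

theorem hd_inv_of_toWord {x : F} {U : List Letter} {l : Letter} (h : x.toWord = U ++ [l]) :
    hd x⁻¹ = some (linv l) := by
  rw [hd_inv, h]; simp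

theorem mem_tail_take_autL_symm {x y : F} (hx : x ≠ 1) {l : Letter}
    (H : Sep (MulEquiv.symm autL x⁻¹) (MulEquiv.symm autL y))
    (h : hd (MulEquiv.symm autL y) = some l)
    {n : ℕ} (hn : 2 * x.toWord.length + 1 ≤ n) :
    l ∈ ((MulEquiv.symm autL (x * y)).toWord.take n).tail := by
  rw [map_inv] at H
  rw [map_mul, toWord_mul_of_sep H]
  have h₁ := length_autL_symm_le x
  obtain ⟨k, -, -, hk⟩ := exists_of_hd_eq h
  rcases hX : (MulEquiv.symm autL x).toWord with _ | ⟨c, X⟩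
  · rw [FreeGroup.toWord_eq_nil_iff, MulEquiv.map_eq_one_iff] at hX
    exact absurd hX hx
  · rw [hX, List.length_cons] at h₁
    rw [hk, show n = n - 1 + 1 by omega, List.cons_append, List.take_succ_cons, List.tail_cons,
      List.take_append]
    refine List.mem_append_right _ ?_
    rw [show n - 1 - X.length = n - 1 - X.length - 1 + 1 by omega, List.take_succ_cons]
    exact List.mem_cons_self

theorem mem_take_autL_symm_b {g : F} {n : ℕ} {s : Bool} (h : (1, s) ∈ g.toWord.take n) :
    (1, s) ∈ (MulEquiv.symm autL g).toWord.take (2 * n + 1) := by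
  obtain ⟨U, W, hg, hn⟩ := exists_append_of_mem_take (List.singleton_infix_iff _ _ |>.2 h)
  rw [List.length_singleton] at hn
  cases s
  · obtain ⟨x, y, rfl, hx, hy, hxy⟩ := exists_mul_of_toWord_eq hg
    have h₁ : hd y = some (1, false) := by rw [hd, hy]; rfl
    have h₂ := hd_autL_symm_eq_b_inv.2 h₁
    refine mem_take_autL_symm (fun l h₃ h₄ => ?_) (.inr h₂) (by rw [hx]; omega)
    rw [h₂] at h₄
    cases h₄
    exact hxy _ (hd_autL_symm_eq_b_inv.1 h₃) h₁
  · rw [← List.append_assoc] at hg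
    obtain ⟨x, y, rfl, hx, hy, hxy⟩ := exists_mul_of_toWord_eq hg
    have h₁ : hd x⁻¹ = some (1, false) := hd_inv_of_toWord hx
    have h₂ := hd_autL_symm_eq_b_inv.2 h₁
    refine mem_take_autL_symm (fun l h₃ h₄ => ?_) (.inl h₂) (by rw [hx]; simp; omega)
    rw [h₂] at h₃
    cases h₃
    exact hxy _ h₁ (hd_autL_symm_eq_b_inv.1 h₄)

theorem mem_take_autL_symm_a {g : F} {n : ℕ} {s : Bool}
    (h : [((0, s) : Letter), (0, s)] <:+: g.toWord.take n) :
    (0, s) ∈ (MulEquiv.symm autL g).toWord.take (2 * n + 1) ∧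
      (s = false → (0, s) ∈ ((MulEquiv.symm autL g).toWord.take (2 * n + 1)).tail) := by
  obtain ⟨U, W, hg, hn⟩ := exists_append_of_mem_take h
  simp only [List.length_cons, List.length_nil] at hn
  rw [show U ++ ([((0, s) : Letter), (0, s)] ++ W) = (U ++ [(0, s)]) ++ ((0, s) :: W) by simp] at hg
  obtain ⟨x, y, rfl, hx, hy, hxy⟩ := exists_mul_of_toWord_eq hg
  have h₁ : hd y = some (0, s) := by rw [hd, hy]; rfl
  have h₂ : hd x⁻¹ = some (0, !s) := hd_inv_of_toWord hx
  have h₃ : 2 * x.toWord.length + 1 ≤ 2 * n + 1 := by rw [hx]; simp; omega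
  cases s
  · have h₄ := hd_autL_symm_of_a_inv h₁
    have := mem_tail_take_autL_symm (x := x) (by rintro rfl; simp at hx)
      (fun l h₅ h₆ => by
        rw [h₄] at h₆
        cases h₆
        exact hd_autL_symm_of_a h₂ h₅) h₄ h₃
    exact ⟨List.mem_of_mem_tail this, fun _ => this⟩
  · have h₄ := hd_autL_symm_of_a_inv h₂
    refine ⟨mem_take_autL_symm (fun l h₅ h₆ => ?_) (.inl h₄) h₃, by simp⟩
    rw [h₄] at h₅
    cases h₅
    exact hd_autL_symm_of_a h₁ h₆

theorem mem_take_move {l : Letter} {g : F} {n : ℕ} (j : Bool)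
    (h : l ∈ (MulEquiv.symm autL g).toWord.take n)
    (hl : l = (0, false) → l ∈ ((MulEquiv.symm autL g).toWord.take n).tail) :
    l ∈ (move (some (false, j)) g).toWord.take (n + 1) := by
  cases j
  · rw [move_false_false]
    exact List.take_subset_take_left _ (Nat.le_succ n) h
  · rw [move_false_true, map_mul, show MulEquiv.symm autL a = a by rw [autL_symm_apply]; simp]
    generalize MulEquiv.symm autL g = g at h hl ⊢
    by_cases h' : hd g = some (0, false)
    · obtain ⟨k, rfl, hk, hw⟩ := exists_of_hd_eq h'
      rw [show a * (lt (0, false) * k) = k by rw [lt_a_inv, mul_inv_cancel_left]]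
      rw [hw] at h hl
      rcases n with _ | n
      · simp at h
      · rw [List.take_succ_cons] at h hl
        rw [List.tail_cons] at hl
        rw [List.mem_cons] at h
        exact List.take_subset_take_left _ (by omega) (h.elim hl id)
    · rw [← lt_a, toWord_lt_mul (l := (0, true)) h', List.take_succ_cons]
      exact List.mem_cons_of_mem _ h

theorem not_lg_true_move {g : F} {n : ℕ} {s : Bool}
    (h : [((0, s) : Letter), (0, s)] <:+: g.toWord.take n) (h' : (1, s) ∈ g.toWord.take n)
    (j s' : Bool) {R : ℕ} (hR : 2 * n + 2 ≤ R) : ¬Lg true s' R (move (some (false, j)) g) := by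
  rintro ⟨-, h₁, -⟩
  obtain ⟨h₂, h₃⟩ := mem_take_autL_symm_a h
  have h₄ := mem_take_move j h₂ fun hs => h₃ (by simpa using hs)
  have h₅ := mem_take_move j (mem_take_autL_symm_b h') (by simp)
  have h₆ := h₁ _ (List.take_subset_take_left _ hR h₄)
  rw [← h₁ _ (List.take_subset_take_left _ hR h₅)] at h₆
  cases s <;> simp [sg] at h₆

theorem replicate_infix_lt_mul {g : F} {m : ℕ} {c x : Letter} (hx : linv x ≠ c)
    (h : List.replicate m c <:+: g.toWord) : List.replicate m c <:+: (lt x * g).toWord := by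
  by_cases h' : hd g = some (linv x)
  · obtain ⟨k, rfl, -, hw⟩ := exists_of_hd_eq h'
    rw [lt_linv, mul_inv_cancel_left]
    rw [hw, List.infix_cons_iff] at h
    rcases h with h | h
    · cases m with
      | zero => simp
      | succ m =>
        rw [List.replicate_succ, List.cons_prefix_cons] at h
        exact absurd h.1.symm hx
    · exact h
  · rw [toWord_lt_mul h']
    exact h.trans (List.suffix_cons _ _).isInfix

theorem toWord_pow_mul {g : F} {c : Letter} (h : hd g ≠ some (linv c)) (m : ℕ) :
    (lt c ^ m * g).toWord = List.replicate m c ++ g.toWord := by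
  induction m with
  | zero => simp
  | succ m ih =>
    rw [pow_succ', mul_assoc, toWord_lt_mul, ih, List.replicate_succ, List.cons_append]
    cases m with
    | zero => simpa using h
    | succ m =>
      rw [hd, ih, List.replicate_succ]
      simpa using (linv_ne c).symm

/-- The first letter of the image of `(1, s)` under `autL`. -/
def starter (s : Bool) : Letter := (if s then 0 else 1, s)

/-- The second letter of the image of `(1, s)` under `autL`. -/
def follower (s : Bool) : Letter := (if s then 1 else 0, s)

theorem starter_mul_follower (s : Bool) : lt (starter s) * lt (follower s) = autL (lt (1, s)) := by
  cases s <;> simp [starter, follower]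

theorem eq_starter_or (l : Letter) : l = starter l.2 ∨ l = follower l.2 := by
  revert l; unfold starter follower; decide

theorem exists_pow_mul {s : Bool} {m : ℕ} {g : F} (hlen : 2 * m + 1 ≤ g.toWord.length)
    (hs : Mono false s (g.toWord.take (2 * m + 1)))
    (hrep : ∀ l, ¬[l, l] <:+: g.toWord.take (2 * m + 1)) (hg : hd g = some (starter s)) :
    ∃ w, g = autL (lt (1, s)) ^ m * w ∧ hd w = some (starter s) := by
  induction m generalizing g with
  | zero => exact ⟨g, by simp, hg⟩
  | succ m ih =>
    obtain ⟨k, rfl, -, hw⟩ := exists_of_hd_eq hg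
    rcases hd_cases k with rfl | ⟨l, k, rfl, -, hw'⟩
    · rw [hw] at hlen; simp at hlen
    · rw [hw'] at hw
      rw [hw] at hlen hs hrep
      rw [show 2 * (m + 1) + 1 = (2 * m + 1) + 1 + 1 by omega, List.take_succ_cons,
        List.take_succ_cons] at hs hrep
      have hl : l = follower s := by
        have h₁ : l.2 = s := by
          have := hs l (by simp)
          simpa [sg] using this
        subst h₁
        refine (eq_starter_or l).resolve_left fun h => hrep l ?_
        rw [← h]
        exact ⟨[], _, rfl⟩
      subst hl
      have hsuf : k.toWord.take (2 * m + 1) <:+: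
          starter s :: follower s :: k.toWord.take (2 * m + 1) :=
        ((List.suffix_cons _ _).trans (List.suffix_cons _ _)).isInfix
      simp only [List.length_cons] at hlen
      obtain ⟨w, hk, hw⟩ := ih (g := k) (by omega) (hs.of_isInfix hsuf)
        (fun l h => hrep l (h.trans hsuf)) (by
          rcases hd_cases k with rfl | ⟨l, k, rfl, -, hwk⟩
          · rw [FreeGroup.toWord_one, List.length_nil] at hlen; omega
          · rw [hwk, List.take_succ_cons] at hs hrep
            have h₁ : l.2 = s := by
              have := hs l (by simp)
              simpa [sg] using this
            subst h₁
            rw [hd, hwk, List.head?_cons, Option.some.injEq]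
            refine (eq_starter_or l).resolve_right fun h => hrep l ?_
            rw [← h]
            exact ⟨[starter l.2], k.toWord.take (2 * m), rfl⟩)
      refine ⟨w, ?_, hw⟩
      rw [hk, pow_succ', ← starter_mul_follower]
      simp only [mul_assoc]

theorem replicate_infix_autL_symm {s : Bool} {m : ℕ} {g : F} (hlen : 2 * m + 1 ≤ g.toWord.length)
    (hs : Mono false s (g.toWord.take (2 * m + 1)))
    (hrep : ∀ l, ¬[l, l] <:+: g.toWord.take (2 * m + 1)) (hg : hd g = some (starter s)) :
    List.replicate m (1, s) <:+: (MulEquiv.symm autL g).toWord := by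
  obtain ⟨w, rfl, hw⟩ := exists_pow_mul hlen hs hrep hg
  rw [map_mul, map_pow, MulEquiv.symm_apply_apply, toWord_pow_mul]
  · exact (List.prefix_append _ _).isInfix
  · cases s
    · rw [hd_autL_symm_eq_b_inv.2 hw]; decide
    · intro h
      have := hd_autL_symm_eq_b_inv.1 h
      rw [hw] at this
      simp [starter] at this

theorem replicate_infix_move {s : Bool} {m : ℕ} {g : F} (hlen : 2 * m + 2 ≤ g.toWord.length)
    (hs : Mono false s (g.toWord.take (2 * m + 2)))
    (hrep : ∀ l, ¬[l, l] <:+: g.toWord.take (2 * m + 2)) (j : Bool) :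
    List.replicate m (1, s) <:+: (move (some (false, j)) g).toWord := by
  have key : List.replicate m (1, s) <:+: (MulEquiv.symm autL g).toWord := by
    rcases hd_cases g with rfl | ⟨l, k, rfl, hk, hw⟩
    · simp at hlen
    · have hl : l.2 = s := by
        rw [hw, List.take_succ_cons] at hs
        simpa [sg] using hs l (by simp)
      subst hl
      by_cases hst : l = starter l.2
      · have hsub : (lt l * k).toWord.take (2 * m + 1) <:+: (lt l * k).toWord.take (2 * m + 2) :=
          (List.take_prefix_take_left (by omega)).isInfix
        exact replicate_infix_autL_symm (by omega) (hs.of_isInfix hsub)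
          (fun l h => hrep l (h.trans hsub)) (by rw [hd, hw, List.head?_cons, ← hst])
      · have hfo := (eq_starter_or l).resolve_left hst
        rw [hw, List.take_succ_cons] at hs hrep
        rw [hw, List.length_cons] at hlen
        have hsuf : k.toWord.take (2 * m + 1) <:+: l :: k.toWord.take (2 * m + 1) :=
          (List.suffix_cons _ _).isInfix
        have := replicate_infix_autL_symm (g := k) (by omega) (hs.of_isInfix hsuf)
          (fun l h => hrep l (h.trans hsuf)) (by
            rcases hd_cases k with rfl | ⟨l', k, rfl, -, hw'⟩
            · simp at hlen
            · rw [hw', List.take_succ_cons] at hs hrep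
              have h₁ : l'.2 = l.2 := by
                have := hs l' (by simp)
                simpa [sg] using this
              rw [hd, hw', List.head?_cons, Option.some.injEq, ← h₁]
              refine (eq_starter_or l').resolve_right fun h => hrep l ?_
              rw [h₁, ← hfo] at h
              subst h
              exact ⟨[], _, rfl⟩)
        rw [map_mul]
        rcases letter_cases l with rfl | rfl | rfl | rfl
        · simp [starter] at hst
        · rw [show MulEquiv.symm autL (lt (0, false)) = lt (0, false) by
            rw [autL_symm_apply]; simp]
          exact replicate_infix_lt_mul (by simp [linv]) this
        · rw [show MulEquiv.symm autL (lt (1, true)) = lt (0, false) * lt (1, true) by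
            rw [autL_symm_apply]; simp, mul_assoc]
          exact replicate_infix_lt_mul (by simp [linv])
            (replicate_infix_lt_mul (by simp [linv]) this)
        · simp [starter] at hst
  cases j
  · rwa [move_false_false]
  · rw [move_false_true, map_mul, show MulEquiv.symm autL a = lt (0, true) by
      rw [autL_symm_apply]; simp]
    exact replicate_infix_lt_mul (by simp [linv]) key

theorem mem_take_of_runLE {E n : ℕ} {w : List Letter} {s : Bool} (hE : RunLE E w)
    (hs : Mono false s (w.take n)) (hn : E < n) (hw : n ≤ w.length) (i : Fin 2) :
    (i, s) ∈ w.take n := by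
  by_contra hcon
  have h := length_le_of_forall_eq (hE.of_isInfix (List.take_prefix n w).isInfix) (l := (i + 1, s))
    fun x hx => by
      have h₁ : x.2 = s := by simpa [sg] using hs x hx
      refine Prod.ext ?_ h₁
      by_contra h₂
      have h₃ : x.1 = i := by
        change ¬x.1 = i + 1 at h₂
        generalize x.1 = j at h₂
        clear hcon
        revert i j; decide
      exact hcon (by rw [← h₁, ← h₃]; exact hx)
  rw [List.length_take] at h
  omega

theorem lg_swapInv {k s : Bool} {R : ℕ} {g : F} (h : Lg k s R g) :
    Lg k (xor s (!k)) R (swapInv g) := by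
  obtain ⟨h₁, h₂, l, hl, l', hl', hne⟩ := h
  have hf {x y : Letter} (h : x.1 ≠ y.1) : (swapL x).1 ≠ (swapL y).1 := by
    revert h; revert x y; unfold swapL; decide
  rw [Lg, toWord_swapInv, ← List.map_take]
  refine ⟨by simpa using h₁, fun x hx => ?_, _, List.mem_map_of_mem hl, _, List.mem_map_of_mem hl',
    hf hne⟩
  obtain ⟨y, hy, rfl⟩ := List.mem_map.1 hx
  rw [sg_swapL, h₂ y hy]

/-- A long positive or negative leg does not become alternating in both children of a chamber. -/
theorem exists_not_lg_true_move {E R : ℕ} (hR : 4 * E + 10 ≤ R) {g : F} {s : Bool}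
    (hE : RunLE E g.toWord) (hg : Lg false s R g) :
    ∃ x, ∀ j, RunLE E (move (some (x, j)) g).toWord →
      ∀ s', ¬Lg true s' R (move (some (x, j)) g) := by
  have hlen : 2 * (E + 1) + 2 ≤ g.toWord.length := by have := hg.1; omega
  have hs : Mono false s (g.toWord.take (2 * (E + 1) + 2)) :=
    hg.2.1.of_isInfix (List.take_prefix_take_left (by omega)).isInfix
  by_cases hrep : ∃ l, [l, l] <:+: g.toWord.take (2 * (E + 1) + 2)
  · obtain ⟨⟨i, s₁⟩, hl⟩ := hrep
    have hi : i = 0 ∨ i = 1 := by clear hl; revert i; decide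
    have hs₁ : s₁ = s := by simpa [sg] using hs (i, s₁) (hl.subset (by simp))
    subst hs₁
    have hmem := mem_take_of_runLE hE hs (by omega) hlen
    rcases hi with rfl | rfl
    · exact ⟨false, fun j _ s' => not_lg_true_move hl (hmem 1) j s' (by omega)⟩
    · refine ⟨true, fun j _ s' h => ?_⟩
      rw [move_true] at h
      have h := lg_swapInv h
      rw [swapInv_swapInv] at h
      refine not_lg_true_move (s := !s₁) ?_ ?_ j _ (n := 2 * (E + 1) + 2) (by omega) h
      · rw [toWord_swapInv, ← List.map_take]
        exact hl.map swapL
      · rw [toWord_swapInv, ← List.map_take]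
        exact List.mem_map_of_mem (f := swapL) (hmem 0)
  · refine ⟨false, fun j hj => ?_⟩
    have := hj _ _ (replicate_infix_move hlen hs (fun l h => hrep ⟨l, h⟩) j)
    omega

theorem exists_longest_common_isPrefix (U V : List Letter) : ∃ w U' V', U = w ++ U' ∧ V = w ++ V' ∧
    ∀ l, U'.head? = some l → V'.head? ≠ some l := by
  induction U generalizing V with
  | nil => exact ⟨[], [], V, rfl, rfl, by simp⟩
  | cons x U ih =>
    rcases V with _ | ⟨y, V⟩
    · exact ⟨[], x :: U, [], rfl, rfl, by simp⟩
    · by_cases hxy : y = x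
      · subst hxy
        obtain ⟨w, U', V', rfl, rfl, h⟩ := ih V
        exact ⟨y :: w, U', V', rfl, rfl, h⟩
      · refine ⟨[], x :: U, y :: V, rfl, rfl, fun l h₁ h₂ => hxy ?_⟩
        simp only [List.head?_cons, Option.some.injEq] at h₁ h₂
        rw [h₁, h₂]

theorem exists_sep₃ (u v : F) : ∃ p : F, Sep₃ p⁻¹ (p⁻¹ * u) (p⁻¹ * v) := by
  obtain ⟨w, U, V, hu, hv, h⟩ := exists_longest_common_isPrefix u.toWord v.toWord
  obtain ⟨p, rfl⟩ := exists_toWord_eq_of_isPrefix (⟨U, hu.symm⟩ : w <+: u.toWord)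
  have hpu : p.toWord <+: u.toWord := ⟨U, hu.symm⟩
  have hpv : p.toWord <+: v.toWord := ⟨V, hv.symm⟩
  refine ⟨p, isPrefix_iff_sep.1 hpu, isPrefix_iff_sep.1 hpv, ?_⟩
  rw [toWord_of_isPrefix hpu] at hu
  rw [toWord_of_isPrefix hpv] at hv
  intro l
  rw [hd, hd, List.append_cancel_left hu, List.append_cancel_left hv]
  exact h l

theorem runLE_of_sep {E : ℕ} {g h : F} (H : Sep g h) (hr : RunLE E (g⁻¹ * h).toWord) :
    RunLE E g.toWord ∧ RunLE E h.toWord := by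
  rw [toWord_inv_mul_of_sep H] at hr
  refine ⟨?_, hr.of_isInfix (List.suffix_append _ _).isInfix⟩
  have := (hr.of_isInfix (List.prefix_append _ _).isInfix).invRev
  rwa [FreeGroup.invRev_invRev] at this

/-- The directions of three points seen from `p`, in the coordinates of a chamber. -/
def Tri (ω : Chamber) (y x p : F) : Prop := Sep₃ p⁻¹ (p⁻¹ * co ω y) (p⁻¹ * co ω x)

theorem Tri.move {ω : Chamber} {y x p : F} {μ : Option (Bool × Bool)}
    (h : Sep₃ (move μ p⁻¹) (move μ (p⁻¹ * co ω y)) (move μ (p⁻¹ * co ω x))) :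
    Tri (moveChamber μ ω) y x (AutF2.move μ p⁻¹)⁻¹ := by
  rwa [Tri, inv_inv, ← move_mul_co, ← move_mul_co]

theorem runLE_leg {N D : ℕ} {y : F} (hy : y ∈ chamberProducts N D) {ω : Chamber}
    (hω : ω.2.length ≤ D + 1) {p : F} (h : Sep p⁻¹ (p⁻¹ * co ω y)) :
    RunLE (powBound N D) p⁻¹.toWord ∧ RunLE (powBound N D) (p⁻¹ * co ω y).toWord := by
  apply runLE_of_sep h
  rw [inv_inv, mul_inv_cancel_left]
  exact runLE_co hy hω

theorem mem_longChambers_of_lg {N D R : ℕ} (hR : powBound N D + 1 ≤ R) {y : F} {ω : Chamber}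
    (hω : ω.2.length ≤ D + 1) {p : F} (h : Sep p⁻¹ (p⁻¹ * co ω y)) {s : Bool}
    (hs : Lg false s R p⁻¹ ∨ Lg false s R (p⁻¹ * co ω y)) : ω ∈ longChambers N D y := by
  have hw := toWord_inv_mul_of_sep h
  rw [inv_inv, mul_inv_cancel_left] at hw
  rcases hs with ⟨h₁, h₂, -⟩ | ⟨h₁, h₂, -⟩
  · refine ⟨hω, !s, FreeGroup.invRev (p⁻¹.toWord.take R), ?_, h₂.invRev, ?_⟩
    · rw [hw]
      refine List.IsInfix.trans ?_ (List.prefix_append _ _).isInfix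
      rw [FreeGroup.invRev, FreeGroup.invRev, List.reverse_infix]
      exact (List.take_prefix _ _).isInfix.map _
    · rw [FreeGroup.invRev_length, List.length_take]
      omega
  · refine ⟨hω, s, (p⁻¹ * co ω y).toWord.take R, ?_, h₂, ?_⟩
    · rw [hw]
      exact (List.take_prefix _ _).isInfix.trans (List.suffix_append _ _).isInfix
    · rw [List.length_take]
      omega

/-- After some move the directions remain different and the first two are not joined by a long
monotone path. -/
def MoveGood (R : ℕ) (g h k : F) : Prop :=
  ∃ μ, Sep₃ (move μ g) (move μ h) (move μ k) ∧ ∀ κ, ¬PairLong κ R (move μ g) (move μ h)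

theorem MoveGood.swap {R : ℕ} {g h k : F} (H : MoveGood R g h k) : MoveGood R h g k := by
  obtain ⟨μ, ⟨h₁, h₂, h₃⟩, h₄⟩ := H
  exact ⟨μ, ⟨h₁.symm, h₃, h₂⟩, fun κ h => h₄ κ h.symm⟩

theorem Sep₃.rotate {g h k : F} (H : Sep₃ g h k) : Sep₃ g k h := ⟨H.2.1, H.1, H.2.2.symm⟩

theorem Sep₃.swap {g h k : F} (H : Sep₃ g h k) : Sep₃ h g k := ⟨H.1.symm, H.2.2, H.2.1⟩

theorem moveGood_of_forall {E R : ℕ} (hR : 4 * E + 10 ≤ R) {g h k ℓ : F} (H : Sep₃ g h k)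
    (hℓ : ℓ = g ∨ ℓ = h) (hlong : ∃ s, Lg false s R g ∨ Lg false s R h) (hE : RunLE E ℓ.toWord)
    (hmove : ∀ μ : Bool × Bool, Sep₃ (move μ g) (move μ h) (move μ k) →
      RunLE E (move μ ℓ).toWord ∧ ¬PairLong false R (move μ g) (move μ h)) :
    MoveGood R g h k := by
  by_contra hcon
  have hcon (μ) (hμ : Sep₃ (move μ g) (move μ h) (move μ k)) :
      ∃ κ, PairLong κ R (move μ g) (move μ h) := by
    by_contra! h'
    exact hcon ⟨μ, hμ, h'⟩
  obtain ⟨κ, s, h₁, h₂⟩ := hcon none H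
  cases κ with
  | true =>
    obtain ⟨s', h' | h'⟩ := hlong
    · exact not_lg_true h' h₁
    · exact not_lg_true h' h₂
  | false =>
    obtain ⟨s', hs'⟩ : ∃ s', Lg false s' R ℓ := by
      rcases hℓ with rfl | rfl
      exacts [⟨_, h₁⟩, ⟨_, h₂⟩]
    obtain ⟨x, hx⟩ := exists_not_lg_true_move hR hE hs'
    obtain ⟨j, hj⟩ := exists_sep₃_move x H
    obtain ⟨h₃, h₄⟩ := hmove (x, j) hj
    obtain ⟨κ, s'', h₅, h₆⟩ := hcon _ hj
    cases κ with
    | true =>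
      rcases hℓ with rfl | rfl
      exacts [hx j h₃ _ h₅, hx j h₃ _ h₆]
    | false => exact h₄ ⟨s'', h₅, h₆⟩

/-- A chamber and a point which separate three points at which no long monotone path turns. -/
def IsCenter (D R : ℕ) (y x : F) (ω : Chamber) (p : F) : Prop :=
  ω.2.length ≤ D ∧ MoveGood R p⁻¹ (p⁻¹ * co ω y) (p⁻¹ * co ω x) ∧
    MoveGood R p⁻¹ (p⁻¹ * co ω x) (p⁻¹ * co ω y) ∧
    MoveGood R (p⁻¹ * co ω y) (p⁻¹ * co ω x) p⁻¹

theorem exists_isCenter {N D R : ℕ} (hR : 4 * powBound N D + 10 ≤ R) {y : F}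
    (hy : y ∈ chamberProducts N D) (x : F) : ∃ ω p, IsCenter D R y x ω p ∧ Tri ω y x p ∧
      (ω = (false, []) ∨ ∃ s, Lg false s R p⁻¹ ∨ Lg false s R (p⁻¹ * co ω y)) := by
  let Λ : Set Chamber := {ω | ω.2.length ≤ D + 1 ∧ ∃ p, Tri ω y x p ∧
    (PairLong false R p⁻¹ (p⁻¹ * co ω y) ∨ PairLong false R p⁻¹ (p⁻¹ * co ω x) ∨
      PairLong false R (p⁻¹ * co ω y) (p⁻¹ * co ω x))}
  have hlg {ω : Chamber} {p : F}
      (h : PairLong false R p⁻¹ (p⁻¹ * co ω y) ∨ PairLong false R p⁻¹ (p⁻¹ * co ω x) ∨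
      PairLong false R (p⁻¹ * co ω y) (p⁻¹ * co ω x)) :
      ∃ s, Lg false s R p⁻¹ ∨ Lg false s R (p⁻¹ * co ω y) := by
    rcases h with ⟨s, h, -⟩ | ⟨s, h, -⟩ | ⟨s, h, -⟩
    exacts [⟨_, .inl h⟩, ⟨_, .inl h⟩, ⟨_, .inr h⟩]
  have hΛ {ω : Chamber} (hω : ω ∈ Λ) : ω.2.length ≤ D := by
    obtain ⟨h₁, p, h₂, h₃⟩ := hω
    obtain ⟨s, h⟩ := hlg h₃
    exact length_le_of_mem_longChambers hy (mem_longChambers_of_lg (by omega) h₁ h₂.1 h)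
  rcases Λ.eq_empty_or_nonempty with he | hne
  · obtain ⟨p, hp⟩ := exists_sep₃ y x
    have hroot (κ : Bool) {g h : F} (hgh : (g = p⁻¹ ∧ (h = p⁻¹ * y ∨ h = p⁻¹ * x)) ∨
        g = p⁻¹ * y ∧ h = p⁻¹ * x) : ¬PairLong κ R g h := by
      intro H
      cases κ with
      | false =>
        have : (false, []) ∈ Λ := ⟨by simp, p, by simpa [Tri] using hp, by
          rcases hgh with ⟨rfl, rfl | rfl⟩ | ⟨rfl, rfl⟩ <;> simp [H]⟩
        simp [he] at this
      | true =>
        have hflip {g h : F} (H : Sep g h) : Sep (flipB g) (flipB h) := by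
          intro l h₁ h₂
          rw [hd_flipB_eq] at h₁ h₂
          exact H _ h₁ h₂
        have H := H.flipB
        have : (true, []) ∈ Λ := by
          refine ⟨by simp, flipB p, ?_, ?_⟩
          · rw [Tri, co_true_nil, co_true_nil, ← map_inv, ← map_mul, ← map_mul]
            exact ⟨hflip hp.1, hflip hp.2.1, hflip hp.2.2⟩
          · rw [co_true_nil, co_true_nil, ← map_inv, ← map_mul, ← map_mul]
            rcases hgh with ⟨rfl, rfl | rfl⟩ | ⟨rfl, rfl⟩
            exacts [.inl H, .inr (.inl H), .inr (.inr H)]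
        simp [he] at this
    refine ⟨(false, []), p, ⟨by simp, ?_, ?_, ?_⟩, by simpa [Tri] using hp, .inl rfl⟩ <;>
      rw [co_false_nil, co_false_nil]
    · exact ⟨none, hp, fun κ => hroot κ (g := p⁻¹) (h := p⁻¹ * y) (.inl ⟨rfl, .inl rfl⟩)⟩
    · exact ⟨none, hp.rotate, fun κ => hroot κ (g := p⁻¹) (h := p⁻¹ * x) (.inl ⟨rfl, .inr rfl⟩)⟩
    · exact ⟨none, hp.swap.rotate, fun κ => hroot κ (.inr ⟨rfl, rfl⟩)⟩
  · obtain ⟨ω, hω, hmax⟩ : ∃ ω ∈ Λ, ∀ ω' ∈ Λ, ω'.2.length ≤ ω.2.length := by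
      have hb : BddAbove ((fun ω : Chamber => ω.2.length) '' Λ) :=
        ⟨D, by rintro _ ⟨ω, hω, rfl⟩; exact hΛ hω⟩
      obtain ⟨ω, hω, h⟩ := Nat.sSup_mem (hne.image _) hb
      refine ⟨ω, hω, fun ω' hω' => ?_⟩
      have := le_csSup hb ⟨ω', hω', rfl⟩
      rwa [← h] at this
    have hωD := hΛ hω
    obtain ⟨-, p, hp, hlong⟩ := hω
    have hmv (μ : Bool × Bool)
        (h : Sep₃ (move μ p⁻¹) (move μ (p⁻¹ * co ω y)) (move μ (p⁻¹ * co ω x))) :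
        (RunLE (powBound N D) (move μ p⁻¹).toWord ∧
          RunLE (powBound N D) (move μ (p⁻¹ * co ω y)).toWord) ∧
        ¬PairLong false R (move μ p⁻¹) (move μ (p⁻¹ * co ω y)) ∧
        ¬PairLong false R (move μ p⁻¹) (move μ (p⁻¹ * co ω x)) ∧
        ¬PairLong false R (move μ (p⁻¹ * co ω y)) (move μ (p⁻¹ * co ω x)) := by
      have hlen : (moveChamber (some μ) ω).2.length = ω.2.length + 1 := by simp [moveChamber]
      have htri := Tri.move h
      have hnot (hmem : moveChamber (some μ) ω ∈ Λ) : False := by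
        have := hmax _ hmem
        omega
      have hr := runLE_leg hy (by omega) htri.1
      rw [inv_inv, ← move_mul_co] at hr
      refine ⟨hr, fun hcon => hnot ⟨by omega, _, htri, ?_⟩,
        fun hcon => hnot ⟨by omega, _, htri, ?_⟩,
        fun hcon => hnot ⟨by omega, _, htri, ?_⟩⟩ <;> rw [inv_inv, ← move_mul_co, ← move_mul_co]
      exacts [.inl hcon, .inr (.inl hcon), .inr (.inr hcon)]
    have hr := runLE_leg hy (by omega) hp.1
    refine ⟨ω, p, ⟨hωD, ?_, ?_, ?_⟩, hp, .inr (hlg hlong)⟩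
    · refine moveGood_of_forall hR hp (.inl rfl) ?_ hr.1 fun μ h => ⟨(hmv μ h).1.1, (hmv μ h).2.1⟩
      exact hlg hlong
    · refine moveGood_of_forall hR hp.rotate (.inl rfl) ?_ hr.1 fun μ h =>
        ⟨(hmv μ h.rotate).1.1, (hmv μ h.rotate).2.2.1⟩
      rcases hlong with ⟨s, h, -⟩ | ⟨s, h, -⟩ | ⟨s, -, h⟩
      exacts [⟨_, .inl h⟩, ⟨_, .inl h⟩, ⟨_, .inr h⟩]
    · refine moveGood_of_forall hR hp.swap.rotate (.inl rfl) ?_ hr.2 fun μ h =>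
        ⟨(hmv μ h.rotate.swap).1.2, (hmv μ h.rotate.swap).2.2.2⟩
      rcases hlong with ⟨s, -, h⟩ | ⟨s, -, h⟩ | ⟨s, h, -⟩
      exacts [⟨_, .inl h⟩, ⟨_, .inr h⟩, ⟨_, .inl h⟩]

/-- All but boundedly many prefixes of a concatenation of words end well inside one of them. -/
theorem encard_prefix_le {𝒞 : List Letter → Prop} (h𝒞 : ∀ u v, u <:+: v → 𝒞 v → 𝒞 u) (R : ℕ)
    (Ls : List (List Letter)) (hLs : ∀ u ∈ Ls, 𝒞 u) :
    {P : List Letter | ∃ S, P ++ S = Ls.flatten ∧ ¬∃ B C, B <:+ P ∧ C <+: S ∧ B.length = R ∧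
      C.length = R ∧ 𝒞 (B ++ C)}.encard ≤ (2 * R * Ls.length + 1 : ℕ) := by
  induction Ls with
  | nil =>
    refine (Set.encard_le_encard (t := {[]}) ?_).trans (by simp)
    rintro P ⟨S, h, -⟩
    simp_all
  | cons u Ls ih =>
    have ih := ih fun v hv => hLs v (List.mem_cons_of_mem _ hv)
    have hu := hLs u List.mem_cons_self
    have hcard (f : ℕ → List Letter) : (f '' Set.Iio R).encard ≤ (R : ℕ) := by
      refine (Set.encard_image_le _ _).trans ?_
      rw [← Finset.coe_Iio, Set.encard_coe_eq_coe_finsetCard]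
      simp
    refine (Set.encard_le_encard (t := ((u ++ ·) '' {P : List Letter | ∃ S, P ++ S = Ls.flatten ∧
      ¬∃ B C, B <:+ P ∧ C <+: S ∧ B.length = R ∧ C.length = R ∧ 𝒞 (B ++ C)}) ∪
      ((fun i => u.take i) '' Set.Iio R ∪ (fun i => u.take (u.length - i)) '' Set.Iio R)) ?_).trans
      ?_
    · rintro P ⟨S, h, hno⟩
      rw [List.flatten_cons, List.append_eq_append_iff] at h
      rcases h with ⟨U, rfl, rfl⟩ | ⟨P', rfl, h⟩
      · right
        by_cases h₁ : P.length < R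
        · exact .inl ⟨P.length, h₁, by simp⟩
        by_cases h₂ : U.length < R
        · exact .inr ⟨U.length, h₂, by simp⟩
        refine absurd ⟨P.drop (P.length - R), U.take R, List.drop_suffix _ _,
          (List.take_prefix _ _).trans (List.prefix_append _ _), by simp; omega, by simp; omega,
          h𝒞 _ _ ?_ hu⟩ hno
        refine ⟨P.take (P.length - R), U.drop R, ?_⟩
        rw [← List.append_assoc, List.take_append_drop, List.append_assoc, List.take_append_drop]
      · refine .inl ⟨P', ⟨S, h.symm, fun ⟨B, C, h₁, h₂⟩ => hno ⟨B, C, ?_, h₂⟩⟩, rfl⟩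
        exact h₁.trans (List.suffix_append _ _)
    · refine (Set.encard_union_le _ _).trans ((add_le_add ((Set.encard_image_le _ _).trans ih)
        ((Set.encard_union_le _ _).trans (add_le_add (hcard _) (hcard _)))).trans ?_)
      norm_cast
      rw [List.length_cons]
      exact le_of_eq (by ring)

theorem eq_of_fst_eq {k : Bool} {l m : Letter} (h₁ : l.1 = m.1) (h₂ : sg k l = sg k m) :
    l = m := by
  revert h₁ h₂; revert k l m; unfold sg; decide

theorem exists_ne_of_runLE {k s : Bool} {M : ℕ} {w : List Letter} (hw : Mono k s w)
    (hr : RunLE M w) (hM : M < w.length) : ∃ l ∈ w, ∃ l' ∈ w, l.1 ≠ l'.1 := by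
  by_contra! h
  obtain ⟨x, hx⟩ := List.exists_mem_of_length_pos (by omega : 0 < w.length)
  have := length_le_of_forall_eq hr (l := x) fun z hz =>
    eq_of_fst_eq (k := k) (h z hz x hx) ((hw z hz).trans (hw x hx).symm)
  omega

theorem lg_of_isPrefix {k s : Bool} {M R : ℕ} {g : F} {w : List Letter} (h : w <+: g.toWord)
    (hlen : w.length = R) (hw : Mono k s w) (hr : RunLE M w) (hM : M < R) : Lg k s R g := by
  have : g.toWord.take R = w := by
    obtain ⟨t, ht⟩ := h
    rw [← ht, ← hlen, List.take_left]
  refine ⟨hlen ▸ h.length_le, ?_, ?_⟩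
  · rwa [this]
  · rw [this]
    exact exists_ne_of_runLE hw hr (hlen ▸ hM)

theorem encard_cut_le {M N R : ℕ} (hR : M < R) {Y : Set F} (hY : ∀ y ∈ Y, Dec (Piece M) N y.toWord)
    (X : F) : {q : F | Sep q⁻¹ (q⁻¹ * X) ∧ (∀ κ, ¬PairLong κ R q⁻¹ (q⁻¹ * X)) ∧
      ∃ y ∈ Y, Sep q⁻¹ (q⁻¹ * y)}.encard ≤ (2 * R * N + 1 : ℕ) := by
  set Q := {q : F | Sep q⁻¹ (q⁻¹ * X) ∧ (∀ κ, ¬PairLong κ R q⁻¹ (q⁻¹ * X)) ∧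
      ∃ y ∈ Y, Sep q⁻¹ (q⁻¹ * y)} with hQ
  rcases Q.eq_empty_or_nonempty with he | hne
  · simp [he]
  have hpre {q : F} (hq : q ∈ Q) : q.toWord <+: X.toWord := isPrefix_iff_sep.2 hq.1
  obtain ⟨p, hp, hmax⟩ : ∃ p ∈ Q, ∀ q ∈ Q, q.toWord.length ≤ p.toWord.length := by
    have hb : BddAbove ((fun q : F => q.toWord.length) '' Q) :=
      ⟨X.toWord.length, by rintro _ ⟨q, hq, rfl⟩; exact (hpre hq).length_le⟩
    obtain ⟨p, hp, h⟩ := Nat.sSup_mem (hne.image _) hb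
    refine ⟨p, hp, fun q hq => ?_⟩
    have := le_csSup hb ⟨q, hq, rfl⟩
    rwa [← h] at this
  obtain ⟨y, hy, hpy⟩ := hp.2.2
  obtain ⟨Ls, hLs, h𝒞, hflat⟩ :=
    (hY y hy).of_isInfix Piece.of_isInfix (isPrefix_iff_sep.2 hpy).isInfix
  refine (Set.encard_le_encard_of_injOn (f := FreeGroup.toWord) ?_
    FreeGroup.toWord_injective.injOn).trans
    ((encard_prefix_le Piece.of_isInfix R Ls h𝒞).trans (by norm_cast; gcongr))
  intro q hq
  obtain ⟨S, hS⟩ := List.prefix_of_prefix_length_le (hpre hq) (hpre hp) (hmax q hq)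
  refine ⟨S, hS.trans hflat.symm, ?_⟩
  rintro ⟨B, C, hB, hC, hBl, hCl, ⟨k, s, hk⟩, hr⟩
  have hB' := (List.prefix_append B C).isInfix
  have hC' := (List.suffix_append B C).isInfix
  refine hq.2.1 k ⟨s, ?_, ?_⟩
  · refine lg_of_isPrefix (w := FreeGroup.invRev B) ?_ (by simpa using hBl)
      (hk.of_isInfix hB').invRev
      (hr.of_isInfix hB').invRev hR
    rw [FreeGroup.toWord_inv, FreeGroup.invRev, FreeGroup.invRev, List.reverse_prefix]
    exact hB.map _
  · refine lg_of_isPrefix (w := C) (hC.trans ?_) hCl (hk.of_isInfix hC') (hr.of_isInfix hC') hR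
    have h := hpre hp
    rw [← hS, toWord_of_isPrefix (hpre hq)] at h
    exact (List.prefix_append_right_inj _).1 h

/-- The points at which, in the coordinates of a chamber, a word branches off a product of `N`
elements of bases without following a long monotone path. -/
def Cut (N D R : ℕ) (ω : Chamber) (X : F) : Set F :=
  {q | ω.2.length ≤ D ∧ ∃ μ, Sep (move μ q⁻¹) (move μ (q⁻¹ * co ω X)) ∧
    (∀ κ, ¬PairLong κ R (move μ q⁻¹) (move μ (q⁻¹ * co ω X))) ∧
    ∃ y ∈ chamberProducts N D, Sep (move μ q⁻¹) (move μ (q⁻¹ * co ω y))}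

theorem encard_Cut_le {N D R : ℕ} (hR : 2 * D + 3 < R) (ω : Chamber) (X : F) :
    (Cut N D R ω X).encard ≤ (5 * (2 * R * N + 1) : ℕ) := by
  by_cases hω : ω.2.length ≤ D
  swap
  · simp [Cut, hω]
  let s (μ : Option (Bool × Bool)) : Set F := {q | Sep (move μ q⁻¹) (move μ (q⁻¹ * co ω X)) ∧
    (∀ κ, ¬PairLong κ R (move μ q⁻¹) (move μ (q⁻¹ * co ω X))) ∧
    ∃ y ∈ chamberProducts N D, Sep (move μ q⁻¹) (move μ (q⁻¹ * co ω y))}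
  have hs (μ : Option (Bool × Bool)) : (s μ).encard ≤ (2 * R * N + 1 : ℕ) := by
    refine (Set.encard_le_encard_of_injOn (f := fun q => (move μ q⁻¹)⁻¹) ?_ ?_).trans
      (encard_cut_le (Y := co (moveChamber μ ω) '' chamberProducts N D) hR ?_
        (co (moveChamber μ ω) X))
    · rintro q ⟨h₁, h₂, y, hy, h₃⟩
      simp only [move_mul_co] at h₁ h₂ h₃
      simp only [Set.mem_ofPred_eq, inv_inv]
      exact ⟨h₁, h₂, _, ⟨y, hy, rfl⟩, h₃⟩
    · exact fun q _ q' _ h => inv_injective (move_injective μ (inv_injective h))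
    · rintro _ ⟨y, hy, rfl⟩
      exact dec_piece_co hy ((length_moveChamber μ ω).trans (by omega))
  refine (Set.encard_le_encard ?_).trans (encard_biUnion_le_mul (A := Set.univ) (s := s) ?_
    fun μ _ => hs μ)
  · rintro q ⟨-, μ, h⟩
    exact Set.mem_biUnion (Set.mem_univ μ) h
  · simp [Set.encard_univ]

theorem encard_le_of_forall_or_mem {α : Type*} {S : Set α} {L : α → Set α} {κ : ℕ}
    (hL : ∀ a ∈ S, (L a).encard ≤ κ) (h : ∀ a ∈ S, ∀ b ∈ S, a ≠ b → a ∈ L b ∨ b ∈ L a) :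
    S.encard ≤ (2 * κ + 1 : ℕ) := by
  classical
  by_contra! hcon
  obtain ⟨T, hT, hcard⟩ := Set.exists_subset_encard_eq (k := (2 * κ + 2 : ℕ))
    (Order.add_one_le_of_lt hcon)
  lift T to Finset α using Set.finite_of_encard_eq_coe hcard
  rw [Set.encard_coe_eq_coe_finsetCard, Nat.cast_inj] at hcard
  let P := (T ×ˢ T).filter fun q => q.1 ∈ L q.2
  have hP : P.card ≤ κ * T.card := by
    refine Finset.card_le_mul_card_image_of_maps_to (f := Prod.snd) ?_ _ fun b hb => ?_
    · intro q hq
      exact (Finset.mem_product.1 (Finset.mem_filter.1 hq).1).2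
    · have : (({q ∈ P | q.2 = b} : Finset (α × α)) : Set (α × α)).encard ≤ κ := by
        refine (Set.encard_le_encard_of_injOn (f := Prod.fst) ?_ ?_).trans (hL b (hT hb))
        · rintro q hq
          simp only [Finset.coe_filter, Set.mem_ofPred_eq, P, Finset.mem_filter] at hq
          exact hq.2 ▸ hq.1.2
        · intro q hq q' hq' hqq
          simp only [Finset.coe_filter, Set.mem_ofPred_eq] at hq hq'
          exact Prod.ext hqq (hq.2.trans hq'.2.symm)
      rw [Set.encard_coe_eq_coe_finsetCard] at this
      exact_mod_cast this
  have hsub : T.offDiag ⊆ P ∪ P.image Prod.swap := by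
    rintro ⟨p, q⟩ hpq
    obtain ⟨hp, hq, hne⟩ := Finset.mem_offDiag.1 hpq
    rw [Finset.mem_union, Finset.mem_image]
    rcases h p (hT hp) q (hT hq) hne with h | h
    · exact .inl (Finset.mem_filter.2 ⟨Finset.mk_mem_product hp hq, h⟩)
    · exact .inr ⟨(q, p), Finset.mem_filter.2 ⟨Finset.mk_mem_product hq hp, h⟩, rfl⟩
  have h₁ := (Finset.card_le_card hsub).trans (Finset.card_union_le _ _)
  have h₂ := Finset.card_image_le (s := P) (f := Prod.swap)
  rw [Finset.offDiag_card, hcard] at h₁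
  rw [hcard] at hP
  have : (2 * κ + 2) * (2 * κ + 2) = 2 * (κ * (2 * κ + 2)) + 2 * (2 * κ + 2) := by ring
  omega

theorem exists_consecutive {w : List Letter} (h : ∃ l ∈ w, ∃ l' ∈ w, l.1 ≠ l'.1) :
    ∃ U x y V, w = U ++ x :: y :: V ∧ x.1 ≠ y.1 := by
  by_contra! hcon
  have : IsTrans Letter fun x y => x.1 = y.1 := ⟨fun _ _ _ => Eq.trans⟩
  have hw := List.isChain_iff_pairwise.1 (List.isChain_iff_forall_rel_of_append_cons_cons.2
    fun {x y U V} (h : w = _) => hcon U x y V h)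
  obtain ⟨l, hl, l', hl', hne⟩ := h
  have : Std.Symm fun x y : Letter => x.1 = y.1 := ⟨fun _ _ => Eq.symm⟩
  exact hne (List.Pairwise.forall_of_forall (R := fun x y : Letter => x.1 = y.1)
    (fun _ _ => rfl) hw hl hl')

theorem hd_inv_mul_eq_iff {p : F} {w : List Letter} {l : Letter} (hp : p.toWord = w ++ [l])
    (g : F) : hd (p⁻¹ * g) = some (linv l) ↔ ¬p.toWord <+: g.toWord := by
  have hl : hd p⁻¹ = some (linv l) := by simp [hd_inv, hp]
  rw [isPrefix_iff_sep]
  refine ⟨fun h H => H _ hl h, fun h => ?_⟩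
  simp only [Sep, not_forall, not_not] at h
  obtain ⟨l', h₁, h₂⟩ := h
  rwa [hl.symm.trans h₁]

theorem hd_inv_mul_of_isPrefix {p g : F} {l : Letter} (h : p.toWord ++ [l] <+: g.toWord) :
    hd (p⁻¹ * g) = some l := by
  have hp : p.toWord <+: g.toWord := (List.prefix_append _ _).trans h
  rw [toWord_of_isPrefix hp, List.prefix_append_right_inj] at h
  obtain ⟨t, ht⟩ := h
  rw [hd, ← ht]
  rfl

theorem exists_suffix_of_lg {s : Bool} {R : ℕ} {p : F} (h : Lg false s R p⁻¹) :
    ∃ Z W, p.toWord = Z ++ W ∧ W.length = R ∧ Mono false (!s) W := by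
  have hp : p.toWord = FreeGroup.invRev p⁻¹.toWord := by rw [← FreeGroup.toWord_inv, inv_inv]
  refine ⟨FreeGroup.invRev (p⁻¹.toWord.drop R), FreeGroup.invRev (p⁻¹.toWord.take R), ?_, ?_,
    h.2.1.invRev⟩
  · rw [hp, ← FreeGroup.invRev_append, List.take_append_drop]
  · rw [FreeGroup.invRev_length, List.length_take, min_eq_left h.1]

/-- Two long stems of the same depth cannot both be invisible from each other. -/
theorem mem_longChambers_or {N D R : ℕ} (hR : 2 * powBound N D + 2 ≤ R) {x y₁ y₂ : F}
    {ω₁ ω₂ : Chamber} (hω₁ : ω₁.2.length ≤ D) (hlen : ω₁.2.length = ω₂.2.length) (hne : ω₁ ≠ ω₂)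
    (hy₁ : y₁ ∈ chamberProducts N D) {p₁ p₂ : F} {s₁ s₂ : Bool}
    (hpy₁ : p₁.toWord <+: (co ω₁ y₁).toWord) (hpx₁ : p₁.toWord <+: (co ω₁ x).toWord)
    (h₁ : Lg false s₁ R p₁⁻¹) (hpy₂ : p₂.toWord <+: (co ω₂ y₂).toWord)
    (hpx₂ : p₂.toWord <+: (co ω₂ x).toWord) (h₂ : Lg false s₂ R p₂⁻¹) :
    ω₁ ∈ longChambers N D y₂ ∨ ω₂ ∈ longChambers N D y₁ := by
  by_contra! hcon
  obtain ⟨hcon₁, hcon₂⟩ := hcon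
  obtain ⟨Z, W, hp₁, hW, hmono⟩ := exists_suffix_of_lg h₁
  obtain ⟨Z₂, W₂, hp₂, hW₂, hmono₂⟩ := exists_suffix_of_lg h₂
  set E := powBound N D
  have hrun : RunLE E p₁.toWord := (runLE_co hy₁ (by omega)).of_isInfix hpy₁.isInfix
  rw [← List.take_append_drop (E + 1) W] at hp₁
  have hdrop := (List.drop_suffix (E + 1) W).isInfix
  obtain ⟨U, f₁, f₂, V, hUV, hf⟩ := exists_consecutive (exists_ne_of_runLE (hmono.of_isInfix hdrop)
    (hrun.of_isInfix (hp₁ ▸ ((List.suffix_append _ _).trans (List.suffix_append _ _)).isInfix))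
    (by rw [List.length_drop]; omega))
  have hs {l : Letter} (hl : l ∈ W.drop (E + 1)) : sg false l = !s₁ := hmono l (hdrop.subset hl)
  have hs₁ : sg false f₁ = !s₁ := hs (by simp [hUV])
  have hs₂ : sg false f₂ = !s₁ := hs (by simp [hUV])
  have hp₁' : p₁.toWord = (Z ++ W.take (E + 1) ++ U ++ [f₁]) ++ [f₂] ++ V := by
    rw [hp₁, hUV]
    simp
  obtain ⟨m, hm⟩ := exists_toWord_eq_of_isPrefix (g := p₁) (w := Z ++ W.take (E + 1) ++ U ++ [f₁])
    ⟨[f₂] ++ V, by simp [hp₁']⟩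
  have hmp : m.toWord ++ [f₂] <+: p₁.toWord := ⟨V, by rw [hm, hp₁']⟩
  obtain ⟨W₃, l, rfl⟩ : ∃ W₃ l, W₂ = W₃ ++ [l] := by
    refine ⟨_, _, (List.dropLast_append_getLast (l := W₂) ?_).symm⟩
    rintro rfl
    simp at hW₂
    omega
  rw [← List.append_assoc] at hp₂
  obtain ⟨k, k', n, -, hpath, hk'⟩ := exists_path ω₁ ω₂
  have hk' : k' = true := by
    refine hk'.resolve_left fun ⟨h, h'⟩ => hne (Prod.ext h ?_)
    exact h'.eq_of_length hlen
  subst hk'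
  have hturn := hpath.noTurn (noTurn_cone k p₂ (linv l))
  set K := ((phi ω₁)⁻¹ * phi ω₂) '' cone p₂ (linv l)
  have hK (g : F) : co ω₁ g ∈ K ↔ ¬p₂.toWord <+: (co ω₂ g).toWord := by
    rw [← hd_inv_mul_eq_iff hp₂]
    conv_lhs => rw [← phi_co ω₂ g, co_phi_eq]
    exact Function.Injective.mem_set_image (MulEquiv.injective _)
  have hsplit₁ : Split K (cone m f₂) := by
    refine ⟨⟨co ω₁ y₁, hd_inv_mul_of_isPrefix (hmp.trans hpy₁), (hK _).2 fun h => hcon₂ ?_⟩,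
      ⟨co ω₁ x, hd_inv_mul_of_isPrefix (hmp.trans hpx₁), fun h => (hK _).1 h hpx₂⟩⟩
    refine ⟨by omega, _, _, ?_, hmono₂, by omega⟩
    refine List.IsInfix.trans (List.IsSuffix.isInfix ?_) h.isInfix
    exact ⟨Z₂, by rw [hp₂, List.append_assoc]⟩
  have hsplit₂ : Split K (cone m (linv f₁)) := by
    refine ⟨⟨co ω₁ 1, (hd_inv_mul_eq_iff hm _).2 ?_, (hK _).2 ?_⟩,
      ⟨co ω₁ y₂, (hd_inv_mul_eq_iff hm _).2 fun h => hcon₁ ?_, fun h => (hK _).1 h hpy₂⟩⟩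
    · simp [hm]
    · simp [hp₂]
    · refine ⟨by omega, _, W.take (E + 1), ?_, hmono.of_isInfix (List.take_prefix _ _).isInfix,
        by rw [List.length_take]; omega⟩
      refine List.IsInfix.trans ?_ h.isInfix
      exact ⟨Z, U ++ [f₁], by rw [hm]; simp⟩
  have hcases : (f₂ = (0, !s₁) ∧ linv f₁ = (1, xor (!s₁) true)) ∨
      (linv f₁ = (0, s₁) ∧ f₂ = (1, xor s₁ true)) := by
    clear * - hf hs₁ hs₂
    revert hf hs₁ hs₂
    revert f₁ f₂ s₁
    unfold sg linv
    decide
  rcases hcases with ⟨h, h'⟩ | ⟨h, h'⟩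
  · exact hturn m _ ⟨h ▸ hsplit₁, h' ▸ hsplit₂⟩
  · exact hturn m _ ⟨h ▸ hsplit₂, h' ▸ hsplit₁⟩

/-- The chambers in whose coordinates a word shares a long stem with a product of `N` elements of
bases. -/
def stems (N D R : ℕ) (x : F) : Set Chamber :=
  {ω | ω.2.length ≤ D ∧ ∃ y ∈ chamberProducts N D, ∃ p : F, p.toWord <+: (co ω y).toWord ∧
    p.toWord <+: (co ω x).toWord ∧ ∃ s, Lg false s R p⁻¹}

theorem encard_stems_le {N D R : ℕ} (hR : 2 * powBound N D + 2 ≤ R) (x : F) :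
    (stems N D R x).encard ≤ ((D + 1) * (2 * (N * (D + 1)) + 1) : ℕ) := by
  choose! y hy p hpy hpx s hs using fun (ω : Chamber) (hω : ω ∈ stems N D R x) => hω.2
  refine (Set.encard_le_encard (t := ⋃ d ∈ Set.Iio (D + 1),
    {ω | ω ∈ stems N D R x ∧ ω.2.length = d}) ?_).trans (encard_biUnion_le_mul ?_ fun d _ => ?_)
  · intro ω hω
    exact Set.mem_biUnion (Set.mem_Iio.2 (Nat.lt_succ_of_le hω.1)) ⟨hω, rfl⟩
  · rw [← Finset.coe_Iio, Set.encard_coe_eq_coe_finsetCard, Nat.card_Iio]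
  · refine encard_le_of_forall_or_mem (L := fun ω => longChambers N D (y ω))
      (fun ω hω => encard_longChambers_le (hy ω hω.1)) ?_
    rintro ω₁ ⟨h₁, hd⟩ ω₂ ⟨h₂, hd'⟩ hne
    exact mem_longChambers_or hR h₁.1 (hd.trans hd'.symm) hne (hy _ h₁) (hpy _ h₁) (hpx _ h₁)
      (hs _ h₁) (hpy _ h₂) (hpx _ h₂) (hs _ h₂)

theorem mem_Cut_of_moveGood {N D R : ℕ} {ω : Chamber} {q X y : F} (hω : ω.2.length ≤ D)
    (hy : y ∈ chamberProducts N D) (h : MoveGood R q⁻¹ (q⁻¹ * co ω X) (q⁻¹ * co ω y)) :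
    q ∈ Cut N D R ω X := by
  obtain ⟨μ, ⟨h₁, h₂, -⟩, h₃⟩ := h
  exact ⟨hω, μ, h₁, h₃, y, hy, h₂⟩

theorem encard_setOf_mem_Cut_le {N D R M : ℕ} (hR : 2 * D + 3 < R) {A : Set Chamber}
    (hA : A.encard ≤ M) (X : F) :
    {k : Chamber × F | k.1 ∈ A ∧ co k.1 k.2 ∈ Cut N D R k.1 X}.encard ≤
      (M * (5 * (2 * R * N + 1)) : ℕ) := by
  refine (Set.encard_le_encard (t := ⋃ ω ∈ A, (fun q => (ω, phi ω q)) '' Cut N D R ω X) ?_).trans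
    (encard_biUnion_le_mul hA fun ω _ => (Set.encard_image_le _ _).trans (encard_Cut_le hR ω X))
  rintro ⟨ω, g⟩ ⟨h₁, h₂⟩
  exact Set.mem_biUnion h₁ ⟨_, h₂, Prod.ext rfl (phi_co ω g)⟩

/-- The triangles with a center which can be recovered from two of their sides. -/
def stemTriangles (N D R : ℕ) : Set (F × F) :=
  {q | q.1 ∈ chamberProducts N D ∧ ∃ ω p, IsCenter D R q.1 (q.1 * q.2) ω p ∧
    Tri ω q.1 (q.1 * q.2) p ∧ (ω = (false, []) ∨ ∃ s, Lg false s R p⁻¹)}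

theorem triBound_stemTriangles {N D R : ℕ} (hR : 2 * powBound N D + 2 ≤ R) (hR' : 2 * D + 3 < R) :
    TriBound (stemTriangles N D R) (((1 + (D + 1) * (2 * (N * (D + 1)) + 1)) *
      (5 * (2 * R * N + 1))) * (((1 + N * (D + 1)) * (5 * (2 * R * N + 1))) *
        (5 * (2 * R * N + 1)))) := by
  have hunion {A : Set Chamber} {M : ℕ} (hA : A.encard ≤ M) :
      ({(false, [])} ∪ A).encard ≤ (1 + M : ℕ) := by
    refine (Set.encard_union_le _ _).trans ?_
    rw [Set.encard_singleton, Nat.cast_add, Nat.cast_one]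
    gcongr
  refine triBound_of_exists_centroid _
    (fun y => {k | y ∈ chamberProducts N D ∧ k.1 ∈ {(false, [])} ∪ longChambers N D y ∧
      co k.1 k.2 ∈ Cut N D R k.1 y})
    (fun x => {k | k.1 ∈ {(false, [])} ∪ stems N D R x ∧ co k.1 k.2 ∈ Cut N D R k.1 x})
    (fun ω z => co ω ⁻¹' Cut N D R ω z) _ _ _ ?_ ?_ ?_ ?_
  · rintro ⟨y, z⟩ ⟨hy, ω, p, ⟨hω, h₁, h₂, h₃⟩, htri, hs⟩
    refine ⟨(ω, phi ω p), ⟨hy, ?_, ?_⟩, ⟨?_, ?_⟩, ?_⟩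
    · refine hs.imp id fun ⟨s, hs⟩ => ?_
      exact mem_longChambers_of_lg (by omega) (Nat.le_succ_of_le hω) htri.1 (.inl hs)
    · rw [co_phi]
      obtain ⟨μ, h, h'⟩ := h₁
      exact ⟨hω, μ, h.1, h', y, hy, h.1⟩
    · refine hs.imp id fun hs => ⟨hω, y, hy, p, ?_, ?_, hs⟩
      exacts [isPrefix_iff_sep.2 htri.1, isPrefix_iff_sep.2 htri.2.1]
    · rw [co_phi]
      exact mem_Cut_of_moveGood hω hy h₂
    · refine mem_Cut_of_moveGood hω (inv_mem_chamberProducts hy) ?_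
      simpa only [co_mul, co_inv, co_phi, mul_inv_rev, inv_inv, mul_assoc, mul_inv_cancel,
        mul_one] using h₃
  · intro y
    by_cases hy : y ∈ chamberProducts N D
    · simpa only [hy, true_and] using
        encard_setOf_mem_Cut_le hR' (hunion (encard_longChambers_le hy)) y
    · simp [hy]
  · exact fun x => encard_setOf_mem_Cut_le hR' (hunion (encard_stems_le hR x)) x
  · intro ω z
    refine (Set.encard_le_encard_of_injOn (f := co ω) ?_ (co_injective ω).injOn).trans
      (encard_Cut_le hR' ω z)
    exact fun g hg => hg

theorem subset_stemTriangles {N D R : ℕ} (hR : 4 * powBound N D + 10 ≤ R) :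
    {q : F × F | q.1 ∈ chamberProducts N D} ⊆
      stemTriangles N D R ∪ {q | (q.1⁻¹, q.1 * q.2) ∈ stemTriangles N D R} := by
  rintro ⟨y, z⟩ hy
  obtain ⟨ω, p, hc, htri, hs⟩ := exists_isCenter hR hy (y * z)
  have hs : (ω = (false, []) ∨ ∃ s, Lg false s R p⁻¹) ∨ ∃ s, Lg false s R (p⁻¹ * co ω y) := by
    rcases hs with hs | ⟨s, hs | hs⟩
    exacts [.inl (.inl hs), .inl (.inr ⟨s, hs⟩), .inr ⟨s, hs⟩]
  refine hs.imp (fun hs => ⟨hy, ω, p, hc, htri, hs⟩) fun hs => ?_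
  refine ⟨inv_mem_chamberProducts hy, ω, (co ω y)⁻¹ * p, ⟨hc.1, ?_, ?_, ?_⟩, ?_, .inr ?_⟩
  · simpa [co_mul, co_inv, mul_assoc] using hc.2.1.swap
  · simpa [co_mul, co_inv, mul_assoc] using hc.2.2.2
  · simpa [co_mul, co_inv, mul_assoc] using hc.2.2.1
  · simpa [Tri, co_mul, co_inv, mul_assoc] using htri.swap
  · simpa using hs

theorem exists_triBound_chamberProducts :
    ∃ A : ℕ, ∀ m, TriBound {q : F × F | q.1 ∈ chamberProducts m m} (A * (m + 1) ^ 14) := by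
  refine ⟨4 * (2 * (2 * 80 * (80 * 80))), fun m => ?_⟩
  set R := 4 * powBound m m + 2 * m + 10 with hR
  have h := triBound_stemTriangles (N := m) (D := m) (R := R) (by omega) (by omega)
  refine (h.union h.transpose).mono (subset_stemTriangles (by omega)) ?_
  have h₁ : 5 * (2 * R * m + 1) ≤ 80 * (m + 1) ^ 3 := by
    rw [hR, powBound]
    nlinarith
  have h₂ : 1 + m * (m + 1) ≤ (m + 1) ^ 2 := by nlinarith
  have h₃ : 1 + (m + 1) * (2 * (m * (m + 1)) + 1) ≤ 2 * (m + 1) ^ 3 := by nlinarith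
  generalize 5 * (2 * R * m + 1) = c at *
  rw [← two_mul]
  calc 4 * (2 * ((1 + (m + 1) * (2 * (m * (m + 1)) + 1)) * c * ((1 + m * (m + 1)) * c * c)))
      ≤ 4 * (2 * (2 * (m + 1) ^ 3 * (80 * (m + 1) ^ 3) * ((m + 1) ^ 2 * (80 * (m + 1) ^ 3) *
        (80 * (m + 1) ^ 3)))) := by gcongr
    _ = 4 * (2 * (2 * 80 * (80 * 80))) * (m + 1) ^ 14 := by ring

theorem exists_list_length_eq_wordLength {Γ : Type*} [Group Γ] {S : Set Γ}
    (hS : Subgroup.closure S = ⊤) (x : Γ) :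
    ∃ w : List Γ, w.length = wordLength S x ∧ (∀ s ∈ w, s ∈ S ∨ s⁻¹ ∈ S) ∧ w.prod = x := by
  obtain ⟨w, hw, h⟩ := exists_list_of_mem_closure (hS ▸ Subgroup.mem_top x)
  exact Nat.sInf_mem (s := {n : ℕ | ∃ w : List Γ, w.length = n ∧ (∀ s ∈ w, s ∈ S ∨ s⁻¹ ∈ S) ∧
    w.prod = x}) ⟨w.length, w, rfl, hw, h⟩

/-- Products of `n` standard generators or their inverses. -/
def IsWord (n : ℕ) (x : G) : Prop := ∃ w : List G, w.length ≤ n ∧ (∀ s ∈ w, IsGen s) ∧ w.prod = x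

theorem IsWord.mono {n m : ℕ} {x : G} (h : IsWord n x) (hnm : n ≤ m) : IsWord m x := by
  obtain ⟨w, h₁, h₂⟩ := h
  exact ⟨w, h₁.trans hnm, h₂⟩

theorem IsWord.mul {n m : ℕ} {x y : G} (hx : IsWord n x) (hy : IsWord m y) :
    IsWord (n + m) (x * y) := by
  obtain ⟨w, h₁, h₂, rfl⟩ := hx
  obtain ⟨v, h₃, h₄, rfl⟩ := hy
  refine ⟨w ++ v, by rw [List.length_append]; omega, fun s hs => ?_, List.prod_append⟩
  exact (List.mem_append.1 hs).elim (h₂ s) (h₄ s)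

theorem IsWord.inv {n : ℕ} {x : G} (hx : IsWord n x) : IsWord n x⁻¹ := by
  obtain ⟨w, h₁, h₂, rfl⟩ := hx
  refine ⟨(w.map fun s => s⁻¹).reverse, by simpa using h₁, fun s hs => ?_,
    (List.prod_inv_reverse w).symm⟩
  obtain ⟨t, ht, rfl⟩ := List.mem_map.1 (List.mem_reverse.1 hs)
  exact (h₂ t ht).inv

theorem IsWord.prod {n : ℕ} {w : List G} (hw : ∀ s ∈ w, IsWord n s) :
    IsWord (n * w.length) w.prod := by
  induction w with
  | nil => exact ⟨[], by simp⟩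
  | cons s w ih =>
    rw [List.prod_cons, List.length_cons, Nat.mul_succ, Nat.add_comm]
    exact (hw s List.mem_cons_self).mul (ih fun t ht => hw t (List.mem_cons_of_mem _ ht))

theorem IsWord.hasNormalForm {n : ℕ} {x : G} (hx : IsWord n x) : HasNormalForm x n := by
  obtain ⟨w, h₁, h₂, rfl⟩ := hx
  exact (hasNormalForm_prod w h₂).mono h₁

theorem exists_isWord (S : Finset G) : ∃ C, ∀ s ∈ S, IsWord C s := by
  choose w hw h using exists_word
  refine ⟨S.sup fun s => (w s).length, fun s hs => ⟨w s, ?_, hw s, h s⟩⟩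
  exact Finset.le_sup (f := fun s => (w s).length) hs

theorem exists_forall_isWord {S : Finset G} (hS : Subgroup.closure (S : Set G) = ⊤) :
    ∃ C, ∀ x, IsWord (C * wordLength (S : Set G) x) x := by
  obtain ⟨C, hC⟩ := exists_isWord S
  refine ⟨C, fun x => ?_⟩
  obtain ⟨w, hlen, hw, h⟩ := exists_list_length_eq_wordLength hS x
  rw [← hlen]
  conv => arg 2; rw [← h]
  refine IsWord.prod fun s hs => ?_
  rcases hw s hs with hs | hs
  · exact hC s hs
  · exact inv_inv s ▸ (hC _ hs).inv

theorem hasPropertyRD_wordLength {S : Finset G} (hS : Subgroup.closure (S : Set G) = ⊤) :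
    HasPropertyRD G fun x => (wordLength (S : Set G) x : ℝ) := by
  obtain ⟨C, hC⟩ := exists_forall_isWord hS
  obtain ⟨A₁, h₁⟩ := exists_triBound_chamberProducts
  obtain ⟨A₂, h₂⟩ := exists_triBound_out
  refine hasPropertyRD_of_triBound _ (A₁ * (6 * C + 1) ^ 14 * (A₂ * (C + 1) ^ 3)) 17 fun n => ?_
  have hball {x : G} (hx : wordLength (S : Set G) x ≤ n) : IsWord (C * n) x :=
    (hC x).mono (Nat.mul_le_mul_left C hx)
  refine (triBound_of_extension ad qm ad_injective (QuotientGroup.mk'_surjective _) ?_ qm_ad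
    {x : G | wordLength (S : Set G) x ≤ n} _ _ ((h₁ (6 * (C * n))).mono ?_ le_rfl)
    ((h₂ (C * n)).mono ?_ le_rfl)).mono subset_rfl ?_
  · intro g hg
    obtain ⟨x, hx⟩ := exists_ad_of_qm_eq (hg.trans (map_one qm).symm)
    exact ⟨x, by rw [hx, mul_one]⟩
  · rintro ⟨x, u⟩ ⟨y, hy, z, hz, h⟩
    have := ((hball hy).inv.mul (hball hz)).hasNormalForm
    rw [← h] at this
    exact chamberProducts_mono (by omega) (by omega) (mem_chamberProducts_of_hasNormalForm this)
  · rintro ⟨_, u⟩ ⟨x, hx, rfl⟩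
    exact ⟨x, (hball hx).hasNormalForm, rfl⟩
  · calc A₁ * (6 * (C * n) + 1) ^ 14 * (A₂ * (C * n + 1) ^ 3)
        ≤ A₁ * ((6 * C + 1) * (n + 1)) ^ 14 * (A₂ * ((C + 1) * (n + 1)) ^ 3) := by
          gcongr <;> nlinarith
      _ = A₁ * (6 * C + 1) ^ 14 * (A₂ * (C + 1) ^ 3) * (n + 1) ^ 17 := by ring

end AutF2

/-- The automorphism group `Aut(F₂)` of the free group on 2 generators is finitely
generated, and it has property RD with respect to the word length associated to
any finite generating set. -/
theorem autF2_fg_and_hasPropertyRD :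
    Group.FG (MulAut (FreeGroup (Fin 2))) ∧
    ∀ S : Finset (MulAut (FreeGroup (Fin 2))),
      Subgroup.closure (S : Set (MulAut (FreeGroup (Fin 2)))) = ⊤ →
      HasPropertyRD (MulAut (FreeGroup (Fin 2)))
        (fun x => (wordLength (S : Set (MulAut (FreeGroup (Fin 2)))) x : ℝ)) :=
  ⟨AutF2.fg_aut, fun _ => AutF2.hasPropertyRD_wordLength⟩
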